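/- arXiv:2503.16370 — 5 statements merged into one kernel-verified Lean document; each statement's English description precedes it below -/
import Mathlib

section
/- Let U and H be finite-dimensional real inner product spaces, Ω ⊆ U × H an open set, and S : Ω × ℝ → ℝ a smooth function such that S(u,h,0) = (1/2)⟨L u, u⟩ + c for all (u,h) ∈ Ω, where L : U → U is a self-adjoint linear isomorphism and c ∈ ℝ. Let (ε_n) be a sequence of nonzero real numbers converging to 0, and let x_n = (u_n, h_n) ∈ Ω be a sequence converging to a point (u*, h*) ∈ Ω such that, for every n, x_n is a critical point of S(·, ε_n). Then u* = 0 and h* is a critical point of the function h ↦ S₁(0,h), where S₁ := (∂S/∂ε)(·,0). -/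
open scoped RealInnerProductSpace

/-- If `f` is strictly differentiable at `(p, 0)` and vanishes at `(x n, 0)` and at `(x n, ε n)`
with `x n → p`, `0 ≠ ε n → 0`, then its derivative at `(p, 0)` kills the last coordinate. -/
theorem HasStrictFDerivAt.apply_zero_one_eq_zero_of_tendsto
    {E F : Type*} [NormedAddCommGroup E] [NormedSpace ℝ E] [NormedAddCommGroup F] [NormedSpace ℝ F]
    {f : E × ℝ → F} {f' : E × ℝ →L[ℝ] F} {p : E} (hf : HasStrictFDerivAt f f' (p, 0))
    {x : ℕ → E} {ε : ℕ → ℝ} (hx : Filter.Tendsto x Filter.atTop (nhds p))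
    (hε : Filter.Tendsto ε Filter.atTop (nhds 0)) (hεne : ∀ n, ε n ≠ 0)
    (h0 : ∀ n, f (x n, 0) = 0) (h1 : ∀ n, f (x n, ε n) = 0) : f' (0, 1) = 0 := by
  have hlim : Filter.Tendsto (fun n => ((x n, ε n), (x n, (0 : ℝ)))) Filter.atTop
      (nhds ((p, (0 : ℝ)), (p, (0 : ℝ)))) :=
    (hx.prodMk_nhds hε).prodMk_nhds (hx.prodMk_nhds tendsto_const_nhds)
  have ho := hf.isLittleO.comp_tendsto hlim
  by_contra hne
  have hpos : 0 < ‖f' (0, 1)‖ := norm_pos_iff.2 hne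
  obtain ⟨n, hn⟩ := (ho.bound (half_pos hpos)).exists
  have hv : f' ((x n, ε n) - (x n, 0)) = ε n • f' (0, 1) := by
    rw [← map_smul]
    simp
  have hεn : 0 < ‖ε n‖ := norm_pos_iff.2 (hεne n)
  simp only [Function.comp_apply, h0, h1, hv, sub_zero, zero_sub, norm_neg, norm_smul] at hn
  have hw : ‖(x n, ε n) - (x n, (0 : ℝ))‖ = ‖ε n‖ := by simp [Prod.norm_def]
  rw [hw] at hn
  nlinarith

/-- Limits of critical points of a perturbed Morse–Bott normal form land in the
critical locus of the restriction of `S₁` to the critical manifold. -/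
theorem stmt0
    {U H : Type*} [NormedAddCommGroup U] [InnerProductSpace ℝ U] [FiniteDimensional ℝ U]
    [NormedAddCommGroup H] [InnerProductSpace ℝ H] [FiniteDimensional ℝ H]
    (Ω : Set (U × H)) (hΩ : IsOpen Ω)
    (S : (U × H) × ℝ → ℝ) (hS : ContDiffOn ℝ (⊤ : ℕ∞) S (Ω ×ˢ Set.univ))
    (S₁ : U × H → ℝ) (hS₁def : ∀ p, S₁ p = deriv (fun e => S (p, e)) 0)
    (L : U ≃ₗ[ℝ] U) (hL : ∀ x y : U, ⟪L x, y⟫ = ⟪x, L y⟫) (c : ℝ)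
    (hNF0 : ∀ p ∈ Ω, S (p, 0) = (1 / 2) * ⟪L p.1, p.1⟫ + c)
    (ε : ℕ → ℝ) (hεne : ∀ n, ε n ≠ 0)
    (hεlim : Filter.Tendsto ε Filter.atTop (nhds 0))
    (x : ℕ → U × H) (hxΩ : ∀ n, x n ∈ Ω)
    (xs : U × H) (hxsΩ : xs ∈ Ω)
    (hxlim : Filter.Tendsto x Filter.atTop (nhds xs))
    (hcrit : ∀ n, fderiv ℝ (fun p => S (p, ε n)) (x n) = 0) :
    xs.1 = 0 ∧ fderiv ℝ (fun h : H => S₁ (0, h)) xs.2 = 0 := by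
  have hSat : ∀ p ∈ Ω, ∀ e : ℝ, ContDiffAt ℝ (⊤ : ℕ∞) S (p, e) := fun p hp e =>
    hS.contDiffAt ((hΩ.prod isOpen_univ).mem_nhds ⟨hp, Set.mem_univ e⟩)
  have hSd : ∀ p ∈ Ω, ∀ e : ℝ, HasFDerivAt S (fderiv ℝ S (p, e)) (p, e) := fun p hp e =>
    ((hSat p hp e).differentiableAt (by simp)).hasFDerivAt
  have hslice : ∀ p ∈ Ω, ∀ e : ℝ, HasFDerivAt (fun q => S (q, e))
      ((fderiv ℝ S (p, e)).comp (.inl ℝ (U × H) ℝ)) p := fun p hp e =>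
    (hSd p hp e).comp p (hasFDerivAt_prodMk_left p e)
  let T : U →L[ℝ] U := LinearMap.toContinuousLinearMap L.toLinearMap
  have hzero : ∀ p ∈ Ω, ∀ w : U × H, fderiv ℝ S (p, 0) (w, 0) = ⟪L p.1, w.1⟫ := by
    intro p hp w
    have hq : HasFDerivAt (fun q : U × H => (1 / 2) * ⟪T q.1, q.1⟫ + c) _ p :=
      (((T.hasFDerivAt.comp p hasFDerivAt_fst).inner ℝ hasFDerivAt_fst).const_mul
        (1 / 2)).add_const c
    have heq : (fun q => S (q, 0)) =ᶠ[nhds p] fun q : U × H => (1 / 2) * ⟪T q.1, q.1⟫ + c := by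
      filter_upwards [hΩ.mem_nhds hp] with q hq using hNF0 q hq
    have := congrArg (fun A => A w) ((hslice p hp 0).unique (hq.congr_of_eventuallyEq heq))
    have hT : ∀ u, T u = L u := fun _ => rfl
    simp [hT, hL w.1 p.1, real_inner_comm] at this
    rw [this, real_inner_comm]
    ring
  have hcrit0 : ∀ n w, fderiv ℝ S (x n, ε n) (w, 0) = 0 := fun n w => by
    simpa using congrArg (fun A => A w) ((hslice _ (hxΩ n) (ε n)).fderiv.symm.trans (hcrit n))
  have hD : ContDiffAt ℝ 1 (fderiv ℝ S) (xs, 0) := (hSat xs hxsΩ 0).fderiv_right (by norm_cast)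
  have hu : xs.1 = 0 := by
    have h := (hD.continuousAt.clm_apply (continuousAt_const (y := ((L xs.1, (0 : H)), (0 : ℝ))))).tendsto.comp
      (hxlim.prodMk_nhds hεlim)
    simp only [Function.comp_def, hcrit0] at h
    have := tendsto_nhds_unique h tendsto_const_nhds
    rw [hzero xs hxsΩ] at this
    exact L.map_eq_zero_iff.1 (inner_self_eq_zero.1 this)
  refine ⟨hu, ?_⟩
  have hDs := hD.hasStrictFDerivAt (by simp)
  have hmixed : ∀ k : H, fderiv ℝ (fderiv ℝ S) (xs, 0) (0, 1) ((0, k), 0) = 0 := fun k =>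
    (hDs.clm_apply (hasStrictFDerivAt_const ((0, k), (0 : ℝ)) _))
      |>.apply_zero_one_eq_zero_of_tendsto hxlim hεlim hεne
        (fun n => by simp [hzero _ (hxΩ n)]) (fun n => hcrit0 n _) |> fun h => by simpa using h
  have hsymm : IsSymmSndFDerivAt ℝ S (xs, 0) := (hSat xs hxsΩ 0).isSymmSndFDerivAt (by
    rw [minSmoothness_of_isRCLikeNormedField]
    exact WithTop.coe_le_coe.2 (le_top : (2 : ℕ∞) ≤ ⊤))
  obtain ⟨us, hs⟩ := xs
  obtain rfl : us = 0 := hu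
  have hS₁ : (fun h : H => S₁ (0, h)) =ᶠ[nhds hs] fun h => fderiv ℝ S ((0, h), 0) (0, 1) := by
    have hc : ContinuousAt (fun h : H => ((0 : U), h)) hs := by fun_prop
    filter_upwards [hc.preimage_mem_nhds (hΩ.mem_nhds hxsΩ)] with h hh
    rw [hS₁def]
    exact ((hSd _ hh 0).comp_hasDerivAt (0 : ℝ)
      ((hasDerivAt_const _ _).prodMk (hasDerivAt_id _))).deriv
  have hι : HasFDerivAt (fun h : H => (((0 : U), h), (0 : ℝ))) 
      ((ContinuousLinearMap.inl ℝ (U × H) ℝ).comp (.inr ℝ U H)) hs :=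
    ((ContinuousLinearMap.inl ℝ (U × H) ℝ).comp (.inr ℝ U H)).hasFDerivAt
  have hder := (hDs.hasFDerivAt.comp hs hι).clm_apply
    (hasFDerivAt_const ((0 : U × H), (1 : ℝ)) hs)
  rw [hS₁.fderiv_eq]
  refine hder.fderiv.trans ?_
  ext k
  have := hsymm.eq (0, 1) ((0, k), 0)
  rw [hmixed] at this
  simpa using this.symm
end

section
/- Let U, V, W be finite-dimensional real inner product spaces, Ω ⊆ U × V × W an open neighborhood of the origin, and S : Ω × ℝ → ℝ a smooth function satisfying (NF0) and (NF1). Then there exist ε₀ > 0, an open neighborhood 𝒰'₀ of 0 in W, an open neighborhood 𝒰₀ ⊆ Ω of the origin in U × V × W, and smooth maps u : 𝒰'₀ × (−ε₀, ε₀) → U and v : 𝒰'₀ × (−ε₀, ε₀) → V with u(t,0) = 0 and v(t,0) = 0 for all t ∈ 𝒰'₀ and with (u(t,ε), v(t,ε), t) ∈ Ω for all (t,ε), such that for every ε with 0 < |ε| ≤ ε₀ the following holds: a point (u₀, v₀, w₀) ∈ 𝒰₀ is a critical point of S(·, ε) if and only if w₀ ∈ 𝒰'₀, (u₀, v₀)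 = (u(w₀, ε), v(w₀, ε)), and w₀ is a critical point of the function t ↦ S(u(t,ε), v(t,ε), t, ε) on 𝒰'₀. -/
open scoped RealInnerProductSpace

open Set in
/-- The integral over `[0, 1]` of a smooth family has the expected derivative. -/
theorem hasFDerivAt_integral_unit_of_contDiffOn
    {X Y : Type*} [NormedAddCommGroup X] [NormedSpace ℝ X] [FiniteDimensional ℝ X]
    [NormedAddCommGroup Y] [NormedSpace ℝ Y] [CompleteSpace Y]
    {A : Set X} (hA : IsOpen A) {F : X × ℝ → Y}
    (hF : ContDiffOn ℝ (⊤ : ℕ∞) F (A ×ˢ univ)) {x : X} (hx : x ∈ A) :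
    HasFDerivAt (fun y => ∫ s in (0 : ℝ)..1, F (y, s))
      (∫ s in (0 : ℝ)..1, (fderiv ℝ F (x, s)).comp (ContinuousLinearMap.inl ℝ X ℝ)) x := by
  have hAo : IsOpen (A ×ˢ (univ : Set ℝ)) := hA.prod isOpen_univ
  have hdF : ContinuousOn (fderiv ℝ F) (A ×ˢ univ) :=
    hF.continuousOn_fderiv_of_isOpen hAo (by simp)
  have hmk (y : X) : Continuous fun s : ℝ => (y, s) := by fun_prop
  have hFc {y : X} (hy : y ∈ A) : Continuous fun s => F (y, s) :=
    hF.continuousOn.comp_continuous (hmk y) fun s => ⟨hy, mem_univ s⟩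
  have hF'c {y : X} (hy : y ∈ A) :
      Continuous fun s => (fderiv ℝ F (y, s)).comp (ContinuousLinearMap.inl ℝ X ℝ) :=
    (hdF.comp_continuous (hmk y) fun s => ⟨hy, mem_univ s⟩).clm_comp continuous_const
  obtain ⟨r, hr, hrA⟩ := Metric.nhds_basis_closedBall.mem_iff.1 (hA.mem_nhds hx)
  have hK : IsCompact (Metric.closedBall x r ×ˢ Icc (0 : ℝ) 1) :=
    (isCompact_closedBall x r).prod isCompact_Icc
  obtain ⟨C, hC⟩ := hK.exists_bound_of_continuousOn
    (f := fun q => (fderiv ℝ F q).comp (ContinuousLinearMap.inl ℝ X ℝ))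
    ((hdF.mono (prod_mono hrA (subset_univ _))).clm_comp continuousOn_const)
  refine (intervalIntegral.hasFDerivAt_integral_of_dominated_of_fderiv_le
    (F := fun y s => F (y, s))
    (F' := fun y s => (fderiv ℝ F (y, s)).comp (ContinuousLinearMap.inl ℝ X ℝ))
    (bound := fun _ => C) (Metric.closedBall_mem_nhds x hr) ?_ ?_ ?_ ?_ ?_ ?_)
  · filter_upwards [hA.mem_nhds hx] with y hy
    exact (hFc hy).aestronglyMeasurable
  · exact (hFc hx).intervalIntegrable _ _
  · exact (hF'c hx).aestronglyMeasurable
  · refine .of_forall fun s hs y hy => hC (y, s) ⟨hy, ?_⟩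
    rw [uIoc_of_le zero_le_one] at hs
    exact Ioc_subset_Icc_self hs
  · exact intervalIntegrable_const
  · refine .of_forall fun s hs y hy => ?_
    have h1 : HasFDerivAt F (fderiv ℝ F (y, s)) (y, s) :=
      ((hF.contDiffAt (hAo.mem_nhds ⟨hrA hy, mem_univ s⟩)).differentiableAt
        (by simp)).hasFDerivAt
    exact h1.comp y (hasFDerivAt_prodMk_left y s)

open Set in
/-- The integral over `[0, 1]` of a smooth family is smooth. -/
theorem contDiffOn_integral_unit
    {X Y : Type*} [NormedAddCommGroup X] [NormedSpace ℝ X] [FiniteDimensional ℝ X]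
    [NormedAddCommGroup Y] [NormedSpace ℝ Y] [CompleteSpace Y]
    {A : Set X} (hA : IsOpen A) {F : X × ℝ → Y}
    (hF : ContDiffOn ℝ (⊤ : ℕ∞) F (A ×ˢ univ)) :
    ContDiffOn ℝ (⊤ : ℕ∞) (fun y => ∫ s in (0 : ℝ)..1, F (y, s)) A := by
  have hAo : IsOpen (A ×ˢ (univ : Set ℝ)) := hA.prod isOpen_univ
  refine contDiffOn_infty.2 fun n => ?_
  induction n generalizing F with
  | zero =>
    exact contDiffOn_zero.2 fun x hx =>
      (hasFDerivAt_integral_unit_of_contDiffOn hA hF hx).continuousAt.continuousWithinAt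
  | succ n ih =>
    push_cast
    rw [contDiffOn_succ_iff_fderiv_of_isOpen hA]
    refine ⟨fun x hx => (hasFDerivAt_integral_unit_of_contDiffOn hA hF
      hx).differentiableAt.differentiableWithinAt, by simp, ?_⟩
    rw [contDiffOn_clm_apply]
    intro y
    have hdF : ContDiffOn ℝ (⊤ : ℕ∞) (fderiv ℝ F) (A ×ˢ univ) :=
      hF.fderiv_of_isOpen hAo (by simp)
    refine (ih (F := fun q => fderiv ℝ F q (y, 0)) (hdF.clm_apply contDiffOn_const)).congr ?_
    intro x hx
    rw [(hasFDerivAt_integral_unit_of_contDiffOn hA hF hx).fderiv,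
      ContinuousLinearMap.intervalIntegral_apply]
    · simp
    · refine Continuous.intervalIntegrable ?_ _ _
      exact (hdF.continuousOn.comp_continuous (by fun_prop)
        fun s => ⟨hx, mem_univ s⟩).clm_comp continuous_const

open Set in
/-- Hadamard's lemma in the parameter: a smooth function is its value at parameter `0` plus the
parameter times a smooth function. -/
theorem exists_contDiffOn_eq_add_mul
    {X : Type*} [NormedAddCommGroup X] [NormedSpace ℝ X] [FiniteDimensional ℝ X]
    {A : Set X} (hA : IsOpen A) {S : X × ℝ → ℝ}
    (hS : ContDiffOn ℝ (⊤ : ℕ∞) S (A ×ˢ univ)) :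
    ∃ H : X × ℝ → ℝ, ContDiffOn ℝ (⊤ : ℕ∞) H (A ×ˢ univ) ∧
      (∀ x ∈ A, ∀ e, S (x, e) = S (x, 0) + e * H (x, e)) ∧
      ∀ x ∈ A, H (x, 0) = deriv (fun e => S (x, e)) 0 := by
  have hAo : IsOpen (A ×ˢ (univ : Set ℝ)) := hA.prod isOpen_univ
  have hdS : ContDiffOn ℝ (⊤ : ℕ∞) (fun q => fderiv ℝ S q (0, 1)) (A ×ˢ univ) :=
    (hS.fderiv_of_isOpen hAo (by simp)).clm_apply contDiffOn_const
  have hder {x : X} (hx : x ∈ A) (e : ℝ) :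
      HasDerivAt (fun e => S (x, e)) (fderiv ℝ S (x, e) (0, 1)) e := by
    have h1 : HasFDerivAt S (fderiv ℝ S (x, e)) (x, e) :=
      ((hS.contDiffAt (hAo.mem_nhds ⟨hx, mem_univ e⟩)).differentiableAt (by simp)).hasFDerivAt
    exact h1.comp_hasDerivAt e ((hasDerivAt_const e x).prodMk (hasDerivAt_id e))
  refine ⟨fun q => ∫ s in (0 : ℝ)..1, fderiv ℝ S (q.1, s * q.2) (0, 1), ?_, ?_, ?_⟩
  · refine contDiffOn_integral_unit (F := fun z : (X × ℝ) × ℝ =>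
      fderiv ℝ S (z.1.1, z.2 * z.1.2) (0, 1)) hAo ?_
    refine hdS.comp (f := fun z : (X × ℝ) × ℝ => (z.1.1, z.2 * z.1.2)) ?_ ?_
    · exact ContDiff.contDiffOn (by fun_prop)
    · exact fun z hz => ⟨hz.1.1, mem_univ _⟩
  · intro x hx e
    have hd (s : ℝ) : HasDerivAt (fun s => S (x, s * e))
        (fderiv ℝ S (x, s * e) (0, 1) * e) s := by
      have h2 : HasDerivAt (fun s : ℝ => s * e) e s := by
        simpa using (hasDerivAt_id s).mul_const e
      exact (hder hx (s * e)).comp s h2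
    have hcont : Continuous fun s : ℝ => fderiv ℝ S (x, s * e) (0, 1) * e :=
      (hdS.continuousOn.comp_continuous (f := fun s : ℝ => (x, s * e)) (by fun_prop)
        fun s => ⟨hx, mem_univ _⟩).mul continuous_const
    have := intervalIntegral.integral_eq_sub_of_hasDerivAt (fun s _ => hd s)
      (hcont.intervalIntegrable 0 1)
    rw [intervalIntegral.integral_mul_const] at this
    simp only [one_mul, zero_mul] at this
    linarith
  · intro x hx
    simp [(hder hx 0).deriv]

open Set in
/-- A smooth implicit function theorem around the origin. -/
theorem exists_contDiffOn_implicit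
    {E E' P : Type*} [NormedAddCommGroup E] [NormedSpace ℝ E] [FiniteDimensional ℝ E]
    [NormedAddCommGroup E'] [NormedSpace ℝ E'] [FiniteDimensional ℝ E']
    [NormedAddCommGroup P] [NormedSpace ℝ P] [FiniteDimensional ℝ P]
    (hdim : Module.finrank ℝ E = Module.finrank ℝ E')
    {N : Set (E × P)} (hN : IsOpen N) (h0 : (0 : E × P) ∈ N) {F : E × P → E'}
    (hF : ContDiffOn ℝ (⊤ : ℕ∞) F N) (hF0 : F 0 = 0)
    (hinj : ∀ e : E, fderiv ℝ F 0 (e, 0) = 0 → e = 0) :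
    ∃ (A : Set (E × P)) (B : Set P) (φ : P → E),
      IsOpen A ∧ (0 : E × P) ∈ A ∧ A ⊆ N ∧ IsOpen B ∧ (∀ x ∈ A, x.2 ∈ B) ∧
      ContDiffOn ℝ (⊤ : ℕ∞) φ B ∧ (∀ y ∈ B, (φ y, y) ∈ A) ∧
      ∀ x ∈ A, (F x = 0 ↔ x.1 = φ x.2) := by
  set Φ : E × P → E' × P := fun x => (F x, x.2) with hΦdef
  have hΦ : ContDiffOn ℝ (⊤ : ℕ∞) Φ N := hF.prodMk contDiffOn_snd
  have hΦat {x : E × P} (hx : x ∈ N) : ContDiffAt ℝ (⊤ : ℕ∞) Φ x :=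
    hΦ.contDiffAt (hN.mem_nhds hx)
  have hF1 : HasFDerivAt F (fderiv ℝ F 0) 0 :=
    ((hF.contDiffAt (hN.mem_nhds h0)).differentiableAt (by simp)).hasFDerivAt
  set D : E × P →L[ℝ] E' × P := (fderiv ℝ F 0).prod (ContinuousLinearMap.snd ℝ E P) with hD
  have hΦ1 : HasFDerivAt Φ D 0 := hF1.prodMk hasFDerivAt_snd
  have hDinj : Function.Injective (D : E × P →ₗ[ℝ] E' × P) := by
    rw [← LinearMap.ker_eq_bot, LinearMap.ker_eq_bot']
    rintro ⟨e, y⟩ h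
    have hy : y = 0 := congrArg Prod.snd h
    subst hy
    have he : fderiv ℝ F 0 (e, 0) = 0 := congrArg Prod.fst h
    rw [hinj e he]
    rfl
  let D' : (E × P) ≃L[ℝ] (E' × P) :=
    (LinearEquiv.ofInjectiveOfFinrankEq (D : E × P →ₗ[ℝ] E' × P) hDinj
      (by simp [hdim])).toContinuousLinearEquiv
  have hD' : (D' : E × P →L[ℝ] E' × P) = D := by
    ext x <;> rfl
  rw [← hD'] at hΦ1
  set e := (hΦat h0).toOpenPartialHomeomorph Φ hΦ1 (by simp) with he
  have hecoe (x : E × P) : e x = (F x, x.2) := rfl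
  have h0e : (0 : E × P) ∈ e.source :=
    (hΦat h0).mem_toOpenPartialHomeomorph_source hΦ1 (by simp)
  set R : Set (E × P →L[ℝ] E' × P) := range ((↑) : ((E × P) ≃L[ℝ] (E' × P)) → _) with hR
  have hRo : IsOpen R := ContinuousLinearEquiv.isOpen
  set A₀ : Set (E × P) := (N ∩ fderiv ℝ Φ ⁻¹' R) ∩ e.source with hA₀
  have hA₀o : IsOpen A₀ :=
    ((hΦ.continuousOn_fderiv_of_isOpen hN (by simp)).isOpen_inter_preimage hN hRo).inter
      e.open_source
  have h0A : (0 : E × P) ∈ A₀ := ⟨⟨h0, D', by rw [hΦ1.fderiv]⟩, h0e⟩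
  set T : Set (E' × P) := e.target ∩ e.symm ⁻¹' A₀ with hT
  have hTo : IsOpen T := e.symm.isOpen_inter_preimage hA₀o
  set B : Set P := (fun y => ((0 : E'), y)) ⁻¹' T with hB
  have hBo : IsOpen B := hTo.preimage (by fun_prop)
  have hright {y : P} (hy : y ∈ B) : F (e.symm (0, y)) = 0 ∧ (e.symm (0, y)).2 = y := by
    have := e.right_inv hy.1
    rw [hecoe] at this
    exact ⟨congrArg Prod.fst this, congrArg Prod.snd this⟩
  have hpair {y : P} (hy : y ∈ B) : ((e.symm (0, y)).1, y) = e.symm (0, y) :=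
    Prod.ext rfl (hright hy).2.symm
  refine ⟨A₀ ∩ Prod.snd ⁻¹' B, B, fun y => (e.symm (0, y)).1,
    hA₀o.inter (hBo.preimage continuous_snd), ⟨h0A, ?_⟩, fun x hx => hx.1.1.1, hBo,
    fun x hx => hx.2, ?_, ?_, ?_⟩
  · have h00 : e 0 = (0, 0) := by rw [hecoe, hF0]; rfl
    have h1 : ((0 : E'), (0 : P)) ∈ e.target := h00 ▸ e.map_source h0e
    refine ⟨h1, ?_⟩
    change e.symm (0, 0) ∈ A₀
    rw [← h00, e.left_inv h0e]
    exact h0A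
  · intro y hy
    obtain ⟨⟨hN', ⟨f', hf'⟩⟩, hs⟩ := hy.2
    have hd : HasFDerivAt e (f' : E × P →L[ℝ] E' × P) (e.symm (0, y)) := by
      rw [hf']
      exact ((hΦat hN').differentiableAt (by simp)).hasFDerivAt
    have h1 : ContDiffAt ℝ (⊤ : ℕ∞) e.symm ((0 : E'), y) :=
      e.contDiffAt_symm hy.1 hd (hΦat hN')
    have h2 : ContDiffAt ℝ (⊤ : ℕ∞) (fun y : P => e.symm ((0 : E'), y)) y :=
      ContDiffAt.comp (g := e.symm) (f := fun y : P => ((0 : E'), y)) y h1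
        (contDiffAt_const.prodMk contDiffAt_id)
    exact h2.fst.contDiffWithinAt
  · intro y hy
    refine ⟨?_, hy⟩
    rw [hpair hy]
    exact hy.2
  · rintro ⟨x, y⟩ ⟨hxA, hy⟩
    constructor
    · intro h
      have h1 : e (x, y) = (0, y) := by rw [hecoe, h]
      have h2 := e.left_inv hxA.2
      rw [h1] at h2
      exact (congrArg Prod.fst h2).symm
    · intro h
      have h1 : (x, y) = e.symm (0, y) := by
        rw [← hpair hy]
        exact Prod.ext h rfl
      rw [h1]
      exact (hright hy).1

/-- The derivative of a self-adjoint quadratic form plus a constant. -/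
theorem hasFDerivAt_half_inner_add_const
    {E : Type*} [NormedAddCommGroup E] [InnerProductSpace ℝ E] [FiniteDimensional ℝ E]
    (L : E →ₗ[ℝ] E) (hL : ∀ x y : E, ⟪L x, y⟫ = ⟪x, L y⟫) (c : ℝ) (x : E) :
    HasFDerivAt (fun y => (1 / 2) * ⟪L y, y⟫ + c) (innerSL ℝ (L x)) x := by
  have h1 : HasFDerivAt (fun y => L y) (LinearMap.toContinuousLinearMap L) x :=
    (LinearMap.toContinuousLinearMap L).hasFDerivAt
  have h2 := ((h1.inner ℝ (hasFDerivAt_id x)).const_mul (1 / 2 : ℝ)).add_const c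
  refine h2.congr_fderiv ?_
  ext y
  have h3 : ⟪L y, x⟫ = ⟪L x, y⟫ := by rw [hL, real_inner_comm]
  simp [h3]
  ring



/-- Local parametrisation of the critical locus of the perturbed function by
critical points of the reduced function on the `W`-slice. -/
theorem stmt1
    {U V W : Type*} [NormedAddCommGroup U] [InnerProductSpace ℝ U] [FiniteDimensional ℝ U]
    [NormedAddCommGroup V] [InnerProductSpace ℝ V] [FiniteDimensional ℝ V]
    [NormedAddCommGroup W] [InnerProductSpace ℝ W] [FiniteDimensional ℝ W]
    (Ω : Set (U × V × W)) (hΩ : IsOpen Ω) (hΩ0 : (0 : U × V × W) ∈ Ω)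
    (S : (U × V × W) × ℝ → ℝ) (hS : ContDiffOn ℝ (⊤ : ℕ∞) S (Ω ×ˢ Set.univ))
    (S₁ : U × V × W → ℝ) (hS₁def : ∀ p, S₁ p = deriv (fun e => S (p, e)) 0)
    (L₀ : U ≃ₗ[ℝ] U) (hL₀ : ∀ x y : U, ⟪L₀ x, y⟫ = ⟪x, L₀ y⟫) (c₀ : ℝ)
    (hNF0 : ∀ p ∈ Ω, S (p, 0) = (1 / 2) * ⟪L₀ p.1, p.1⟫ + c₀)
    (L₁ : V ≃ₗ[ℝ] V) (hL₁ : ∀ x y : V, ⟪L₁ x, y⟫ = ⟪x, L₁ y⟫) (c₁ : ℝ)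
    (hNF1 : ∀ (v : V) (w : W), ((0, v, w) : U × V × W) ∈ Ω →
      S₁ (0, v, w) = (1 / 2) * ⟪L₁ v, v⟫ + c₁) :
    ∃ (ε₀ : ℝ) (U' : Set W) (U₀ : Set (U × V × W)) (u : W × ℝ → U) (v : W × ℝ → V),
      0 < ε₀ ∧ IsOpen U' ∧ (0 : W) ∈ U' ∧ IsOpen U₀ ∧ (0 : U × V × W) ∈ U₀ ∧ U₀ ⊆ Ω ∧
      ContDiffOn ℝ (⊤ : ℕ∞) u (U' ×ˢ Set.Icc (-ε₀) ε₀) ∧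
      ContDiffOn ℝ (⊤ : ℕ∞) v (U' ×ˢ Set.Icc (-ε₀) ε₀) ∧
      (∀ t ∈ U', u (t, 0) = 0 ∧ v (t, 0) = 0) ∧
      (∀ t ∈ U', ∀ ε ∈ Set.Icc (-ε₀) ε₀, ((u (t, ε), v (t, ε), t) : U × V × W) ∈ Ω) ∧
      ∀ ε : ℝ, 0 < |ε| → |ε| ≤ ε₀ →
        ∀ p ∈ U₀,
          (fderiv ℝ (fun q => S (q, ε)) p = 0 ↔
            p.2.2 ∈ U' ∧ p.1 = u (p.2.2, ε) ∧ p.2.1 = v (p.2.2, ε) ∧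
              fderiv ℝ (fun t : W => S ((u (t, ε), v (t, ε), t), ε)) p.2.2 = 0) := by
  have hΩu : IsOpen (Ω ×ˢ (Set.univ : Set ℝ)) := hΩ.prod isOpen_univ
  obtain ⟨H, hH, hSH, hH0⟩ := exists_contDiffOn_eq_add_mul hΩ hS
  set iU : U →L[ℝ] U × V × W := ContinuousLinearMap.inl ℝ U (V × W) with hiU
  set iV : V →L[ℝ] U × V × W :=
    (ContinuousLinearMap.inr ℝ U (V × W)).comp (ContinuousLinearMap.inl ℝ V W) with hiV
  have hslice {f : (U × V × W) × ℝ → ℝ} (hf : ContDiffOn ℝ (⊤ : ℕ∞) f (Ω ×ˢ Set.univ))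
      {p : U × V × W} (hp : p ∈ Ω) (e : ℝ) :
      HasFDerivAt (fun q => f (q, e))
        ((fderiv ℝ f (p, e)).comp (ContinuousLinearMap.inl ℝ (U × V × W) ℝ)) p := by
    have h1 : HasFDerivAt f (fderiv ℝ f (p, e)) (p, e) :=
      ((hf.contDiffAt (hΩu.mem_nhds ⟨hp, Set.mem_univ e⟩)).differentiableAt (by simp)).hasFDerivAt
    exact h1.comp p (hasFDerivAt_prodMk_left p e)
  set dS : (U × V × W) × ℝ → (U × V × W →L[ℝ] ℝ) := fun q =>
    (fderiv ℝ S q).comp (ContinuousLinearMap.inl ℝ (U × V × W) ℝ) with hdS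
  set dH : (U × V × W) × ℝ → (U × V × W →L[ℝ] ℝ) := fun q =>
    (fderiv ℝ H q).comp (ContinuousLinearMap.inl ℝ (U × V × W) ℝ) with hdH
  have hdSc : ContDiffOn ℝ (⊤ : ℕ∞) dS (Ω ×ˢ Set.univ) :=
    (hS.fderiv_of_isOpen hΩu (by simp)).clm_comp contDiffOn_const
  have hdHc : ContDiffOn ℝ (⊤ : ℕ∞) dH (Ω ×ˢ Set.univ) :=
    (hH.fderiv_of_isOpen hΩu (by simp)).clm_comp contDiffOn_const
  have hquad {p : U × V × W} : HasFDerivAt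
      (fun q : U × V × W => (1 / 2) * ⟪L₀ q.1, q.1⟫ + c₀)
      ((innerSL ℝ (L₀ p.1)).comp (ContinuousLinearMap.fst ℝ U (V × W))) p :=
    HasFDerivAt.comp (g := fun x : U => (1 / 2) * ⟪L₀ x, x⟫ + c₀) p
      (hasFDerivAt_half_inner_add_const (L₀ : U →ₗ[ℝ] U) hL₀ c₀ p.1) hasFDerivAt_fst
  have hdS_eq {p : U × V × W} (hp : p ∈ Ω) (e : ℝ) : dS (p, e) =
      (innerSL ℝ (L₀ p.1)).comp (ContinuousLinearMap.fst ℝ U (V × W)) + e • dH (p, e) := by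
    refine (hslice hS hp e).unique ?_
    refine (hquad.add ((hslice hH hp e).const_mul e)).congr_of_eventuallyEq ?_
    filter_upwards [hΩ.mem_nhds hp] with q hq
    rw [hSH q hq e, hNF0 q hq]
    rfl
  have hdSU {p : U × V × W} (hp : p ∈ Ω) : (dS (p, 0)).comp iU = innerSL ℝ (L₀ p.1) := by
    rw [hdS_eq hp]
    ext x
    simp [hiU]
  have hdSV {p : U × V × W} (hp : p ∈ Ω) (e : ℝ) :
      (dS (p, e)).comp iV = e • (dH (p, e)).comp iV := by
    rw [hdS_eq hp]
    ext x
    simp [hiV]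
  have hdHV {b : V} {w : W} (hp : ((0, b, w) : U × V × W) ∈ Ω) :
      (dH ((0, b, w), 0)).comp iV = innerSL ℝ (L₁ b) := by
    have hline : HasFDerivAt (fun x : V => ((0, x, w) : U × V × W)) iV b :=
      (hasFDerivAt_prodMk_right (0 : U) (b, w)).comp b (hasFDerivAt_prodMk_left b w)
    have h1 := HasFDerivAt.comp (g := fun q => H (q, 0))
      (f := fun x : V => ((0, x, w) : U × V × W)) b (hslice hH hp 0) hline
    refine h1.unique ((hasFDerivAt_half_inner_add_const (L₁ : V →ₗ[ℝ] V) hL₁ c₁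
      b).congr_of_eventuallyEq ?_)
    filter_upwards [hline.continuousAt.preimage_mem_nhds (hΩ.mem_nhds hp)] with x hx
    change H ((0, x, w), 0) = _
    rw [hH0 _ hx, ← hS₁def, hNF1 x w hx]
    rfl
  set J : (U × V) × (W × ℝ) → (U × V × W) × ℝ := fun q =>
    ((q.1.1, q.1.2, q.2.1), q.2.2) with hJ
  have hJc : ContDiff ℝ (⊤ : ℕ∞) J := by fun_prop
  set N : Set ((U × V) × (W × ℝ)) := J ⁻¹' (Ω ×ˢ Set.univ) with hN
  have hNo : IsOpen N := hΩu.preimage hJc.continuous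
  have hN0 : (0 : (U × V) × (W × ℝ)) ∈ N := ⟨hΩ0, Set.mem_univ _⟩
  set F : (U × V) × (W × ℝ) → (U →L[ℝ] ℝ) × (V →L[ℝ] ℝ) := fun q =>
    ((dS (J q)).comp iU, (dH (J q)).comp iV) with hFdef
  have hF : ContDiffOn ℝ (⊤ : ℕ∞) F N :=
    ((hdSc.comp hJc.contDiffOn fun q hq => hq).clm_comp contDiffOn_const).prodMk
      ((hdHc.comp hJc.contDiffOn fun q hq => hq).clm_comp contDiffOn_const)
  have hFzero {w : W} (hp : ((0, 0, w) : U × V × W) ∈ Ω) : F ((0, 0), (w, 0)) = 0 := by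
    refine Prod.ext ?_ ?_
    · change (dS ((0, 0, w), 0)).comp iU = 0
      rw [hdSU hp]
      simp
    · change (dH ((0, 0, w), 0)).comp iV = 0
      rw [hdHV hp]
      simp
  have hinj : ∀ z : U × V, fderiv ℝ F 0 (z, 0) = 0 → z = 0 := by
    rintro ⟨a, b⟩ hab
    have hline : HasDerivAt (fun t : ℝ => t • (((a, b), 0) : (U × V) × (W × ℝ)))
        ((a, b), 0) 0 := by
      simpa using (hasDerivAt_id (0 : ℝ)).smul_const (((a, b), 0) : (U × V) × (W × ℝ))
    have hF1 : HasFDerivAt F (fderiv ℝ F 0) ((0 : ℝ) • (((a, b), 0) : (U × V) × (W × ℝ))) := by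
      rw [zero_smul]
      exact ((hF.contDiffAt (hNo.mem_nhds hN0)).differentiableAt (by simp)).hasFDerivAt
    have hg : HasDerivAt (fun t : ℝ => F (t • ((a, b), 0))) 0 0 := by
      have := hF1.comp_hasDerivAt (0 : ℝ) hline
      rwa [hab] at this
    have hev : ∀ᶠ t : ℝ in nhds 0, t • (((a, b), 0) : (U × V) × (W × ℝ)) ∈ N := by
      refine hline.continuousAt.preimage_mem_nhds (hNo.mem_nhds ?_)
      rw [zero_smul]
      exact hN0
    have hJt (t : ℝ) : J (t • (((a, b), 0) : (U × V) × (W × ℝ))) = ((t • a, t • b, 0), 0) := by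
      simp [hJ]
    have hmul (c : ℝ) : HasDerivAt (fun t : ℝ => t * c) c 0 := by
      simpa using (hasDerivAt_id (0 : ℝ)).mul_const c
    have ha : a = 0 := by
      have h1 : HasDerivAt (fun t : ℝ => (F (t • ((a, b), 0))).1 (L₀ a)) 0 0 := by
        have := ((ContinuousLinearMap.apply ℝ ℝ (L₀ a)).comp
          (ContinuousLinearMap.fst ℝ (U →L[ℝ] ℝ) (V →L[ℝ] ℝ))).hasFDerivAt.comp_hasDerivAt 0 hg
        rwa [map_zero] at this
      have h2 : HasDerivAt (fun t : ℝ => (F (t • ((a, b), 0))).1 (L₀ a)) ⟪L₀ a, L₀ a⟫ 0 := by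
        refine (hmul ⟪L₀ a, L₀ a⟫).congr_of_eventuallyEq ?_
        filter_upwards [hev] with t ht
        have ht' := ht.1
        rw [hJt] at ht'
        simp only [hFdef, hJt]
        rw [hdSU ht']
        simp
      exact (map_eq_zero_iff L₀ L₀.injective).1 (inner_self_eq_zero.1 (h2.unique h1))
    have hb : b = 0 := by
      have h1 : HasDerivAt (fun t : ℝ => (F (t • ((a, b), 0))).2 (L₁ b)) 0 0 := by
        have := ((ContinuousLinearMap.apply ℝ ℝ (L₁ b)).comp
          (ContinuousLinearMap.snd ℝ (U →L[ℝ] ℝ) (V →L[ℝ] ℝ))).hasFDerivAt.comp_hasDerivAt 0 hg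
        rwa [map_zero] at this
      have h2 : HasDerivAt (fun t : ℝ => (F (t • ((a, b), 0))).2 (L₁ b)) ⟪L₁ b, L₁ b⟫ 0 := by
        refine (hmul ⟪L₁ b, L₁ b⟫).congr_of_eventuallyEq ?_
        filter_upwards [hev] with t ht
        have ht' := ht.1
        rw [hJt, ha, smul_zero] at ht'
        simp only [hFdef, hJt]
        rw [ha, smul_zero, hdHV ht']
        simp
      exact (map_eq_zero_iff L₁ L₁.injective).1 (inner_self_eq_zero.1 (h2.unique h1))
    rw [ha, hb]
    rfl
  have hdimU : Module.finrank ℝ (U →L[ℝ] ℝ) = Module.finrank ℝ U :=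
    (LinearMap.toContinuousLinearMap (𝕜 := ℝ) (E := U) (F' := ℝ)).finrank_eq.symm.trans
      Subspace.dual_finrank_eq
  have hdimV : Module.finrank ℝ (V →L[ℝ] ℝ) = Module.finrank ℝ V :=
    (LinearMap.toContinuousLinearMap (𝕜 := ℝ) (E := V) (F' := ℝ)).finrank_eq.symm.trans
      Subspace.dual_finrank_eq
  obtain ⟨A, B, φ, hA, h0A, hAN, hB, hAB, hφ, hφA, hiff⟩ :=
    exists_contDiffOn_implicit (by simp [hdimU, hdimV]) hNo hN0 hF (hFzero hΩ0) hinj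
  obtain ⟨r, hr, hrA⟩ := Metric.isOpen_iff.1 hA 0 h0A
  have hballA {a : U} {b : V} {w : W} {e : ℝ} (ha : ‖a‖ < r) (hb : ‖b‖ < r) (hw : ‖w‖ < r)
      (he : ‖e‖ < r) : (((a, b), (w, e)) : (U × V) × (W × ℝ)) ∈ A := by
    apply hrA
    simp only [mem_ball_zero_iff, Prod.norm_def, sup_lt_iff]
    exact ⟨⟨ha, hb⟩, hw, he⟩
  have hballB {w : W} {e : ℝ} (hw : ‖w‖ < r) (he : ‖e‖ < r) : (w, e) ∈ B :=
    hAB _ (hballA (a := 0) (b := 0) (by simpa) (by simpa) hw he)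
  have hsmall {e : ℝ} (he : |e| ≤ r / 2) : ‖e‖ < r := by
    rw [Real.norm_eq_abs]
    linarith
  have hsub : Metric.ball (0 : W) r ×ˢ Set.Icc (-(r / 2)) (r / 2) ⊆ B := by
    rintro ⟨w, e⟩ ⟨hw, he⟩
    exact hballB (by simpa using hw) (hsmall (abs_le.2 he))
  refine ⟨r / 2, Metric.ball 0 r, Metric.ball 0 r, fun y => (φ y).1, fun y => (φ y).2,
    half_pos hr, Metric.isOpen_ball, Metric.mem_ball_self hr, Metric.isOpen_ball,
    Metric.mem_ball_self hr, ?_, hφ.fst.mono hsub, hφ.snd.mono hsub, ?_, ?_, ?_⟩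
  · rintro ⟨a, b, w⟩ hp
    simp only [mem_ball_zero_iff, Prod.norm_def, sup_lt_iff] at hp
    exact (hAN (hballA (e := 0) hp.1 hp.2.1 hp.2.2 (by simpa))).1
  · intro t ht
    have hmem : (((0, 0), (t, 0)) : (U × V) × (W × ℝ)) ∈ A :=
      hballA (by simpa) (by simpa) (by simpa using ht) (by simpa)
    have h1 := (hiff _ hmem).1 (hFzero (hAN hmem).1)
    exact ⟨(congrArg Prod.fst h1).symm, (congrArg Prod.snd h1).symm⟩
  · intro t ht e he
    exact (hAN (hφA (t, e) (hsub ⟨ht, he⟩))).1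
  · rintro e he0 he ⟨a, b, w⟩ hp
    simp only [mem_ball_zero_iff, Prod.norm_def, sup_lt_iff] at hp
    obtain ⟨ha, hb, hw⟩ := hp
    have hmem := hballA ha hb hw (hsmall he)
    have hpΩ : (a, b, w) ∈ Ω := (hAN hmem).1
    have he' : e ≠ 0 := abs_pos.1 he0
    have hwB : (w, e) ∈ B := hballB hw (hsmall he)
    have hFiff : F ((a, b), (w, e)) = 0 ↔
        (dS ((a, b, w), e)).comp iU = 0 ∧ (dS ((a, b, w), e)).comp iV = 0 := by
      rw [hdSV hpΩ, smul_eq_zero_iff_right he']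
      exact Prod.ext_iff
    have hred (hab : (a, b) = φ (w, e)) (hU : (dS ((a, b, w), e)).comp iU = 0)
        (hV : (dS ((a, b, w), e)).comp iV = 0) :
        fderiv ℝ (fun t : W => S (((φ (t, e)).1, (φ (t, e)).2, t), e)) w =
          (dS ((a, b, w), e)).comp ((ContinuousLinearMap.inr ℝ U (V × W)).comp
            (ContinuousLinearMap.inr ℝ V W)) := by
      have hφ1 : DifferentiableAt ℝ (fun t => φ (t, e)) w :=
        DifferentiableAt.comp (g := φ) (f := fun t => (t, e)) w
          ((hφ.contDiffAt (hB.mem_nhds hwB)).differentiableAt (by simp)) (by fun_prop)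
      have h1 := hφ1.hasFDerivAt
      have h2 := h1.fst.prodMk (h1.snd.prodMk (hasFDerivAt_id w))
      have h3 : HasFDerivAt (fun q => S (q, e)) (dS ((a, b, w), e))
          ((φ (w, e)).1, (φ (w, e)).2, w) := by
        rw [← hab]
        exact hslice hS hpΩ e
      have h4 := HasFDerivAt.comp (g := fun q => S (q, e))
        (f := fun t => ((φ (t, e)).1, (φ (t, e)).2, t)) w h3 h2
      refine h4.fderiv.trans ?_
      ext k
      set z := fderiv ℝ (fun t => φ (t, e)) w k with hz
      have hsum : ((z.1, z.2, k) : U × V × W) = iU z.1 + iV z.2 + (0, 0, k) := by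
        simp [hiU, hiV]
      have hU' : dS ((a, b, w), e) (iU z.1) = 0 := DFunLike.congr_fun hU z.1
      have hV' : dS ((a, b, w), e) (iV z.2) = 0 := DFunLike.congr_fun hV z.2
      change dS ((a, b, w), e) (z.1, z.2, k) = dS ((a, b, w), e) (0, 0, k)
      rw [hsum, map_add, map_add, hU', hV', zero_add, zero_add]
    rw [(hslice hS hpΩ e).fderiv]
    change dS ((a, b, w), e) = 0 ↔ _
    constructor
    · intro h
      have hab : (a, b) = φ (w, e) := (hiff _ hmem).1 (hFiff.2 (by simp [h]))
      refine ⟨by simpa using hw, congrArg Prod.fst hab, congrArg Prod.snd hab, ?_⟩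
      refine (hred hab (by simp [h]) (by simp [h])).trans ?_
      simp [h]
    · rintro ⟨-, h1, h2, h3⟩
      have hab : (a, b) = φ (w, e) := Prod.ext h1 h2
      obtain ⟨hU, hV⟩ := hFiff.1 ((hiff _ hmem).2 hab)
      have hW := (hred hab hU hV).symm.trans h3
      ext x
      · exact DFunLike.congr_fun hU x
      · exact DFunLike.congr_fun hV x
      · exact DFunLike.congr_fun hW x
end

section
/- Let U, V, W be finite-dimensional real inner product spaces, Ω ⊆ U × V × W an open neighborhood of the origin, and S : Ω × ℝ → ℝ a smooth function satisfying (NF0) and (NF1). Let δ > 0, let 𝒰' be an open neighborhood of 0 in W, and let u : 𝒰' × (−δ,δ) → U, v : 𝒰' × (−δ,δ) → V be smooth maps with u(t,0) = 0 and v(t,0) = 0 for all t, with (u(t,ε), v(t,ε), t) ∈ Ω for all (t,ε), and such that for all (t,ε) the partial Fréchet derivatives of S(·,ε) in the U-direction and in the V-direction both vanish at (u(t,ε), v(t,ε), t). Then the function S'(t,ε) := ε^{-2}·( S(u(t,ε), v(t,ε), t, ε) − S(0,0,0,0) − ε·S₁(0,0,0) ), defined for ε ≠ 0, extends to a smooth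 function on 𝒰' × (−δ,δ), and its value at ε = 0 is S'(t,0) = (1/2)⟨∇_u S₁(0,0,t), λ(t)⟩ + S₂(0,0,t). -/
open scoped RealInnerProductSpace

/-- Differentiation under the integral sign for a `C^1` integrand. -/
theorem hasFDerivAt_intervalIntegral_of_contDiff
    {E : Type*} [NormedAddCommGroup E] [NormedSpace ℝ E] [FiniteDimensional ℝ E]
    {F : E × ℝ → ℝ} (hF : ContDiff ℝ 1 F) (x₀ : E) :
    HasFDerivAt (fun x => ∫ s in (0 : ℝ)..1, F (x, s))
      (∫ s in (0 : ℝ)..1, (fderiv ℝ F (x₀, s)).comp (ContinuousLinearMap.inl ℝ E ℝ)) x₀ := by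
  have hF' : Continuous fun p : E × ℝ =>
      (fderiv ℝ F p).comp (ContinuousLinearMap.inl ℝ E ℝ) :=
    (hF.continuous_fderiv one_ne_zero).clm_comp continuous_const
  obtain ⟨C, hC⟩ := ((isCompact_closedBall x₀ 1).prod (isCompact_Icc (a := (0 : ℝ)) (b := 1))
    ).exists_bound_of_continuousOn hF'.continuousOn
  have hcont : ∀ x : E, Continuous fun s : ℝ => F (x, s) := fun x =>
    hF.continuous.comp (by fun_prop)
  refine intervalIntegral.hasFDerivAt_integral_of_dominated_of_fderiv_le
    (F' := fun x s => (fderiv ℝ F (x, s)).comp (ContinuousLinearMap.inl ℝ E ℝ))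
    (bound := fun _ => C)
    (Metric.closedBall_mem_nhds x₀ one_pos)
    (Filter.Eventually.of_forall fun x => (hcont x).aestronglyMeasurable)
    ((hcont x₀).intervalIntegrable _ _)
    (hF'.comp (by fun_prop : Continuous fun s : ℝ => (x₀, s))).aestronglyMeasurable
    (Filter.Eventually.of_forall fun s hs x hx => hC (x, s) ⟨hx, ?_⟩)
    intervalIntegrable_const
    (Filter.Eventually.of_forall fun s _ x _ => ?_)
  · rw [Set.uIoc_of_le zero_le_one] at hs
    exact ⟨hs.1.le, hs.2⟩
  · exact ((hF.differentiable one_ne_zero (x, s)).hasFDerivAt).comp x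
      (hasFDerivAt_prodMk_left x s)

/-- The integral over `[0, 1]` of a smooth function depends smoothly on parameters. -/
theorem contDiff_intervalIntegral
    {E : Type*} [NormedAddCommGroup E] [NormedSpace ℝ E] [FiniteDimensional ℝ E]
    {F : E × ℝ → ℝ} (hF : ContDiff ℝ (⊤ : ℕ∞) F) :
    ContDiff ℝ (⊤ : ℕ∞) fun x => ∫ s in (0 : ℝ)..1, F (x, s) := by
  rw [contDiff_infty]
  intro n
  induction n generalizing F with
  | zero =>
    exact contDiff_zero.2
      (intervalIntegral.continuous_parametric_intervalIntegral_of_continuous'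
        (f := fun x s => F (x, s)) hF.continuous 0 1)
  | succ n ih =>
    have hF1 : ContDiff ℝ 1 F := hF.of_le (by exact_mod_cast le_top)
    have hd := hasFDerivAt_intervalIntegral_of_contDiff hF1
    rw [Nat.cast_succ, contDiff_succ_iff_fderiv_apply]
    refine ⟨fun x => (hd x).differentiableAt, by simp, fun y => ?_⟩
    have hF' : Continuous fun p : E × ℝ =>
        (fderiv ℝ F p).comp (ContinuousLinearMap.inl ℝ E ℝ) :=
      (hF1.continuous_fderiv one_ne_zero).clm_comp continuous_const
    have key : ContDiff ℝ (⊤ : ℕ∞) fun p : E × ℝ => fderiv ℝ F p (y, 0) :=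
      (hF.fderiv_right (by simp)).clm_apply contDiff_const
    convert ih key using 2 with x
    rw [(hd x).fderiv, ContinuousLinearMap.intervalIntegral_apply]
    · simp
    · exact (hF'.comp (by fun_prop : Continuous fun s : ℝ => (x, s))).intervalIntegrable _ _

/-- Hadamard's lemma with parameters. -/
theorem exists_contDiff_eq_add_mul
    {E : Type*} [NormedAddCommGroup E] [NormedSpace ℝ E] [FiniteDimensional ℝ E]
    {F : E × ℝ → ℝ} (hF : ContDiff ℝ (⊤ : ℕ∞) F) :
    ∃ H : E × ℝ → ℝ, ContDiff ℝ (⊤ : ℕ∞) H ∧ ∀ t ε, F (t, ε) = F (t, 0) + ε * H (t, ε) := by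
  have hD : ContDiff ℝ (⊤ : ℕ∞) fun p : E × ℝ => fderiv ℝ F p (0, 1) :=
    (hF.fderiv_right (by simp)).clm_apply contDiff_const
  refine ⟨fun p => ∫ s in (0 : ℝ)..1, fderiv ℝ F (p.1, s * p.2) (0, 1),
    contDiff_intervalIntegral (F := fun q : (E × ℝ) × ℝ =>
      fderiv ℝ F (q.1.1, q.2 * q.1.2) (0, 1)) (hD.comp (by fun_prop)), fun t ε => ?_⟩
  have hderiv : ∀ s ∈ Set.uIcc (0 : ℝ) 1,
      HasDerivAt (fun s => F (t, s * ε)) (ε * fderiv ℝ F (t, s * ε) (0, 1)) s := by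
    intro s _
    have h1 : HasDerivAt (fun s : ℝ => (t, s * ε)) ((0 : E), ε) s :=
      (hasDerivAt_const s t).prodMk (by simpa using (hasDerivAt_id s).mul_const ε)
    have h2 := (hF.differentiable (by simp) (t, s * ε)).hasFDerivAt.comp_hasDerivAt s h1
    have h3 : ((0 : E), ε) = ε • ((0 : E), (1 : ℝ)) := by simp
    rw [h3, map_smul] at h2
    exact h2
  have := intervalIntegral.integral_eq_sub_of_hasDerivAt hderiv
    ((continuous_const.mul (hD.continuous.comp (by fun_prop))).intervalIntegrable _ _)
  rw [intervalIntegral.integral_const_mul] at this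
  simp only [one_mul, zero_mul] at this
  linarith

/-- Uniqueness of second order Taylor coefficients at `0`. -/
theorem eq_of_eq_add_mul_add_sq_mul {φ k : ℝ → ℝ} {c h a A : ℝ} (hk : ContDiff ℝ (⊤ : ℕ∞) k)
    (hφ : ∀ᶠ ε in nhds 0, φ ε = c + ε * h + ε ^ 2 * k ε)
    (ha : HasDerivAt φ a 0) (hA : HasDerivAt (deriv φ) (2 * A) 0) : h = a ∧ k 0 = A := by
  have hkd : ∀ x, HasDerivAt k (deriv k x) x := fun x =>
    (hk.differentiable (by simp) x).hasDerivAt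
  have hk' : Differentiable ℝ (deriv k) :=
    (hk.iterate_deriv 1).differentiable (by simp)
  have hd : ∀ x, HasDerivAt (fun ε => c + ε * h + ε ^ 2 * k ε)
      (h + (2 * x * k x + x ^ 2 * deriv k x)) x := fun x => by
    refine ((((hasDerivAt_id x).mul_const h).const_add c).add
      (((hasDerivAt_id x).pow 2).mul (hkd x))).congr_deriv ?_
    simp
  have hd0 : deriv φ =ᶠ[nhds 0] fun x => h + (2 * x * k x + x ^ 2 * deriv k x) := by
    filter_upwards [hφ.eventually_nhds] with x hx
    exact (Filter.EventuallyEq.deriv_eq hx).trans (hd x).deriv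
  refine ⟨?_, ?_⟩
  · have := ha.unique ((hd 0).congr_of_eventuallyEq hφ)
    simpa using this.symm
  · have h2 : HasDerivAt (fun x => h + (2 * x * k x + x ^ 2 * deriv k x)) (2 * k 0) 0 := by
      refine (((((hasDerivAt_id (0 : ℝ)).const_mul 2).mul (hkd 0)).add
        (((hasDerivAt_id (0 : ℝ)).pow 2).mul (hk' 0).hasDerivAt)).const_add h).congr_deriv ?_
      simp
    have := hA.unique (h2.congr_of_eventuallyEq hd0)
    linarith

/-- A smooth function with the affine part of its Taylor expansion in the last variable removed
remains smooth after division by the square of that variable. -/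
theorem contDiffOn_second_order_quotient
    {E : Type*} [NormedAddCommGroup E] [NormedSpace ℝ E] [FiniteDimensional ℝ E]
    {O : Set (E × ℝ)} (hO : IsOpen O) {f : E × ℝ → ℝ} (hf : ContDiffOn ℝ (⊤ : ℕ∞) f O)
    {c a : ℝ} {A : E → ℝ} (hc : ∀ t, (t, (0 : ℝ)) ∈ O → f (t, 0) = c)
    (ha : ∀ t, (t, (0 : ℝ)) ∈ O → HasDerivAt (fun ε => f (t, ε)) a 0)
    (hA : ∀ t, (t, (0 : ℝ)) ∈ O → HasDerivAt (deriv fun ε => f (t, ε)) (2 * A t) 0) :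
    ContDiffOn ℝ (⊤ : ℕ∞)
      (fun p => if p.2 = 0 then A p.1 else (p.2 ^ 2)⁻¹ * (f p - c - p.2 * a)) O := by
  rintro ⟨t₀, ε₀⟩ hp
  apply ContDiffAt.contDiffWithinAt
  by_cases hε : ε₀ = 0
  · subst hε
    obtain ⟨r, hr, hrO⟩ := Metric.nhds_basis_closedBall.mem_iff.1 (hO.mem_nhds hp)
    let χ : ContDiffBump ((t₀, 0) : E × ℝ) := ⟨r / 2, r, by positivity, by linarith⟩
    have hχf : ContDiff ℝ (⊤ : ℕ∞) fun p => χ p * f p := by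
      rw [contDiff_iff_contDiffAt]
      intro p
      by_cases hpO : p ∈ O
      · exact χ.contDiff.contDiffAt.mul (hf.contDiffAt (hO.mem_nhds hpO))
      · have hps : p ∉ tsupport χ := fun h => hpO (hrO (by rwa [χ.tsupport_eq] at h))
        refine (contDiffAt_const (c := (0 : ℝ))).congr_of_eventuallyEq ?_
        filter_upwards [notMem_tsupport_iff_eventuallyEq.1 hps] with q hq
        simp [hq]
    obtain ⟨H, hH, hFH⟩ := exists_contDiff_eq_add_mul hχf
    obtain ⟨K, hK, hHK⟩ := exists_contDiff_eq_add_mul hH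
    have hball : ∀ p ∈ Metric.ball ((t₀, 0) : E × ℝ) (r / 2), χ p = 1 := fun p hp =>
      χ.one_of_mem_closedBall (Metric.ball_subset_closedBall hp)
    have hsub : Metric.ball ((t₀, 0) : E × ℝ) (r / 2) ⊆ O := fun p hp =>
      hrO (Metric.ball_subset_closedBall (Metric.ball_subset_ball (by linarith) hp))
    refine hK.contDiffAt.congr_of_eventuallyEq ?_
    filter_upwards [Metric.ball_mem_nhds _ (half_pos hr)]
    rintro ⟨t, ε⟩ htε
    have ht0 : (t, (0 : ℝ)) ∈ Metric.ball ((t₀, 0) : E × ℝ) (r / 2) := by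
      rw [← ball_prod_same] at htε ⊢
      exact ⟨htε.1, Metric.mem_ball_self (half_pos hr)⟩
    have hexp : ∀ e, (t, e) ∈ Metric.ball ((t₀, 0) : E × ℝ) (r / 2) →
        f (t, e) = c + e * H (t, 0) + e ^ 2 * K (t, e) := by
      intro e he
      have h1 := hFH t e
      rw [hball _ he, hball _ ht0, hc t (hsub ht0), hHK t e] at h1
      linarith
    have hev : ∀ᶠ e in nhds (0 : ℝ), f (t, e) = c + e * H (t, 0) + e ^ 2 * K (t, e) := by
      have : ContinuousAt (fun e : ℝ => (t, e)) 0 := by fun_prop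
      filter_upwards [this (Metric.isOpen_ball.mem_nhds ht0)] with e he using hexp e he
    obtain ⟨h1, h2⟩ := eq_of_eq_add_mul_add_sq_mul (k := fun e => K (t, e))
      (hK.comp (by fun_prop)) hev (ha t (hsub ht0)) (hA t (hsub ht0))
    by_cases he : ε = 0
    · simp [he, h2]
    · simp only [he, if_false, hexp ε htε, h1]
      field_simp
      ring
  · have hfa : ContDiffAt ℝ (⊤ : ℕ∞) f (t₀, ε₀) := hf.contDiffAt (hO.mem_nhds hp)
    have : ContDiffAt ℝ (⊤ : ℕ∞) (fun p : E × ℝ => (p.2 ^ 2)⁻¹ * (f p - c - p.2 * a))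
        (t₀, ε₀) :=
      ((contDiffAt_snd.pow 2).inv (pow_ne_zero 2 hε)).mul
        ((hfa.sub contDiffAt_const).sub (contDiffAt_snd.mul contDiffAt_const))
    refine this.congr_of_eventuallyEq ?_
    filter_upwards [continuousAt_snd.eventually_ne hε] with p hp
    simp [hp]

/-- The derivative in the last variable, in terms of the total derivative. -/
theorem hasDerivAt_parameter
    {E : Type*} [NormedAddCommGroup E] [NormedSpace ℝ E] {Ω : Set E} (hΩ : IsOpen Ω)
    {S : E × ℝ → ℝ} (hS : ContDiffOn ℝ (⊤ : ℕ∞) S (Ω ×ˢ Set.univ)) {p : E} (hp : p ∈ Ω) (ε : ℝ) :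
    HasDerivAt (fun e => S (p, e)) (fderiv ℝ S (p, ε) (0, 1)) ε :=
  HasFDerivAt.comp_hasDerivAt (f := fun e : ℝ => (p, e)) ε
    ((hS.contDiffAt ((hΩ.prod isOpen_univ).mem_nhds ⟨hp, trivial⟩)).differentiableAt
      (by simp)).hasFDerivAt
    ((hasDerivAt_const ε p).prodMk (hasDerivAt_id ε))

/-- At a point that is critical in the directions `U` and `V`, the derivative of `S` along a curve
depends only on its parameter derivative. -/
theorem hasDerivAt_critical_value
    {U V W : Type*} [NormedAddCommGroup U] [InnerProductSpace ℝ U]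
    [NormedAddCommGroup V] [InnerProductSpace ℝ V]
    [NormedAddCommGroup W] [InnerProductSpace ℝ W]
    {Ω : Set (U × V × W)} (hΩ : IsOpen Ω)
    {S : (U × V × W) × ℝ → ℝ} (hS : ContDiffOn ℝ (⊤ : ℕ∞) S (Ω ×ˢ Set.univ))
    {u : ℝ → U} {v : ℝ → V} {t : W} {u' : U} {v' : V} {ε : ℝ}
    (hu : HasDerivAt u u' ε) (hv : HasDerivAt v v' ε) (hmem : (u ε, v ε, t) ∈ Ω)
    (hcritU : fderiv ℝ (fun x : U => S ((x, v ε, t), ε)) (u ε) = 0)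
    (hcritV : fderiv ℝ (fun y : V => S ((u ε, y, t), ε)) (v ε) = 0) :
    HasDerivAt (fun e => S ((u e, v e, t), e)) (fderiv ℝ S ((u ε, v ε, t), ε) (0, 1)) ε ∧
      ∀ x : U, fderiv ℝ S ((u ε, v ε, t), ε) ((x, 0, 0), 0) = 0 := by
  have hSd : HasFDerivAt S (fderiv ℝ S ((u ε, v ε, t), ε)) ((u ε, v ε, t), ε) :=
    ((hS.contDiffAt ((hΩ.prod isOpen_univ).mem_nhds ⟨hmem, trivial⟩)).differentiableAt
      (by simp)).hasFDerivAt
  have hU : ∀ x : U, fderiv ℝ S ((u ε, v ε, t), ε) ((x, 0, 0), 0) = 0 := fun x => by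
    have := HasFDerivAt.comp (f := fun x : U => ((x, v ε, t), ε)) (u ε) hSd
      (((hasFDerivAt_id (𝕜 := ℝ) (u ε)).prodMk (hasFDerivAt_const (v ε, t) (u ε))).prodMk
        (hasFDerivAt_const ε (u ε)))
    have h := congrArg (fun L : U →L[ℝ] ℝ => L x) (this.fderiv.symm.trans hcritU)
    exact h
  have hV : ∀ y : V, fderiv ℝ S ((u ε, v ε, t), ε) ((0, y, 0), 0) = 0 := fun y => by
    have := HasFDerivAt.comp (f := fun y : V => ((u ε, y, t), ε)) (v ε) hSd
      (((hasFDerivAt_const (u ε) (v ε)).prodMk ((hasFDerivAt_id (𝕜 := ℝ) (v ε)).prodMk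
        (hasFDerivAt_const t (v ε)))).prodMk (hasFDerivAt_const ε (v ε)))
    have h := congrArg (fun L : V →L[ℝ] ℝ => L y) (this.fderiv.symm.trans hcritV)
    simpa using h
  refine ⟨?_, hU⟩
  have := HasFDerivAt.comp_hasDerivAt (f := fun e => ((u e, v e, t), e)) ε hSd
    ((hu.prodMk (hv.prodMk (hasDerivAt_const ε t))).prodMk (hasDerivAt_id ε))
  have hsplit : (((u', v', 0), 1) : (U × V × W) × ℝ)
      = ((u', 0, 0), 0) + ((0, v', 0), 0) + (0, 1) := by simp
  rw [hsplit, map_add, map_add, hU, hV, zero_add, zero_add] at this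
  exact this

/-- Second derivative at `0` of a function in normal form along a curve of points that are critical
in the directions `U` and `V`. -/
theorem hasDerivAt_deriv_critical_value
    {U V W : Type*} [NormedAddCommGroup U] [InnerProductSpace ℝ U] [FiniteDimensional ℝ U]
    [NormedAddCommGroup V] [InnerProductSpace ℝ V] [FiniteDimensional ℝ V]
    [NormedAddCommGroup W] [InnerProductSpace ℝ W]
    {Ω : Set (U × V × W)} (hΩ : IsOpen Ω)
    {S : (U × V × W) × ℝ → ℝ} (hS : ContDiffOn ℝ (⊤ : ℕ∞) S (Ω ×ˢ Set.univ))
    {S₁ S₂ : U × V × W → ℝ}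
    (hS₁def : ∀ p, S₁ p = deriv (fun e => S (p, e)) 0)
    (hS₂def : ∀ p, S₂ p = (1 / 2) * deriv (fun e => deriv (fun e' => S (p, e')) e) 0)
    {L₀ : U ≃ₗ[ℝ] U} (hL₀ : ∀ x y : U, ⟪L₀ x, y⟫ = ⟪x, L₀ y⟫) {c₀ : ℝ}
    (hNF0 : ∀ p ∈ Ω, S (p, 0) = (1 / 2) * ⟪L₀ p.1, p.1⟫ + c₀)
    {L₁ : V ≃ₗ[ℝ] V} {c₁ : ℝ}
    (hNF1 : ∀ (v : V) (w : W), ((0, v, w) : U × V × W) ∈ Ω →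
      S₁ (0, v, w) = (1 / 2) * ⟪L₁ v, v⟫ + c₁)
    {u : ℝ → U} {v : ℝ → V} {t : W}
    (hu : ∀ᶠ ε in nhds 0, DifferentiableAt ℝ u ε) (hv : ∀ᶠ ε in nhds 0, DifferentiableAt ℝ v ε)
    (hu0 : u 0 = 0) (hv0 : v 0 = 0)
    (hmem : ∀ᶠ ε in nhds 0, (u ε, v ε, t) ∈ Ω)
    (hcritU : ∀ᶠ ε in nhds 0, fderiv ℝ (fun x : U => S ((x, v ε, t), ε)) (u ε) = 0)
    (hcritV : ∀ᶠ ε in nhds 0, fderiv ℝ (fun y : V => S ((u ε, y, t), ε)) (v ε) = 0) :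
    HasDerivAt (deriv fun e => S ((u e, v e, t), e))
      (2 * ((1 / 2) * ⟪gradient (fun x : U => S₁ (x, 0, t)) 0,
        -(L₀.symm (gradient (fun x : U => S₁ (x, 0, t)) 0))⟫ + S₂ (0, 0, t))) 0 := by
  have hmem0 : ((0, 0, t) : U × V × W) ∈ Ω := by simpa [hu0, hv0] using hmem.self_of_nhds
  have hSa : ∀ p ∈ Ω, ∀ e, ContDiffAt ℝ (⊤ : ℕ∞) S (p, e) := fun p hp e =>
    hS.contDiffAt ((hΩ.prod isOpen_univ).mem_nhds ⟨hp, trivial⟩)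
  have hSd : ∀ p ∈ Ω, ∀ e, HasFDerivAt S (fderiv ℝ S (p, e)) (p, e) := fun p hp e =>
    ((hSa p hp e).differentiableAt (by simp)).hasFDerivAt
  have hDS : HasFDerivAt (fderiv ℝ S) (fderiv ℝ (fderiv ℝ S) ((0, 0, t), 0)) ((0, 0, t), 0) :=
    (((hSa _ hmem0 0).fderiv_right (m := 1) (by norm_cast)).differentiableAt
      one_ne_zero).hasFDerivAt
  have hsymm : IsSymmSndFDerivAt ℝ S (((0, 0, t), 0) : (U × V × W) × ℝ) :=
    (hSa _ hmem0 0).isSymmSndFDerivAt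
      (by rw [minSmoothness_of_isRCLikeNormedField]; exact WithTop.coe_le_coe.2 le_top)
  set B := fderiv ℝ (fderiv ℝ S) (((0, 0, t), 0) : (U × V × W) × ℝ)
  have hDz : ∀ z, HasFDerivAt (fun q => fderiv ℝ S q z) (B.flip z)
      (((0, 0, t), 0) : (U × V × W) × ℝ) := fun z => by
    simpa using hDS.clm_apply (hasFDerivAt_const z (((0, 0, t), 0) : (U × V × W) × ℝ))
  have hΩn : ∀ᶠ p in nhds ((0, 0, t) : U × V × W), p ∈ Ω := hΩ.mem_nhds hmem0
  -- derivative in the parameter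
  have hpar : ∀ p ∈ Ω, ∀ e, HasDerivAt (fun e => S (p, e)) (fderiv ℝ S (p, e) (0, 1)) e :=
    fun p hp e => hasDerivAt_parameter hΩ hS hp e
  have hS₂ : B (0, 1) (0, 1) = 2 * S₂ (0, 0, t) := by
    have h1 : HasDerivAt (fun e => fderiv ℝ S (((0, 0, t), e) : (U × V × W) × ℝ) (0, 1))
        (B (0, 1) (0, 1)) 0 := by
      exact HasFDerivAt.comp_hasDerivAt
        (f := fun e => (((0, 0, t), e) : (U × V × W) × ℝ)) (0 : ℝ) (hDz (0, 1))
        ((hasDerivAt_const (0 : ℝ) ((0, 0, t) : U × V × W)).prodMk (hasDerivAt_id (0 : ℝ)))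
    have h2 : (fun e => deriv (fun e' => S ((0, 0, t), e')) e)
        = fun e => fderiv ℝ S (((0, 0, t), e) : (U × V × W) × ℝ) (0, 1) :=
      funext fun e => (hpar _ hmem0 e).deriv
    rw [hS₂def, h2, h1.deriv]
    ring
  -- derivative of `S₁`
  have hslice : ∀ z, HasFDerivAt (fun p : U × V × W => fderiv ℝ S (p, 0) z)
      ((B.flip z).comp (ContinuousLinearMap.inl ℝ (U × V × W) ℝ)) (0, 0, t) := fun z =>
    HasFDerivAt.comp (f := fun p : U × V × W => (p, (0 : ℝ)))
      ((0, 0, t) : U × V × W) (hDz z) (hasFDerivAt_prodMk_left ((0, 0, t) : U × V × W) (0 : ℝ))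
  have hS₁ : HasFDerivAt S₁
      ((B.flip (0, 1)).comp (ContinuousLinearMap.inl ℝ (U × V × W) ℝ)) (0, 0, t) := by
    refine (hslice (0, 1)).congr_of_eventuallyEq ?_
    filter_upwards [hΩn] with p hp
    rw [hS₁def, (hpar p hp 0).deriv]
  have hgrad : ∀ x : U, B ((x, 0, 0), 0) (0, 1)
      = ⟪gradient (fun x : U => S₁ (x, 0, t)) 0, x⟫ := fun x => by
    have := HasFDerivAt.comp (f := fun x : U => ((x, 0, t) : U × V × W)) 0 hS₁
      (hasFDerivAt_prodMk_left (0 : U) ((0, t) : V × W))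
    rw [inner_gradient_left]
    change _ = fderiv ℝ (S₁ ∘ fun x : U => ((x, 0, t) : U × V × W)) 0 x
    rw [this.fderiv]
    rfl
  have hBV : ∀ y : V, B ((0, y, 0), 0) (0, 1) = 0 := fun y => by
    have h1 := HasFDerivAt.comp (f := fun y : V => ((0, y, t) : U × V × W)) 0 hS₁
      ((hasFDerivAt_const (0 : U) (0 : V)).prodMk (hasFDerivAt_prodMk_left (0 : V) t))
    have h2 : HasFDerivAt (fun y : V => (1 / 2) * ⟪L₁ y, y⟫ + c₁) (0 : V →L[ℝ] ℝ) 0 := by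
      have hL : HasFDerivAt (fun y : V => L₁ y)
          (LinearMap.toContinuousLinearMap L₁.toLinearMap) 0 :=
        (LinearMap.toContinuousLinearMap L₁.toLinearMap).hasFDerivAt
      refine (((hL.inner ℝ (hasFDerivAt_id (0 : V))).const_mul (1 / 2)).add_const
        c₁).congr_fderiv ?_
      ext y
      simp
    have h3 : (S₁ ∘ fun y : V => ((0, y, t) : U × V × W))
        =ᶠ[nhds 0] fun y : V => (1 / 2) * ⟪L₁ y, y⟫ + c₁ := by
      have : ContinuousAt (fun y : V => ((0, y, t) : U × V × W)) 0 := by fun_prop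
      filter_upwards [this hΩn] with y hy using hNF1 y t hy
    have h4 := congrArg (fun L : V →L[ℝ] ℝ => L y) (h1.unique (h2.congr_of_eventuallyEq h3))
    simpa using h4
  -- second derivative of `S (·, 0)`
  have hB0 : ∀ p q : U × V × W, B (p, 0) (q, 0) = ⟪L₀ p.1, q.1⟫ := fun p q => by
    have hL : ∀ x : U, HasFDerivAt (fun y : U => L₀ y)
        (LinearMap.toContinuousLinearMap L₀.toLinearMap) x := fun x =>
      (LinearMap.toContinuousLinearMap L₀.toLinearMap).hasFDerivAt
    have h1 : ∀ p ∈ Ω, fderiv ℝ S (p, 0) (q, 0) = ⟪L₀ p.1, q.1⟫ := fun p hp => by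
      have h2 := HasFDerivAt.comp (f := fun p : U × V × W => (p, (0 : ℝ))) p (hSd p hp 0)
        (hasFDerivAt_prodMk_left p (0 : ℝ))
      have h3 := ((((hL p.1).comp p hasFDerivAt_fst).inner ℝ
        (hasFDerivAt_fst (p := p) (𝕜 := ℝ))).const_mul (1 / 2)).add_const c₀
      have h4 : (S ∘ fun p => (p, (0 : ℝ)))
          =ᶠ[nhds p] fun p => (1 / 2) * ⟪L₀ p.1, p.1⟫ + c₀ := by
        filter_upwards [hΩ.mem_nhds hp] with p hp using hNF0 p hp
      have h5 := congrArg (fun L : U × V × W →L[ℝ] ℝ => L q)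
        (h2.unique (h3.congr_of_eventuallyEq h4))
      have h6 : ⟪L₀ q.1, p.1⟫ = ⟪L₀ p.1, q.1⟫ := by rw [hL₀, real_inner_comm]
      simp at h5
      rw [h5, h6]
      ring
    have h2 := ((hL 0).comp ((0, 0, t) : U × V × W) (hasFDerivAt_fst (𝕜 := ℝ))).inner ℝ
      (hasFDerivAt_const q.1 ((0, 0, t) : U × V × W))
    have h3 := (hslice (q, 0)).unique (h2.congr_of_eventuallyEq
      (by filter_upwards [hΩn] with p hp using h1 p hp))
    simpa using congrArg (fun L : U × V × W →L[ℝ] ℝ => L p) h3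
  -- the curve of critical points
  have hcrit : ∀ᶠ ε in nhds 0,
      HasDerivAt (fun e => S ((u e, v e, t), e)) (fderiv ℝ S ((u ε, v ε, t), ε) (0, 1)) ε ∧
        ∀ x : U, fderiv ℝ S ((u ε, v ε, t), ε) ((x, 0, 0), 0) = 0 := by
    filter_upwards [hu, hv, hmem, hcritU, hcritV] with ε h1 h2 h3 h4 h5 using
      hasDerivAt_critical_value hΩ hS h1.hasDerivAt h2.hasDerivAt h3 h4 h5
  set x₀ := deriv u 0
  set y₀ := deriv v 0
  have hγ : ∀ z, HasDerivAt (fun e => fderiv ℝ S ((u e, v e, t), e) z)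
      (B ((x₀, y₀, 0), 1) z) 0 := fun z => by
    have h1 : HasDerivAt (fun e => (((u e, v e, t), e) : (U × V × W) × ℝ)) ((x₀, y₀, 0), 1) 0 :=
      (hu.self_of_nhds.hasDerivAt.prodMk (hv.self_of_nhds.hasDerivAt.prodMk
        (hasDerivAt_const (0 : ℝ) t))).prodMk (hasDerivAt_id (0 : ℝ))
    have h2 : HasFDerivAt (fun q => fderiv ℝ S q z) (B.flip z) ((u 0, v 0, t), 0) := by
      rw [hu0, hv0]
      exact hDz z
    exact HasFDerivAt.comp_hasDerivAt
      (f := fun e => (((u e, v e, t), e) : (U × V × W) × ℝ)) (0 : ℝ) h2 h1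
  have hsplit : (((x₀, y₀, 0), 1) : (U × V × W) × ℝ)
      = ((x₀, 0, 0), 0) + ((0, y₀, 0), 0) + (0, 1) := by simp
  have hx₀ : x₀ = -(L₀.symm (gradient (fun x : U => S₁ (x, 0, t)) 0)) := by
    have h1 : ∀ x : U, ⟪L₀ x₀, x⟫ + ⟪gradient (fun x : U => S₁ (x, 0, t)) 0, x⟫ = 0 := fun x => by
      have h2 := (hγ ((x, 0, 0), 0)).unique ((hasDerivAt_const (0 : ℝ) (0 : ℝ)).congr_of_eventuallyEq
        (by filter_upwards [hcrit] with ε h using h.2 x))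
      rw [hsplit, map_add, map_add, add_apply, add_apply,
        hB0, hB0, hsymm.eq (0, 1), hgrad] at h2
      simpa using h2
    have h2 : L₀ x₀ + gradient (fun x : U => S₁ (x, 0, t)) 0 = 0 :=
      ext_inner_right ℝ fun x => by rw [inner_add_left, h1, inner_zero_left]
    rw [← map_neg, ← eq_neg_of_add_eq_zero_left h2, LinearEquiv.symm_apply_apply]
  have hmain := (hγ (0, 1)).congr_of_eventuallyEq
    (show (deriv fun e => S ((u e, v e, t), e)) =ᶠ[nhds 0] _ by
      filter_upwards [hcrit] with ε h using h.1.deriv)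
  rw [hsplit, map_add, map_add, add_apply, add_apply,
    hgrad, hBV, hS₂, hx₀] at hmain
  refine hmain.congr_deriv ?_
  ring

/-- The rescaled function `S'(t,ε) = ε⁻²(S(u(t,ε),v(t,ε),t,ε) − S(0,0) − ε S₁(0))`
extends smoothly across `ε = 0`, with leading term
`S'(t,0) = ½⟨∇ᵤS₁(0,0,t), λ(t)⟩ + S₂(0,0,t)`. -/
theorem stmt2
    {U V W : Type*} [NormedAddCommGroup U] [InnerProductSpace ℝ U] [FiniteDimensional ℝ U]
    [NormedAddCommGroup V] [InnerProductSpace ℝ V] [FiniteDimensional ℝ V]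
    [NormedAddCommGroup W] [InnerProductSpace ℝ W] [FiniteDimensional ℝ W]
    (Ω : Set (U × V × W)) (hΩ : IsOpen Ω) (hΩ0 : (0 : U × V × W) ∈ Ω)
    (S : (U × V × W) × ℝ → ℝ) (hS : ContDiffOn ℝ (⊤ : ℕ∞) S (Ω ×ˢ Set.univ))
    (S₁ S₂ : U × V × W → ℝ)
    (hS₁def : ∀ p, S₁ p = deriv (fun e => S (p, e)) 0)
    (hS₂def : ∀ p, S₂ p = (1 / 2) * deriv (fun e => deriv (fun e' => S (p, e')) e) 0)
    (L₀ : U ≃ₗ[ℝ] U) (hL₀ : ∀ x y : U, ⟪L₀ x, y⟫ = ⟪x, L₀ y⟫) (c₀ : ℝ)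
    (hNF0 : ∀ p ∈ Ω, S (p, 0) = (1 / 2) * ⟪L₀ p.1, p.1⟫ + c₀)
    (L₁ : V ≃ₗ[ℝ] V) (hL₁ : ∀ x y : V, ⟪L₁ x, y⟫ = ⟪x, L₁ y⟫) (c₁ : ℝ)
    (hNF1 : ∀ (v : V) (w : W), ((0, v, w) : U × V × W) ∈ Ω →
      S₁ (0, v, w) = (1 / 2) * ⟪L₁ v, v⟫ + c₁)
    (δ : ℝ) (hδ : 0 < δ)
    (U' : Set W) (hU' : IsOpen U') (hU'0 : (0 : W) ∈ U')
    (u : W × ℝ → U) (v : W × ℝ → V)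
    (hu : ContDiffOn ℝ (⊤ : ℕ∞) u (U' ×ˢ Set.Ioo (-δ) δ))
    (hv : ContDiffOn ℝ (⊤ : ℕ∞) v (U' ×ˢ Set.Ioo (-δ) δ))
    (hu0 : ∀ t ∈ U', u (t, 0) = 0) (hv0 : ∀ t ∈ U', v (t, 0) = 0)
    (hmem : ∀ t ∈ U', ∀ ε ∈ Set.Ioo (-δ) δ, ((u (t, ε), v (t, ε), t) : U × V × W) ∈ Ω)
    (hcritU : ∀ t ∈ U', ∀ ε ∈ Set.Ioo (-δ) δ,
      fderiv ℝ (fun u' : U => S ((u', v (t, ε), t), ε)) (u (t, ε)) = 0)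
    (hcritV : ∀ t ∈ U', ∀ ε ∈ Set.Ioo (-δ) δ,
      fderiv ℝ (fun v' : V => S ((u (t, ε), v', t), ε)) (v (t, ε)) = 0) :
    ∃ S' : W × ℝ → ℝ,
      ContDiffOn ℝ (⊤ : ℕ∞) S' (U' ×ˢ Set.Ioo (-δ) δ) ∧
      (∀ t ∈ U', ∀ ε ∈ Set.Ioo (-δ) δ, ε ≠ 0 →
        S' (t, ε) = (ε ^ 2)⁻¹ *
          (S ((u (t, ε), v (t, ε), t), ε) - S ((0 : U × V × W), 0)
            - ε * S₁ (0 : U × V × W))) ∧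
      (∀ t ∈ U',
        S' (t, 0) =
          (1 / 2) * ⟪gradient (fun u' : U => S₁ (u', 0, t)) 0,
              -(L₀.symm (gradient (fun u' : U => S₁ (u', 0, t)) 0))⟫
            + S₂ (0, 0, t)) := by
  have hmem0 : ∀ t ∈ U', ((0, 0, t) : U × V × W) ∈ Ω := fun t ht => by
    simpa [hu0 t ht, hv0 t ht] using hmem t ht 0 ⟨by linarith, hδ⟩
  have hO : IsOpen (U' ×ˢ Set.Ioo (-δ) δ) := hU'.prod isOpen_Ioo
  have hI : ∀ᶠ ε in nhds (0 : ℝ), ε ∈ Set.Ioo (-δ) δ := Ioo_mem_nhds (by linarith) hδ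
  have hslice : ∀ t ε, DifferentiableAt ℝ (fun e : ℝ => ((t, e) : W × ℝ)) ε := by fun_prop
  have hud : ∀ t ∈ U', ∀ ε ∈ Set.Ioo (-δ) δ, DifferentiableAt ℝ (fun e => u (t, e)) ε :=
    fun t ht ε hε => DifferentiableAt.comp (f := fun e : ℝ => (t, e)) ε
      ((hu.contDiffAt (hO.mem_nhds ⟨ht, hε⟩)).differentiableAt (by simp)) (hslice t ε)
  have hvd : ∀ t ∈ U', ∀ ε ∈ Set.Ioo (-δ) δ, DifferentiableAt ℝ (fun e => v (t, e)) ε :=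
    fun t ht ε hε => DifferentiableAt.comp (f := fun e : ℝ => (t, e)) ε
      ((hv.contDiffAt (hO.mem_nhds ⟨ht, hε⟩)).differentiableAt (by simp)) (hslice t ε)
  have hf : ContDiffOn ℝ (⊤ : ℕ∞) (fun p : W × ℝ => S ((u p, v p, p.1), p.2))
      (U' ×ˢ Set.Ioo (-δ) δ) :=
    hS.comp ((hu.prodMk (hv.prodMk contDiffOn_fst)).prodMk contDiffOn_snd)
      fun p hp => ⟨hmem p.1 hp.1 p.2 hp.2, trivial⟩
  have hS0 : ∀ w : W, ((0, 0, w) : U × V × W) ∈ Ω → S ((0, 0, w), 0) = c₀ := fun w hw => by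
    simpa using hNF0 _ hw
  have hS₁0 : ∀ w : W, ((0, 0, w) : U × V × W) ∈ Ω → S₁ (0, 0, w) = c₁ := fun w hw => by
    simpa using hNF1 0 w hw
  refine ⟨_, contDiffOn_second_order_quotient hO hf
    (c := S ((0 : U × V × W), 0)) (a := S₁ (0 : U × V × W))
    (A := fun t => (1 / 2) * ⟪gradient (fun u' : U => S₁ (u', 0, t)) 0,
      -(L₀.symm (gradient (fun u' : U => S₁ (u', 0, t)) 0))⟫ + S₂ (0, 0, t))
    (fun t ht => ?_) (fun t ht => ?_) (fun t ht => ?_),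
    fun t ht ε hε hε0 => by simp [hε0], fun t ht => by simp⟩
  · simp only [hu0 t ht.1, hv0 t ht.1]
    exact (hS0 t (hmem0 t ht.1)).trans (hS0 0 hΩ0).symm
  · have h := (hasDerivAt_critical_value (u := fun e => u (t, e)) (v := fun e => v (t, e))
      hΩ hS (hud t ht.1 0 ht.2).hasDerivAt
      (hvd t ht.1 0 ht.2).hasDerivAt (hmem t ht.1 0 ht.2) (hcritU t ht.1 0 ht.2)
      (hcritV t ht.1 0 ht.2)).1
    refine h.congr_deriv ?_
    rw [hu0 t ht.1, hv0 t ht.1, ← (hasDerivAt_parameter hΩ hS (hmem0 t ht.1) 0).deriv,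
      ← hS₁def, hS₁0 t (hmem0 t ht.1)]
    exact (hS₁0 0 hΩ0).symm
  · exact hasDerivAt_deriv_critical_value (u := fun e => u (t, e)) (v := fun e => v (t, e)) hΩ hS hS₁def hS₂def hL₀ hNF0 hNF1
      (hI.mono (hud t ht.1)) (hI.mono (hvd t ht.1)) (hu0 t ht.1) (hv0 t ht.1)
      (hI.mono (hmem t ht.1)) (hI.mono (hcritU t ht.1)) (hI.mono (hcritV t ht.1))
end

section
/- Let U, V, W be finite-dimensional real inner product spaces, Ω ⊆ U × V × W an open neighborhood of the origin, and S : Ω × ℝ → ℝ a smooth function satisfying (NF0) and (NF1). Define λ(t) := −L₀^{-1}(∇_u S₁(0,0,t)) and S'₀(t) := (1/2)⟨∇_u S₁(0,0,t), λ(t)⟩ + S₂(0,0,t) for t in a neighborhood of 0 in W. Suppose 0 ∈ W is a nondegenerate critical point of S'₀. Then there exist an open neighborhood 𝒰₀ ⊆ Ω of the origin, a constant ε₀ > 0, and a smooth map ε ↦ x_ε from [−ε₀, ε₀] to 𝒰₀ with x₀ = 0, such that for every ε with 0 < |ε| ≤ ε₀ the point x_ε is the unique critical point of S(·,ε) in 𝒰₀,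 and this critical point is nondegenerate. -/
open scoped RealInnerProductSpace
open scoped Topology ContDiff

/-- An integral over `[0, 1]` depending smoothly on a parameter is smooth in the parameter. -/
theorem contDiff_integral_unitInterval {X F : Type*} [NormedAddCommGroup X] [NormedSpace ℝ X]
    [FiniteDimensional ℝ X] [NormedAddCommGroup F] [NormedSpace ℝ F] [CompleteSpace F]
    {f : X × ℝ → F} (hf : ContDiff ℝ ∞ f) :
    ContDiff ℝ ∞ (fun x => ∫ s in (0 : ℝ)..1, f (x, s)) := by
  have : ProperSpace X := FiniteDimensional.proper ℝ X
  have hderiv : ∀ {g : X × ℝ → F}, ContDiff ℝ ∞ g → ∀ x₀ : X,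
      HasFDerivAt (fun x => ∫ s in (0 : ℝ)..1, g (x, s))
        (∫ s in (0 : ℝ)..1, (fderiv ℝ g (x₀, s)).comp (ContinuousLinearMap.inl ℝ X ℝ)) x₀ := by
    intro g hg x₀
    have hg' : Continuous (fun z : X × ℝ =>
        (fderiv ℝ g z).comp (ContinuousLinearMap.inl ℝ X ℝ)) :=
      (hg.continuous_fderiv (by simp)).clm_comp continuous_const
    obtain ⟨C, hC⟩ := ((isCompact_closedBall x₀ 1).prod
      (isCompact_Icc (a := (0 : ℝ)) (b := 1))).exists_bound_of_continuousOn hg'.continuousOn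
    refine intervalIntegral.hasFDerivAt_integral_of_dominated_of_fderiv_le
      (F := fun x s => g (x, s))
      (F' := fun x s => (fderiv ℝ g (x, s)).comp (ContinuousLinearMap.inl ℝ X ℝ))
      (bound := fun _ => C) (Metric.closedBall_mem_nhds x₀ one_pos) ?_ ?_ ?_ ?_ ?_ ?_
    · exact .of_forall fun x =>
        (hg.continuous.comp (Continuous.prodMk_right x)).aestronglyMeasurable
    · exact (hg.continuous.comp (Continuous.prodMk_right x₀)).intervalIntegrable _ _
    · exact (hg'.comp (Continuous.prodMk_right x₀)).aestronglyMeasurable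
    · refine .of_forall fun t ht x hx => hC (x, t) ⟨hx, ?_⟩
      rw [Set.uIoc_of_le zero_le_one] at ht
      exact Set.Ioc_subset_Icc_self ht
    · exact intervalIntegrable_const
    · refine .of_forall fun t _ x _ => ?_
      exact ((hg.differentiable (by simp)) (x, t)).hasFDerivAt.comp x
        (hasFDerivAt_prodMk_left x t)
  refine contDiff_infty.2 fun n => ?_
  induction n generalizing f with
  | zero =>
    exact contDiff_zero.2 (intervalIntegral.continuous_parametric_intervalIntegral_of_continuous'
      (f := fun x s => f (x, s)) hf.continuous _ _)
  | succ n ih =>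
    rw [Nat.cast_succ]
    refine contDiff_succ_iff_fderiv_apply.2
      ⟨fun x => (hderiv hf x).differentiableAt, fun h => absurd h (by simp), fun y => ?_⟩
    have hy : ContDiff ℝ ∞ (fun z : X × ℝ => fderiv ℝ f z (y, 0)) :=
      (hf.fderiv_right (by simp)).clm_apply contDiff_const
    convert ih hy using 2 with x
    have hc : Continuous (fun s : ℝ =>
        (fderiv ℝ f (x, s)).comp (ContinuousLinearMap.inl ℝ X ℝ)) :=
      ((hf.continuous_fderiv (by simp)).comp (Continuous.prodMk_right x)).clm_comp continuous_const
    rw [(hderiv hf x).fderiv, ContinuousLinearMap.intervalIntegral_apply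
      (hc.intervalIntegrable _ _)]
    rfl

/-- Hadamard's lemma: increments of a smooth map depend linearly on the displacement, through
a smooth family of linear maps. -/
theorem ContDiff.exists_sub_eq_clm_apply {X F : Type*} [NormedAddCommGroup X] [NormedSpace ℝ X]
    [FiniteDimensional ℝ X] [NormedAddCommGroup F] [NormedSpace ℝ F] [CompleteSpace F]
    {f : X → F} (hf : ContDiff ℝ ∞ f) :
    ∃ K : X × X → (X →L[ℝ] F), ContDiff ℝ ∞ K ∧ (∀ a b, f b - f a = K (a, b) (b - a)) ∧
      ∀ a, K (a, a) = fderiv ℝ f a := by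
  have hf' : ContDiff ℝ ∞ (fderiv ℝ f) := hf.fderiv_right (by simp)
  refine ⟨fun z => ∫ s in (0 : ℝ)..1, fderiv ℝ f (z.1 + s • (z.2 - z.1)),
    contDiff_integral_unitInterval
      (f := fun w : (X × X) × ℝ => fderiv ℝ f (w.1.1 + w.2 • (w.1.2 - w.1.1)))
      (hf'.comp (by fun_prop)), fun a b => ?_, fun a => by simp⟩
  have hc : Continuous (fun s : ℝ => fderiv ℝ f (a + s • (b - a))) :=
    hf'.continuous.comp (by fun_prop)
  have hd : ∀ s : ℝ, HasDerivAt (fun s : ℝ => f (a + s • (b - a)))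
      (fderiv ℝ f (a + s • (b - a)) (b - a)) s := fun s => by
    have h1 : HasDerivAt (fun s : ℝ => a + s • (b - a)) (b - a) s := by
      simpa using ((hasDerivAt_id s).smul_const (b - a)).const_add a
    exact ((hf.differentiable (by simp)) _).hasFDerivAt.comp_hasDerivAt s h1
  have := intervalIntegral.integral_eq_sub_of_hasDerivAt (a := 0) (b := 1) (fun s _ => hd s)
    ((hc.clm_apply continuous_const).intervalIntegrable _ _)
  dsimp only
  rw [ContinuousLinearMap.intervalIntegral_apply (hc.intervalIntegrable _ _), this]
  simp

/-- Smooth implicit function theorem with a quantified neighbourhood: the zero set of a smooth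
family `G(·, ε)` whose derivative at the origin is injective is locally a smooth curve. -/
theorem ContDiff.exists_unique_zero_curve {X F : Type*} [NormedAddCommGroup X] [NormedSpace ℝ X]
    [FiniteDimensional ℝ X] [NormedAddCommGroup F] [NormedSpace ℝ F] [FiniteDimensional ℝ F]
    (hdim : Module.finrank ℝ X = Module.finrank ℝ F)
    {G : X × ℝ → F} (hG : ContDiff ℝ ∞ G) (hG0 : G 0 = 0)
    (hinj : ∀ k : X, fderiv ℝ G 0 (k, 0) = 0 → k = 0)
    {O : Set (X × ℝ)} (hO : O ∈ 𝓝 0) :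
    ∃ (U₀ : Set X) (ε₀ : ℝ) (x : ℝ → X), IsOpen U₀ ∧ 0 ∈ U₀ ∧ 0 < ε₀ ∧
      ContDiffOn ℝ ∞ x (Set.Icc (-ε₀) ε₀) ∧ (∀ ε ∈ Set.Icc (-ε₀) ε₀, x ε ∈ U₀) ∧ x 0 = 0 ∧
      (∀ y ∈ U₀, ∀ ε ∈ Set.Icc (-ε₀) ε₀, (y, ε) ∈ O) ∧
      ∀ ε ∈ Set.Icc (-ε₀) ε₀, G (x ε, ε) = 0 ∧
        (∀ k : X, fderiv ℝ G (x ε, ε) (k, 0) = 0 → k = 0) ∧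
        ∀ y ∈ U₀, G (y, ε) = 0 → y = x ε := by
  have : CompleteSpace X := FiniteDimensional.complete ℝ X
  set Φ : X × ℝ → F × ℝ := fun z => (G z, z.2) with hΦdef
  have hΦ : ContDiff ℝ ∞ Φ := hG.prodMk contDiff_snd
  have hΦ' : ∀ z, HasFDerivAt Φ ((fderiv ℝ G z).prod (ContinuousLinearMap.snd ℝ X ℝ)) z :=
    fun z => ((hG.differentiable (by simp)) z).hasFDerivAt.prodMk hasFDerivAt_snd
  have hfd : ∀ z, fderiv ℝ Φ z = (fderiv ℝ G z).prod (ContinuousLinearMap.snd ℝ X ℝ) :=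
    fun z => (hΦ' z).fderiv
  have hinj0 : Function.Injective (fderiv ℝ Φ 0) := by
    rw [injective_iff_map_eq_zero]
    rintro ⟨k, e⟩ h
    rw [hfd] at h
    obtain ⟨h1, rfl⟩ : fderiv ℝ G 0 (k, e) = 0 ∧ e = 0 := by simpa using h
    rw [hinj k h1]
    rfl
  let L : (X × ℝ) ≃L[ℝ] (F × ℝ) :=
    (LinearMap.linearEquivOfInjective (fderiv ℝ Φ 0 : X × ℝ →ₗ[ℝ] F × ℝ) hinj0
      (by simp [hdim])).toContinuousLinearEquiv
  have hL : (L : X × ℝ →L[ℝ] F × ℝ) = fderiv ℝ Φ 0 :=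
    ContinuousLinearMap.ext fun _ => rfl
  have hL' : HasFDerivAt Φ (L : X × ℝ →L[ℝ] F × ℝ) 0 := by
    rw [hL]
    exact ((hΦ.differentiable (by simp)) 0).hasFDerivAt
  have hn : (∞ : WithTop ℕ∞) ≠ 0 := by simp
  let e := hΦ.contDiffAt.toOpenPartialHomeomorph Φ hL' hn
  have he : (e : X × ℝ → F × ℝ) = Φ := rfl
  have hmem : (0 : X × ℝ) ∈ e.source := ContDiffAt.mem_toOpenPartialHomeomorph_source _ hL' hn
  have hI : {z | fderiv ℝ Φ z ∈ Set.range ((↑) : ((X × ℝ) ≃L[ℝ] (F × ℝ)) → _)} ∈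
      𝓝 (0 : X × ℝ) := by
    refine (hΦ.continuous_fderiv hn).continuousAt ?_
    rw [← hL]
    exact ContinuousLinearEquiv.nhds L
  have hs : e.source ∩ (O ∩ {z | fderiv ℝ Φ z ∈
      Set.range ((↑) : ((X × ℝ) ≃L[ℝ] (F × ℝ)) → _)}) ∈ 𝓝 (0 : X × ℝ) :=
    Filter.inter_mem (e.open_source.mem_nhds hmem) (Filter.inter_mem hO hI)
  obtain ⟨r, hr, hrs⟩ := Metric.mem_nhds_iff.1 hs
  have hΦ0 : Φ 0 = 0 := by simp [hΦdef, hG0]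
  have h0t : (0 : F × ℝ) ∈ e.target := hΦ0 ▸ e.map_source hmem
  have hsymm0 : e.symm 0 = 0 := by
    have := e.left_inv hmem
    rwa [he, hΦ0] at this
  have hcurve : {ε : ℝ | ((0 : F), ε) ∈ e.target ∧ e.symm ((0 : F), ε) ∈ Metric.ball 0 r} ∈
      𝓝 (0 : ℝ) := by
    have hpre : e.target ∩ e.symm ⁻¹' Metric.ball 0 r ∈ 𝓝 ((0 : F), (0 : ℝ)) :=
      Filter.inter_mem (e.open_target.mem_nhds h0t)
        ((e.continuousAt_symm h0t) (by rw [hsymm0]; exact Metric.ball_mem_nhds 0 hr))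
    exact (Continuous.prodMk_right (0 : F)).continuousAt hpre
  obtain ⟨δ, hδ, hδs⟩ := Metric.mem_nhds_iff.1 hcurve
  have hε : 0 < min δ r / 2 := by positivity
  have hsmall : ∀ ε ∈ Set.Icc (-(min δ r / 2)) (min δ r / 2), |ε| < δ ∧ |ε| < r := by
    intro ε hε'
    have := abs_le.2 hε'
    constructor
    · linarith [min_le_left δ r]
    · linarith [min_le_right δ r]
  have hball : ∀ ε ∈ Set.Icc (-(min δ r / 2)) (min δ r / 2),
      ((0 : F), ε) ∈ e.target ∧ e.symm ((0 : F), ε) ∈ Metric.ball 0 r := fun ε hε' =>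
    hδs (by simpa using (hsmall ε hε').1)
  have hΦsymm : ∀ ε ∈ Set.Icc (-(min δ r / 2)) (min δ r / 2),
      e.symm ((0 : F), ε) = ((e.symm ((0 : F), ε)).1, ε) ∧
        G ((e.symm ((0 : F), ε)).1, ε) = 0 := fun ε hε' => by
    have h := e.right_inv (hball ε hε').1
    obtain ⟨h1, h2⟩ := Prod.ext_iff.1 h
    have h3 : e.symm ((0 : F), ε) = ((e.symm ((0 : F), ε)).1, ε) := Prod.ext rfl h2
    exact ⟨h3, by rw [← h3]; exact h1⟩
  have hprod : ∀ y ∈ Metric.ball (0 : X) r, ∀ ε ∈ Set.Icc (-(min δ r / 2)) (min δ r / 2),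
      (y, ε) ∈ Metric.ball (0 : X × ℝ) r := fun y hy ε hε' => by
    rw [mem_ball_zero_iff] at hy ⊢
    exact max_lt hy (hsmall ε hε').2
  refine ⟨Metric.ball 0 r, min δ r / 2, fun ε => (e.symm ((0 : F), ε)).1, Metric.isOpen_ball,
    Metric.mem_ball_self hr, hε, ?_, ?_, ?_, ?_, ?_⟩
  · intro ε hε'
    obtain ⟨h1, h2⟩ := hball ε hε'
    obtain ⟨-, -, M, hM⟩ := hrs h2
    have h3 : ContDiffAt ℝ ∞ e.symm ((0 : F), ε) := by
      refine e.contDiffAt_symm (f₀' := M) h1 ?_ hΦ.contDiffAt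
      rw [hM]
      exact ((hΦ.differentiable hn) _).hasFDerivAt
    exact (contDiffAt_fst.comp ε (h3.comp ε
      (contDiff_prodMk_right (0 : F)).contDiffAt)).contDiffWithinAt
  · intro ε hε'
    have := (hball ε hε').2
    rw [mem_ball_zero_iff] at this ⊢
    exact (le_max_left _ _).trans_lt this
  · change (e.symm 0).1 = 0
    rw [hsymm0]
    rfl
  · exact fun y hy ε hε' => (hrs (hprod y hy ε hε')).2.1
  · intro ε hε'
    obtain ⟨h1, h2⟩ := hΦsymm ε hε'
    refine ⟨h2, fun k hk => ?_, fun y hy hGy => ?_⟩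
    · obtain ⟨-, -, M, hM⟩ := hrs (hball ε hε').2
      rw [h1] at hM
      have : M (k, 0) = 0 := by
        change (M : X × ℝ →L[ℝ] F × ℝ) (k, 0) = 0
        rw [hM, hfd]
        simp [hk]
      exact (Prod.ext_iff.1 ((map_eq_zero_iff M M.injective).1 this)).1
    · have hys := (hrs (hprod y hy ε hε')).1
      have := e.left_inv hys
      rw [he] at this
      simp only [hΦdef, hGy] at this
      simp [this]

section NormalForm

variable {U V W : Type*} [NormedAddCommGroup U] [InnerProductSpace ℝ U]
  [NormedAddCommGroup V] [InnerProductSpace ℝ V] [NormedAddCommGroup W] [InnerProductSpace ℝ W]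

/-- The derivative of the leading term along the degenerate directions. -/
theorem fderiv_leadingTerm_apply {R : (U × V × W) × ℝ → ℝ} (hR : ContDiff ℝ ∞ R)
    {L₀ : U ≃L[ℝ] U} (hL₀ : ∀ x y : U, ⟪L₀ x, y⟫ = ⟪x, L₀ y⟫) {Q : W → U}
    (hQ : Differentiable ℝ Q)
    (hQR : ∀ t b, ⟪L₀ (Q t), b⟫ = fderiv ℝ R ((0, 0, t), 0) ((b, 0, 0), 0)) (t a : W) :
    fderiv ℝ (fun t => -(1 / 2) * ⟪L₀ (Q t), Q t⟫ + fderiv ℝ R ((0, 0, t), 0) (0, 1)) t a =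
      fderiv ℝ (fderiv ℝ R) ((0, 0, t), 0) ((-Q t, 0, 0), 1) ((0, 0, a), 0) := by
  have hR' : ContDiff ℝ ∞ (fderiv ℝ R) := hR.fderiv_right (by simp)
  let ι : W →L[ℝ] (U × V × W) × ℝ := (ContinuousLinearMap.inl ℝ (U × V × W) ℝ).comp
    ((ContinuousLinearMap.inr ℝ U (V × W)).comp (ContinuousLinearMap.inr ℝ V W))
  have hDR : ∀ b : (U × V × W) × ℝ, HasFDerivAt (fun t => fderiv ℝ R ((0, 0, t), 0) b)
      ((ContinuousLinearMap.apply ℝ ℝ b).comp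
        ((fderiv ℝ (fderiv ℝ R) ((0, 0, t), 0)).comp ι)) t := fun b =>
    (ContinuousLinearMap.apply ℝ ℝ b).hasFDerivAt.comp t
      (HasFDerivAt.comp t ((hR'.differentiable (by simp)) (ι t)).hasFDerivAt ι.hasFDerivAt)
  have hL : ∀ b, ⟪L₀ (fderiv ℝ Q t a), b⟫ =
      fderiv ℝ (fderiv ℝ R) ((0, 0, t), 0) ((0, 0, a), 0) ((b, 0, 0), 0) := fun b => by
    have h1 : HasFDerivAt (fun t => ⟪L₀ (Q t), b⟫) _ t :=
      (L₀.hasFDerivAt.comp t (hQ t).hasFDerivAt).inner ℝ (hasFDerivAt_const b t)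
    have h2 := hDR ((b, 0, 0), 0)
    simp only [hQR] at h1
    simpa [ι] using DFunLike.congr_fun (h1.unique h2) a
  have h1 := (((L₀.hasFDerivAt.comp t (hQ t).hasFDerivAt).inner ℝ (hQ t).hasFDerivAt).const_mul
    (-(1 / 2) : ℝ)).add (hDR (0, 1))
  have h2 : HasFDerivAt
      (fun t => -(1 / 2) * ⟪L₀ (Q t), Q t⟫ + fderiv ℝ R ((0, 0, t), 0) (0, 1)) _ t := h1
  have hsymm : IsSymmSndFDerivAt ℝ R ((0, 0, t), 0) :=
    hR.contDiffAt.isSymmSndFDerivAt (by simpa using WithTop.coe_le_coe.2 (le_top : (2 : ℕ∞) ≤ ⊤))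
  have hsplit : (((-Q t, 0, 0), 1) : (U × V × W) × ℝ) = (0, 1) - ((Q t, 0, 0), 0) := by simp
  rw [h2.fderiv, hsymm.eq, hsplit, map_sub, ← hL]
  have h3 : ⟪L₀ (Q t), fderiv ℝ Q t a⟫ = ⟪L₀ (fderiv ℝ Q t a), Q t⟫ := by
    rw [hL₀, real_inner_comm]
  simp [ι, h3]
  ring

/-- The derivative of a function that is quadratic in `v` along `u = 0`. -/
theorem eventually_fderiv_eq_inner {R : (U × V × W) × ℝ → ℝ} (hR : ContDiff ℝ ∞ R)
    {L₁ : V ≃L[ℝ] V} (hL₁ : ∀ x y : V, ⟪L₁ x, y⟫ = ⟪x, L₁ y⟫) {c₁ : ℝ}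
    (hR₁ : ∀ᶠ y : V × W in 𝓝 0, R ((0, y), 0) = (1 / 2) * ⟪L₁ y.1, y.1⟫ + c₁) :
    ∀ᶠ y : V × W in 𝓝 0, ∀ b : V × W, fderiv ℝ R ((0, y), 0) ((0, b), 0) = ⟪L₁ y.1, b.1⟫ := by
  filter_upwards [hR₁.eventually_nhds] with y hy b
  let ι : V × W →L[ℝ] (U × V × W) × ℝ := (ContinuousLinearMap.inl ℝ (U × V × W) ℝ).comp
    (ContinuousLinearMap.inr ℝ U (V × W))
  have h1 : HasFDerivAt (fun y : V × W => R ((0, y), 0)) _ y :=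
    HasFDerivAt.comp y ((hR.differentiable (by simp)) (ι y)).hasFDerivAt ι.hasFDerivAt
  have h2 : HasFDerivAt (fun y : V × W => (1 / 2) * ⟪L₁ y.1, y.1⟫ + c₁) _ y :=
    (((L₁.hasFDerivAt.comp y hasFDerivAt_fst).inner ℝ hasFDerivAt_fst).const_mul _).add_const c₁
  have h3 := DFunLike.congr_fun
    ((h1.congr_of_eventuallyEq (Filter.EventuallyEq.symm hy)).unique h2) b
  have h4 : ⟪L₁ b.1, y.1⟫ = ⟪L₁ y.1, b.1⟫ := by rw [hL₁, real_inner_comm]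
  simp [ι, h4] at h3
  rw [h3]
  ring

set_option maxHeartbeats 1000000 in
/-- A function `½⟨L₀u, u⟩ + c₀ + ε R(u, v, w, ε)` whose leading term along `W` has a nondegenerate
critical point at the origin has a smooth curve of nondegenerate critical points, unique near
the origin. -/
theorem exists_nondegenerate_critical_curve [FiniteDimensional ℝ U] [FiniteDimensional ℝ V]
    [FiniteDimensional ℝ W] {R : (U × V × W) × ℝ → ℝ} (hR : ContDiff ℝ ∞ R)
    {L₀ : U ≃L[ℝ] U} (hL₀ : ∀ x y : U, ⟪L₀ x, y⟫ = ⟪x, L₀ y⟫) (c₀ : ℝ)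
    {L₁ : V ≃L[ℝ] V} (hL₁ : ∀ x y : V, ⟪L₁ x, y⟫ = ⟪x, L₁ y⟫) {c₁ : ℝ}
    (hR₁ : ∀ᶠ y : V × W in 𝓝 0, R ((0, y), 0) = (1 / 2) * ⟪L₁ y.1, y.1⟫ + c₁)
    {g : W → U} (hg : ∀ᶠ t in 𝓝 0, ∀ b, ⟪g t, b⟫ = fderiv ℝ R ((0, 0, t), 0) ((b, 0, 0), 0))
    {S₀' : W → ℝ} (hS₀' : ∀ᶠ t in 𝓝 0,
      S₀' t = -(1 / 2) * ⟪g t, L₀.symm (g t)⟫ + fderiv ℝ R ((0, 0, t), 0) (0, 1))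
    (hcrit0 : fderiv ℝ S₀' 0 = 0)
    (hnondeg0 : ∀ h : W, (∀ k : W, fderiv ℝ (fderiv ℝ S₀') 0 h k = 0) → h = 0)
    {B : Set (U × V × W)} (hB : B ∈ 𝓝 0) {F : ℝ → U × V × W → ℝ}
    (hF : ∀ ε p, F ε p = (1 / 2) * ⟪L₀ p.1, p.1⟫ + c₀ + ε * R (p, ε)) :
    ∃ (U₀ : Set (U × V × W)) (ε₀ : ℝ) (x : ℝ → U × V × W),
      IsOpen U₀ ∧ (0 : U × V × W) ∈ U₀ ∧ U₀ ⊆ B ∧ 0 < ε₀ ∧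
      ContDiffOn ℝ ∞ x (Set.Icc (-ε₀) ε₀) ∧
      (∀ ε ∈ Set.Icc (-ε₀) ε₀, x ε ∈ U₀) ∧ x 0 = 0 ∧
      ∀ ε : ℝ, 0 < |ε| → |ε| ≤ ε₀ →
        fderiv ℝ (F ε) (x ε) = 0 ∧
        (∀ h : U × V × W,
          (∀ k : U × V × W, fderiv ℝ (fderiv ℝ (F ε)) (x ε) h k = 0) → h = 0) ∧
        ∀ y ∈ U₀, fderiv ℝ (F ε) y = 0 → y = x ε := by
  have hn : (∞ : WithTop ℕ∞) ≠ 0 := by simp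
  -- the Riesz representative with respect to the form of `L₀`
  obtain ⟨ρ, hρ⟩ : ∃ ρ : (U →L[ℝ] ℝ) →L[ℝ] U, ∀ φ b, ⟪L₀ (ρ φ), b⟫ = φ b := by
    refine ⟨LinearMap.toContinuousLinearMap
      { toFun := fun φ => L₀.symm ((InnerProductSpace.toDual ℝ U).symm φ)
        map_add' := by simp
        map_smul' := by simp }, fun φ b => ?_⟩
    simp
  have hρ_inner : ∀ a : U, ρ (innerSL ℝ (L₀ a)) = a := fun a =>
    L₀.injective (ext_inner_right ℝ fun b => by simp [hρ])
  let jU : U →L[ℝ] (U × V × W) := ContinuousLinearMap.inl ℝ U (V × W)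
  let ι : (U × V × W) →L[ℝ] (U × V × W) × ℝ := ContinuousLinearMap.inl ℝ (U × V × W) ℝ
  have hR' : ContDiff ℝ ∞ (fderiv ℝ R) := hR.fderiv_right (by simp)
  -- `T` is the differential of `R` in the space variables
  obtain ⟨T, hT, hTd⟩ : ∃ T : (U × V × W) × ℝ → ((U × V × W) →L[ℝ] ℝ),
      (∀ z, T z = (fderiv ℝ R z).comp ι) ∧
      ContDiff ℝ ∞ T :=
    ⟨fun z => (fderiv ℝ R z).comp ι, fun z => rfl, hR'.clm_comp contDiff_const⟩
  have hTapp : ∀ z h, T z h = fderiv ℝ R z (h, 0) := fun z h => by rw [hT]; rfl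
  obtain ⟨K, hKd, hK, hKdiag⟩ := hTd.exists_sub_eq_clm_apply
  let π : (U × V × W) × ℝ → (U × V × W) × ℝ := fun z => ((0, z.1.2), 0)
  have hπd : ContDiff ℝ ∞ π :=
    (contDiff_const.prodMk (contDiff_snd.comp contDiff_fst)).prodMk contDiff_const
  have hinW : ContDiff ℝ ∞ fun t : W => (((0, 0, t), 0) : (U × V × W) × ℝ) :=
    (contDiff_const.prodMk (contDiff_const.prodMk contDiff_id)).prodMk contDiff_const
  have hTvw : ∀ᶠ y : V × W in 𝓝 0, ∀ b : V × W, T ((0, y), 0) (0, b) = ⟪L₁ y.1, b.1⟫ := by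
    simpa only [hTapp] using eventually_fderiv_eq_inner hR hL₁ hR₁
  obtain ⟨q, hq, hqd⟩ : ∃ q : (U × V × W) × ℝ → U,
      (∀ z, q z = ρ ((T z).comp jU)) ∧ ContDiff ℝ ∞ q :=
    ⟨fun z => ρ ((T z).comp jU), fun z => rfl, ρ.contDiff.comp (hTd.clm_comp contDiff_const)⟩
  obtain ⟨C, hC, hCd⟩ : ∃ C : (U × V × W) × ℝ → ((U × V × W) →L[ℝ] ℝ),
      (∀ z, C z = K (π z, z) ((-q z, 0, 0), 1)) ∧ ContDiff ℝ ∞ C :=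
    ⟨fun z => K (π z, z) ((-q z, 0, 0), 1), fun z => rfl,
      (hKd.comp (hπd.prodMk contDiff_id)).clm_apply
        ((hqd.neg.prodMk contDiff_const).prodMk contDiff_const)⟩
  obtain ⟨D, hD, hDd⟩ : ∃ D : (U × V × W) × ℝ → ((U × V × W) →L[ℝ] ℝ),
      (∀ z h, D z h = ⟪L₀ z.1.1, h.1⟫ + z.2 * T z h) ∧ ContDiff ℝ ∞ D :=
    ⟨fun z => (innerSL ℝ (L₀ z.1.1)).comp (ContinuousLinearMap.fst ℝ U (V × W)) + z.2 • T z,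
      fun z h => by simp, (((innerSL ℝ).contDiff.comp (L₀.contDiff.comp
        (contDiff_fst.comp contDiff_fst))).clm_comp contDiff_const).add (contDiff_snd.smul hTd)⟩
  obtain ⟨G, hG, hGd⟩ : ∃ G : (U × V × W) × ℝ → ((U × V × W) →L[ℝ] ℝ),
      (∀ z h, G z h = D z (h.1, 0, 0) + T z (0, h.2.1, 0) + C z (0, 0, h.2.2)) ∧
      ContDiff ℝ ∞ G := by
    refine ⟨fun z =>
      (D z).comp (jU.comp (ContinuousLinearMap.fst ℝ U (V × W))) +
      (T z).comp ((ContinuousLinearMap.inr ℝ U (V × W)).comp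
        ((ContinuousLinearMap.inl ℝ V W).comp ((ContinuousLinearMap.fst ℝ V W).comp
          (ContinuousLinearMap.snd ℝ U (V × W))))) +
      (C z).comp ((ContinuousLinearMap.inr ℝ U (V × W)).comp
        ((ContinuousLinearMap.inr ℝ V W).comp ((ContinuousLinearMap.snd ℝ V W).comp
          (ContinuousLinearMap.snd ℝ U (V × W))))), fun z h => by simp [jU]; rfl, ?_⟩
    exact ((hDd.clm_comp contDiff_const).add (hTd.clm_comp contDiff_const)).add
      (hCd.clm_comp contDiff_const)
  have hFD : ∀ ε, fderiv ℝ (F ε) = fun p => D (p, ε) := fun ε => by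
    funext p
    have h1 : HasFDerivAt (fun p : (U × V × W) => R (p, ε)) (T (p, ε)) p := by
      rw [hT]
      exact ((hR.differentiable hn) (p, ε)).hasFDerivAt.comp p (hasFDerivAt_prodMk_left p ε)
    have h2 := ((((L₀.hasFDerivAt.comp p hasFDerivAt_fst).inner ℝ
      hasFDerivAt_fst).const_mul (1 / 2)).add_const c₀).add (h1.const_mul ε)
    have h3 : HasFDerivAt (F ε) _ p := h2.congr_of_eventuallyEq (.of_forall fun p => hF ε p)
    rw [h3.fderiv]
    refine ContinuousLinearMap.ext fun h => ?_
    have h4 : ⟪L₀ h.1, p.1⟫ = ⟪L₀ p.1, h.1⟫ := by rw [hL₀, real_inner_comm]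
    rw [hD]
    simp [h4]
    ring
  -- derivatives along lines
  have hline : ∀ {H : (U × V × W) × ℝ → ((U × V × W) →L[ℝ] ℝ)}, ContDiff ℝ ∞ H →
      ∀ (p k : U × V × W) (ε : ℝ),
      HasDerivAt (fun t : ℝ => H (p + t • k, ε)) (fderiv ℝ H (p, ε) (k, 0)) 0 := by
    intro H hH p k ε
    have h1 : HasDerivAt (fun t : ℝ => (p + t • k, ε)) (k, 0) 0 := by
      simpa using (((hasDerivAt_id (0 : ℝ)).smul_const k).const_add p).prodMk
        (hasDerivAt_const (0 : ℝ) ε)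
    have h2 := HasFDerivAt.comp_hasDerivAt (0 : ℝ) (f := fun t : ℝ => (p + t • k, ε))
      ((hH.differentiable hn) (p + (0 : ℝ) • k, ε)).hasFDerivAt h1
    rw [zero_smul, add_zero] at h2
    exact h2
  have happly : ∀ {H : ℝ → ((U × V × W) →L[ℝ] ℝ)} {H' : (U × V × W) →L[ℝ] ℝ} (h : U × V × W),
      HasDerivAt H H' 0 →
      HasDerivAt (fun t => H t h) (H' h) 0 := fun h hH => by
    simpa using hH.clm_apply (hasDerivAt_const (0 : ℝ) h)
  -- near the origin `G` is an invertible combination of the components of `D`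
  have hGD : ∀ z : (U × V × W) × ℝ, (∀ k : W, T (π z) (0, 0, k) = 0) → ∀ h : U × V × W,
      G z (h.1, z.2 • h.2.1, z.2 ^ 2 • h.2.2) =
        D z h - z.2 * K (π z, z) ((ρ ((D z).comp jU), 0, 0), 0) (0, 0, h.2.2) := by
    rintro ⟨⟨u, v, w⟩, ε⟩ hz ⟨a, b, c⟩
    have h1 : ρ ((D ((u, v, w), ε)).comp jU) = u + ε • q ((u, v, w), ε) := by
      have : (D ((u, v, w), ε)).comp jU = innerSL ℝ (L₀ u) + ε • (T ((u, v, w), ε)).comp jU :=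
        ContinuousLinearMap.ext fun b => by simp [hD, jU]
      rw [this, map_add, map_smul, hρ_inner, ← hq]
    have h2 : T ((u, v, w), ε) (0, 0, c) =
        K (π ((u, v, w), ε), ((u, v, w), ε)) ((u, 0, 0), ε) (0, 0, c) := by
      have := DFunLike.congr_fun (hK (π ((u, v, w), ε)) ((u, v, w), ε)) (0, 0, c)
      rw [_root_.sub_apply, hz, sub_zero] at this
      rw [this]
      congr 2
      simp [π]
      rfl
    have h3 : ε • ((-q ((u, v, w), ε), 0, 0), 1) =
        (((u, 0, 0), ε) - ((u + ε • q ((u, v, w), ε), 0, 0), 0) : (U × V × W) × ℝ) := by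
      simp
    have h4 : ε * C ((u, v, w), ε) (0, 0, c) = T ((u, v, w), ε) (0, 0, c) -
        K (π ((u, v, w), ε), ((u, v, w), ε)) ((u + ε • q ((u, v, w), ε), 0, 0), 0) (0, 0, c) := by
      rw [h2, hC, ← _root_.sub_apply, ← map_sub, ← h3, map_smul]
      rfl
    have h5 : T ((u, v, w), ε) (0, ε • b, 0) = ε * T ((u, v, w), ε) (0, b, 0) := by
      rw [← smul_eq_mul, ← map_smul]
      simp
    have h6 : C ((u, v, w), ε) (0, 0, ε ^ 2 • c) = ε * (ε * C ((u, v, w), ε) (0, 0, c)) := by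
      rw [← mul_assoc, ← pow_two, ← smul_eq_mul, ← map_smul]
      simp
    have h7 : T ((u, v, w), ε) (a, b, c) = T ((u, v, w), ε) (a, 0, 0) +
        T ((u, v, w), ε) (0, b, 0) + T ((u, v, w), ε) (0, 0, c) := by
      rw [← map_add, ← map_add]
      simp
    dsimp only
    rw [hG, h1]
    dsimp only
    rw [h5, h6, h4, hD, hD]
    dsimp only
    rw [h7]
    ring
  have hDG : ∀ z : (U × V × W) × ℝ, (∀ k : W, T (π z) (0, 0, k) = 0) → z.2 ≠ 0 →
      (D z = 0 ↔ G z = 0) := by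
    intro z hz hε
    constructor
    · intro h
      refine ContinuousLinearMap.ext fun k => ?_
      have := hGD z hz (k.1, z.2⁻¹ • k.2.1, (z.2 ^ 2)⁻¹ • k.2.2)
      simpa [h, smul_smul, hε, show ((0, 0, 0), 0) = (0 : (U × V × W) × ℝ) from rfl] using this
    · intro h
      have h1 : (D z).comp jU = 0 := ContinuousLinearMap.ext fun a => by
        have := hGD z hz (a, 0, 0)
        have h2 : D z (a, 0, 0) = 0 := by
          simpa [h, show ((0, 0, 0) : U × V × W) = 0 from rfl] using this.symm
        exact h2
      refine ContinuousLinearMap.ext fun k => ?_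
      have := hGD z hz k
      simpa [h, h1, show ((0, 0, 0), 0) = (0 : (U × V × W) × ℝ) from rfl] using this.symm
  have hreduced : ∀ᶠ t : W in 𝓝 0, ∀ a, fderiv ℝ S₀' t a = C ((0, 0, t), 0) (0, 0, a) := by
    have hQ : ∀ᶠ t in 𝓝 0, L₀ (q ((0, 0, t), 0)) = g t := by
      filter_upwards [hg] with t ht
      refine ext_inner_right ℝ fun b => ?_
      rw [hq, hρ, ht, ContinuousLinearMap.comp_apply, hTapp]
      rfl
    have hS : S₀' =ᶠ[𝓝 0] fun t => -(1 / 2) * ⟪L₀ (q ((0, 0, t), 0)), q ((0, 0, t), 0)⟫ +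
        fderiv ℝ R ((0, 0, t), 0) (0, 1) := by
      filter_upwards [hQ, hS₀'] with t h1 h2
      rw [h2, ← h1, L₀.symm_apply_apply]
    filter_upwards [hS.eventuallyEq_nhds] with t ht a
    rw [ht.fderiv_eq, fderiv_leadingTerm_apply hR hL₀ (Q := fun t => q ((0, 0, t), 0))
      ((hqd.comp hinW).differentiable hn) fun t b => by
        rw [hq, hρ, ContinuousLinearMap.comp_apply, hTapp]; rfl]
    rw [hC, show π ((0, 0, t), 0) = ((0, 0, t), 0) from rfl, hKdiag]
    have h1 : HasFDerivAt T _ ((0, 0, t), 0) :=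
      (((ContinuousLinearMap.compL ℝ (U × V × W) ((U × V × W) × ℝ) ℝ).flip ι).hasFDerivAt.comp _
        ((hR'.differentiable hn) ((0, 0, t), 0)).hasFDerivAt).congr_of_eventuallyEq
        (.of_forall fun z => hT z)
    rw [h1.fderiv]
    rfl
  have hG0 : G 0 = 0 := by
    have hS0 := fun a => (hreduced.self_of_nhds a).symm.trans (by rw [hcrit0, zero_apply])
    have hT0 := hTvw.self_of_nhds
    refine ContinuousLinearMap.ext fun k => ?_
    have h1 : C 0 (0, 0, k.2.2) = 0 := hS0 _
    have h2 : T 0 (0, k.2.1, 0) = 0 := (hT0 (k.2.1, 0)).trans (by simp)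
    rw [hG, hD, h1, h2]
    simp
  have hGinj : ∀ k : U × V × W, fderiv ℝ G 0 (k, 0) = 0 → k = 0 := by
    rintro ⟨a, b, c⟩ hk
    have hzero : ∀ h, HasDerivAt (fun t : ℝ => G (t • (a, b, c), 0) h) 0 0 := fun h => by
      have h1 := happly h (hline hGd 0 (a, b, c) 0)
      rw [show ((0 : U × V × W), (0 : ℝ)) = 0 from rfl, hk] at h1
      simpa using h1
    have ha : a = 0 := by
      refine L₀.injective (ext_inner_right ℝ fun d => ?_)
      have h1 : HasDerivAt (fun t : ℝ => t * ⟪L₀ a, d⟫) (1 * ⟪L₀ a, d⟫) 0 :=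
        (hasDerivAt_id (0 : ℝ)).mul_const _
      have h2 := hzero (d, 0, 0)
      simp only [hG, hD] at h2
      simp [inner_smul_left, show ((0, 0, 0) : U × V × W) = 0 from rfl] at h2
      simpa using h1.unique h2
    subst ha
    have hb : b = 0 := by
      refine L₁.injective (ext_inner_right ℝ fun d => ?_)
      have h1 : HasDerivAt (fun t : ℝ => t * ⟪L₁ b, d⟫) (1 * ⟪L₁ b, d⟫) 0 :=
        (hasDerivAt_id (0 : ℝ)).mul_const _
      have h2 := hzero (0, d, 0)
      have h3 : Filter.Tendsto (fun t : ℝ => t • (b, c)) (𝓝 0) (𝓝 0) := by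
        have h4 : Continuous fun t : ℝ => t • (b, c) := continuous_id.smul continuous_const
        have h5 := h4.tendsto 0
        rwa [zero_smul] at h5
      have h4 : (fun t : ℝ => t * ⟪L₁ b, d⟫) =ᶠ[𝓝 0] fun t => G (t • (0, b, c), 0) (0, d, 0) := by
        filter_upwards [h3.eventually hTvw] with t ht
        have h5 := ht (d, 0)
        rw [hG, hD]
        simp [inner_smul_left, show ((0, 0, 0) : U × V × W) = 0 from rfl] at h5 ⊢
        exact h5.symm
      simpa using h1.unique (h2.congr_of_eventuallyEq h4)
    subst hb
    have hc : c = 0 := by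
      refine hnondeg0 c fun d => ?_
      have h1 : DifferentiableAt ℝ (fderiv ℝ S₀') 0 := by
        have h2 : ContDiff ℝ ∞ fun t : W => (C ((0, 0, t), 0)).comp
            ((ContinuousLinearMap.inr ℝ U (V × W)).comp (ContinuousLinearMap.inr ℝ V W)) :=
          (hCd.comp hinW).clm_comp contDiff_const
        refine ((h2.differentiable hn) 0).congr_of_eventuallyEq ?_
        filter_upwards [hreduced] with t ht
        exact ContinuousLinearMap.ext fun a => ht a
      have h2 : HasDerivAt (fun t : ℝ => t • c) c 0 := by
        simpa using (hasDerivAt_id (0 : ℝ)).smul_const c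
      have h1' : HasFDerivAt (fderiv ℝ S₀') (fderiv ℝ (fderiv ℝ S₀') 0) ((0 : ℝ) • c) := by
        rw [zero_smul]
        exact h1.hasFDerivAt
      have h3 : HasDerivAt (fun t : ℝ => fderiv ℝ S₀' (t • c) d)
          (fderiv ℝ (fderiv ℝ S₀') 0 c d) 0 := by
        simpa using (HasFDerivAt.comp_hasDerivAt (0 : ℝ) (f := fun t : ℝ => t • c)
          h1' h2).clm_apply (hasDerivAt_const (0 : ℝ) d)
      have h4 : Filter.Tendsto (fun t : ℝ => t • c) (𝓝 0) (𝓝 0) := by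
        have h4 : Continuous fun t : ℝ => t • c := continuous_id.smul continuous_const
        have h5 := h4.tendsto 0
        rwa [zero_smul] at h5
      refine h3.unique ((hzero (0, 0, d)).congr_of_eventuallyEq ?_)
      filter_upwards [h4.eventually hreduced] with t ht
      have h5 := ht d
      rw [hG, hD]
      simp [show ((0, 0, 0) : U × V × W) = 0 from rfl]
      exact h5
    rw [hc]
    rfl
  have hdim : Module.finrank ℝ (U × V × W) = Module.finrank ℝ ((U × V × W) →L[ℝ] ℝ) := by
    rw [← (LinearMap.toContinuousLinearMap : ((U × V × W) →ₗ[ℝ] ℝ) ≃ₗ[ℝ] _).finrank_eq]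
    exact Subspace.dual_finrank_eq.symm
  have hO : {z : (U × V × W) × ℝ | z.1 ∈ B ∧ ∀ᶠ z' in 𝓝 z, ∀ k : W, T (π z') (0, 0, k) = 0} ∈
      𝓝 (0 : (U × V × W) × ℝ) := by
    have h1 : Filter.Tendsto (fun z : (U × V × W) × ℝ => z.1.2) (𝓝 0) (𝓝 0) :=
      (continuous_snd.comp continuous_fst).tendsto 0
    refine Filter.inter_mem (continuous_fst.continuousAt hB)
      ((h1.eventually hTvw).mono fun z hz k => ?_).eventually_nhds
    exact (hz (0, k)).trans (by simp)
  obtain ⟨U₀, ε₀, x, hU₀, h0U₀, hε₀, hxd, hxU₀, hx0, hUO, hx⟩ :=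
    hGd.exists_unique_zero_curve hdim hG0 hGinj hO
  refine ⟨U₀, ε₀, x, hU₀, h0U₀, fun y hy => (hUO y hy 0 ⟨by linarith, hε₀.le⟩).1, hε₀, hxd, hxU₀,
    hx0, fun ε hε hεε₀ => ?_⟩
  have hεmem := abs_le.1 hεε₀
  have hε' : ε ≠ 0 := abs_pos.1 hε
  obtain ⟨hx1, hx2, hx3⟩ := hx ε hεmem
  have hxO := (hUO _ (hxU₀ ε hεmem) ε hεmem).2
  have hDx : D (x ε, ε) = 0 := (hDG _ hxO.self_of_nhds hε').2 hx1
  rw [hFD]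
  refine ⟨hDx, fun k hk => hx2 k ?_, fun y hy hDy => hx3 y hy ?_⟩
  · have hDk : fderiv ℝ D (x ε, ε) (k, 0) = 0 := by
      refine ContinuousLinearMap.ext fun h => ?_
      refine Eq.trans ?_ (hk h)
      have h1 : HasFDerivAt (fun p => D (p, ε)) _ (x ε) :=
        HasFDerivAt.comp (x ε) (g := D) (f := fun p => (p, ε))
          ((hDd.differentiable hn) (x ε, ε)).hasFDerivAt
          (hasFDerivAt_prodMk_left (x ε) ε)
      rw [h1.fderiv]
      rfl
    have hDline := hline hDd (x ε) k ε
    rw [hDk] at hDline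
    have hGline := hline hGd (x ε) k ε
    have hcurve : ContDiff ℝ ∞ fun t : ℝ => (x ε + t • k, ε) :=
      (contDiff_const.add (contDiff_id.smul contDiff_const)).prodMk contDiff_const
    have hKline : HasDerivAt (fun t : ℝ => K (π (x ε + t • k, ε), (x ε + t • k, ε))) _ 0 :=
      (((hKd.comp (hπd.prodMk contDiff_id)).comp hcurve).differentiable hn 0).hasDerivAt
    let Λ : ((U × V × W) →L[ℝ] ℝ) →L[ℝ] (U × V × W) × ℝ :=
      ι.comp (jU.comp (ρ.comp ((ContinuousLinearMap.compL ℝ U (U × V × W) ℝ).flip jU)))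
    have hΛ : ∀ φ, Λ φ = ((ρ (φ.comp jU), 0, 0), 0) := fun φ => rfl
    have hDΛ := HasFDerivAt.comp_hasDerivAt (0 : ℝ)
      (f := fun t : ℝ => D (x ε + t • k, ε)) Λ.hasFDerivAt hDline
    have hKD := hKline.clm_apply hDΛ
    simp only [Function.comp_apply, zero_smul, add_zero, hDx, map_zero] at hKD
    have hGk : ∀ h : U × V × W,
        fderiv ℝ G (x ε, ε) (k, 0) (h.1, ε • h.2.1, ε ^ 2 • h.2.2) = 0 := fun h => by
      refine (happly _ hGline).unique ?_
      have h1 := (happly h hDline).sub ((happly (0, 0, h.2.2) hKD).const_mul ε)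
      have h2 : HasDerivAt (fun t : ℝ => D (x ε + t • k, ε) h - ε *
          K (π (x ε + t • k, ε), (x ε + t • k, ε)) (Λ (D (x ε + t • k, ε))) (0, 0, h.2.2)) 0 0 := by
        rw [zero_apply, zero_apply, mul_zero, sub_zero] at h1
        exact h1
      refine h2.congr_of_eventuallyEq ?_
      have h3 : Filter.Tendsto (fun t : ℝ => (x ε + t • k, ε)) (𝓝 0) (𝓝 (x ε, ε)) := by
        have := hcurve.continuous.tendsto 0
        rwa [zero_smul, add_zero] at this
      filter_upwards [h3.eventually hxO] with t ht
      rw [hΛ]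
      exact hGD _ ht h
    refine ContinuousLinearMap.ext fun h => ?_
    have := hGk (h.1, ε⁻¹ • h.2.1, (ε ^ 2)⁻¹ • h.2.2)
    simpa [smul_smul, hε'] using this
  · exact (hDG (y, ε) (hUO y hy ε hεmem).2.self_of_nhds hε').1 hDy

end NormalForm

/-- A function smooth on a cylinder `Ω ×ˢ univ` agrees near the axis over `0` with a globally
smooth function. -/
theorem ContDiffOn.exists_contDiff_eq_on_ball {X : Type*} [NormedAddCommGroup X]
    [NormedSpace ℝ X] [FiniteDimensional ℝ X] {f : X × ℝ → ℝ} {Ω : Set X} (hΩ : IsOpen Ω)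
    (h0 : (0 : X) ∈ Ω) (hf : ContDiffOn ℝ ∞ f (Ω ×ˢ Set.univ)) :
    ∃ r > 0, Metric.ball 0 r ⊆ Ω ∧ ∃ f' : X × ℝ → ℝ, ContDiff ℝ ∞ f' ∧
      ∀ p ∈ Metric.ball 0 r, ∀ e, f' (p, e) = f (p, e) := by
  obtain ⟨r, hr, hrΩ⟩ := Metric.nhds_basis_closedBall.mem_iff.1 (hΩ.mem_nhds h0)
  let χ : ContDiffBump (0 : X) := ⟨r / 2, r, by positivity, by linarith⟩
  refine ⟨r / 2, by positivity, fun p hp => hrΩ (Metric.closedBall_subset_closedBall (by linarith)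
    (Metric.ball_subset_closedBall hp)), fun z => χ z.1 * f z, ?_, fun p hp e => ?_⟩
  · refine contDiff_iff_contDiffAt.2 fun z => ?_
    by_cases hz : z.1 ∈ Ω
    · exact (χ.contDiff.comp contDiff_fst).contDiffAt.mul
        (hf.contDiffAt ((hΩ.prod isOpen_univ).mem_nhds ⟨hz, trivial⟩))
    · have h1 : z.1 ∉ tsupport χ := fun h => hz (hrΩ (by rwa [χ.tsupport_eq] at h))
      have h2 := continuous_fst.continuousAt.eventually (notMem_tsupport_iff_eventuallyEq.1 h1)
      refine (contDiffAt_const (c := (0 : ℝ))).congr_of_eventuallyEq ?_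
      filter_upwards [h2] with y hy
      simp [hy]
  · have : χ p = 1 := χ.one_of_mem_closedBall (Metric.ball_subset_closedBall hp)
    simp [this]

/-- If `0` is a nondegenerate critical point of the leading term `S'₀`, then for all
small `ε ≠ 0` the perturbed function `S(·,ε)` has a unique critical point near the origin, which
is nondegenerate, and it depends smoothly on `ε`. -/
theorem stmt3
    {U V W : Type*} [NormedAddCommGroup U] [InnerProductSpace ℝ U] [FiniteDimensional ℝ U]
    [NormedAddCommGroup V] [InnerProductSpace ℝ V] [FiniteDimensional ℝ V]
    [NormedAddCommGroup W] [InnerProductSpace ℝ W] [FiniteDimensional ℝ W]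
    (Ω : Set (U × V × W)) (hΩ : IsOpen Ω) (hΩ0 : (0 : U × V × W) ∈ Ω)
    (S : (U × V × W) × ℝ → ℝ) (hS : ContDiffOn ℝ (⊤ : ℕ∞) S (Ω ×ˢ Set.univ))
    (S₁ S₂ : U × V × W → ℝ)
    (hS₁def : ∀ p, S₁ p = deriv (fun e => S (p, e)) 0)
    (hS₂def : ∀ p, S₂ p = (1 / 2) * deriv (fun e => deriv (fun e' => S (p, e')) e) 0)
    (L₀ : U ≃ₗ[ℝ] U) (hL₀ : ∀ x y : U, ⟪L₀ x, y⟫ = ⟪x, L₀ y⟫) (c₀ : ℝ)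
    (hNF0 : ∀ p ∈ Ω, S (p, 0) = (1 / 2) * ⟪L₀ p.1, p.1⟫ + c₀)
    (L₁ : V ≃ₗ[ℝ] V) (hL₁ : ∀ x y : V, ⟪L₁ x, y⟫ = ⟪x, L₁ y⟫) (c₁ : ℝ)
    (hNF1 : ∀ (v : V) (w : W), ((0, v, w) : U × V × W) ∈ Ω →
      S₁ (0, v, w) = (1 / 2) * ⟪L₁ v, v⟫ + c₁)
    (g lam : W → U)
    (hg : ∀ t, g t = gradient (fun u' : U => S₁ (u', 0, t)) 0)
    (hlam : ∀ t, lam t = -(L₀.symm (g t)))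
    (S₀' : W → ℝ)
    (hS₀'def : ∀ t, S₀' t = (1 / 2) * ⟪g t, lam t⟫ + S₂ (0, 0, t))
    (hcrit0 : fderiv ℝ S₀' 0 = 0)
    (hnondeg0 : ∀ h : W, (∀ k : W, fderiv ℝ (fderiv ℝ S₀') 0 h k = 0) → h = 0) :
    ∃ (U₀ : Set (U × V × W)) (ε₀ : ℝ) (x : ℝ → U × V × W),
      IsOpen U₀ ∧ (0 : U × V × W) ∈ U₀ ∧ U₀ ⊆ Ω ∧ 0 < ε₀ ∧
      ContDiffOn ℝ (⊤ : ℕ∞) x (Set.Icc (-ε₀) ε₀) ∧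
      (∀ ε ∈ Set.Icc (-ε₀) ε₀, x ε ∈ U₀) ∧ x 0 = 0 ∧
      ∀ ε : ℝ, 0 < |ε| → |ε| ≤ ε₀ →
        fderiv ℝ (fun p => S (p, ε)) (x ε) = 0 ∧
        (∀ h : U × V × W,
          (∀ k : U × V × W, fderiv ℝ (fderiv ℝ (fun p => S (p, ε))) (x ε) h k = 0) → h = 0) ∧
        ∀ y ∈ U₀, fderiv ℝ (fun p => S (p, ε)) y = 0 → y = x ε := by
  have hn : (∞ : WithTop ℕ∞) ≠ 0 := by simp
  obtain ⟨r, hr, hrΩ, S', hS', hSS'⟩ := hS.exists_contDiff_eq_on_ball hΩ hΩ0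
  obtain ⟨K, hKd, hK, -⟩ := hS'.exists_sub_eq_clm_apply
  obtain ⟨R, hRdef, hR⟩ : ∃ R : (U × V × W) × ℝ → ℝ,
      (∀ z, R z = K ((z.1, 0), z) (0, 1)) ∧ ContDiff ℝ ∞ R :=
    ⟨fun z => K ((z.1, 0), z) (0, 1), fun z => rfl,
      (hKd.comp ((contDiff_fst.prodMk contDiff_const).prodMk contDiff_id)).clm_apply
        contDiff_const⟩
  have hR' : ContDiff ℝ ∞ (fderiv ℝ R) := hR.fderiv_right (by simp)
  have hSR : ∀ p ∈ Metric.ball (0 : U × V × W) r, ∀ e,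
      S (p, e) = (1 / 2) * ⟪L₀ p.1, p.1⟫ + c₀ + e * R (p, e) := fun p hp e => by
    have h1 := hK (p, 0) (p, e)
    rw [hSS' p hp, hSS' p hp, hNF0 p (hrΩ hp), show (p, e) - (p, 0) =
      e • ((0, 1) : (U × V × W) × ℝ) by simp, map_smul, ← hRdef (p, e), smul_eq_mul] at h1
    linarith
  have hRe : ∀ p e, HasDerivAt (fun e => R (p, e)) (fderiv ℝ R (p, e) (0, 1)) e := fun p e =>
    HasFDerivAt.comp_hasDerivAt e (f := fun e => (p, e))
      ((hR.differentiable hn) (p, e)).hasFDerivAt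
      ((hasDerivAt_const e p).prodMk (hasDerivAt_id e))
  have hSe : ∀ p ∈ Metric.ball (0 : U × V × W) r, ∀ e,
      deriv (fun e => S (p, e)) e = R (p, e) + e * fderiv ℝ R (p, e) (0, 1) := fun p hp e => by
    have h1 := ((hasDerivAt_id e).mul (hRe p e)).const_add ((1 / 2) * ⟪L₀ p.1, p.1⟫ + c₀)
    rw [one_mul] at h1
    exact (h1.congr_of_eventuallyEq (.of_forall fun e => hSR p hp e)).deriv
  have hS₁ : ∀ p ∈ Metric.ball (0 : U × V × W) r, S₁ p = R (p, 0) := fun p hp => by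
    rw [hS₁def, hSe p hp, zero_mul, add_zero]
  have hS₂ : ∀ p ∈ Metric.ball (0 : U × V × W) r, S₂ p = fderiv ℝ R (p, 0) (0, 1) := by
    intro p hp
    have h1 : Differentiable ℝ fun e : ℝ => fderiv ℝ R (p, e) (0, 1) :=
      ((hR'.comp (contDiff_const.prodMk contDiff_id)).clm_apply contDiff_const).differentiable hn
    have h2 := (hRe p 0).add ((hasDerivAt_id (0 : ℝ)).mul (h1 0).hasDerivAt)
    have h3 := h2.congr_of_eventuallyEq (.of_forall fun e => hSe p hp e)
    rw [hS₂def, h3.deriv]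
    simp
    ring
  have hball : Metric.ball (0 : U × V × W) r ∈ 𝓝 0 := Metric.ball_mem_nhds 0 hr
  have hball_w : ∀ᶠ t : W in 𝓝 0, ((0, 0, t) : U × V × W) ∈ Metric.ball 0 r :=
    (by fun_prop : Continuous fun t : W => ((0, 0, t) : U × V × W)).continuousAt hball
  have hball_vw : ∀ᶠ y : V × W in 𝓝 0, ((0, y) : U × V × W) ∈ Metric.ball 0 r :=
    (by fun_prop : Continuous fun y : V × W => ((0, y) : U × V × W)).continuousAt hball
  have hgR : ∀ᶠ t in 𝓝 0, ∀ b, ⟪g t, b⟫ = fderiv ℝ R ((0, 0, t), 0) ((b, 0, 0), 0) := by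
    filter_upwards [hball_w] with t ht b
    have h1 : ∀ᶠ u : U in 𝓝 0, ((u, 0, t) : U × V × W) ∈ Metric.ball 0 r :=
      (by fun_prop : Continuous fun u : U => ((u, 0, t) : U × V × W)).continuousAt
        (Metric.isOpen_ball.mem_nhds ht)
    have h2 : (fun u => S₁ (u, 0, t)) =ᶠ[𝓝 0] fun u => R ((u, 0, t), 0) :=
      h1.mono fun u hu => hS₁ _ hu
    have h3 : HasFDerivAt (fun u : U => R ((u, 0, t), 0)) _ 0 :=
      HasFDerivAt.comp (0 : U) (g := R) (f := fun u => ((u, 0, t), 0))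
        ((hR.differentiable hn) ((0, 0, t), 0)).hasFDerivAt
        (((hasFDerivAt_id (0 : U)).prodMk (hasFDerivAt_const ((0, t) : V × W) 0)).prodMk
          (hasFDerivAt_const (0 : ℝ) 0))
    rw [hg, gradient, InnerProductSpace.toDual_symm_apply, h2.fderiv_eq, h3.fderiv]
    rfl
  obtain ⟨U₀, ε₀, x, hU₀, h0U₀, hU₀B, hε₀, hxd, hxU₀, hx0, hx⟩ :=
    exists_nondegenerate_critical_curve hR (L₀ := L₀.toContinuousLinearEquiv) hL₀ c₀
      (L₁ := L₁.toContinuousLinearEquiv) hL₁ (c₁ := c₁)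
      (hball_vw.mono fun y hy => by rw [← hS₁ _ hy]; exact hNF1 y.1 y.2 (hrΩ hy)) hgR
      (hball_w.mono fun t ht => by
        rw [hS₀'def, hlam, hS₂ _ ht, inner_neg_right]
        change _ = -(1 / 2) * ⟪g t, L₀.symm (g t)⟫ + _
        ring) hcrit0 hnondeg0 hball
      (F := fun ε p => (1 / 2) * ⟪L₀ p.1, p.1⟫ + c₀ + ε * R (p, ε)) fun ε p => rfl
  have hSF : ∀ y ∈ U₀, ∀ ε, (fun p => S (p, ε)) =ᶠ[𝓝 y]
      fun p => (1 / 2) * ⟪L₀ p.1, p.1⟫ + c₀ + ε * R (p, ε) := fun y hy ε =>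
    Filter.eventually_of_mem (hU₀.mem_nhds hy) fun p hp => hSR p (hU₀B hp) ε
  refine ⟨U₀, ε₀, x, hU₀, h0U₀, hU₀B.trans hrΩ, hε₀, hxd, hxU₀, hx0, fun ε hε hεε₀ => ?_⟩
  obtain ⟨h1, h2, h3⟩ := hx ε hε hεε₀
  have hxε := hxU₀ ε (abs_le.1 hεε₀)
  refine ⟨(hSF _ hxε ε).fderiv_eq.trans h1, fun h hk => h2 h ?_, fun y hy hy0 =>
    h3 y hy ((hSF y hy ε).fderiv_eq.symm.trans hy0)⟩
  rwa [(hSF _ hxε ε).fderiv.fderiv_eq] at hk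
end

section
/- Let U, V, W be finite-dimensional real inner product spaces, Ω ⊆ U × V × W an open neighborhood of the origin, and S : Ω × ℝ → ℝ a smooth function satisfying (NF0) and (NF1). Define λ(t) := −L₀^{-1}(∇_u S₁(0,0,t)) and S'₀(t) := (1/2)⟨∇_u S₁(0,0,t), λ(t)⟩ + S₂(0,0,t), and suppose 0 ∈ W is a nondegenerate critical point of S'₀. Let 𝒰₀, ε₀ and the smooth path ε ↦ x_ε of unique nondegenerate critical points of S(·,ε) in 𝒰₀ be as in the local perturbation result. Then for 0 < ε ≤ ε₀ the Morse index of the nondegenerate critical point x_ε of S(·,ε) equals ind(L₀) + ind(L₁) + ind₀(S'₀), while for −ε₀ ≤ ε < 0 it equals ind(L₀) + (dim V − ind(L₁)) + ind₀(S'₀), where ind₀(S'₀) is the Morse index of the nondegenerate critical point 0 of S'₀. -/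
open scoped RealInnerProductSpace

/-- The index of a (bilinear) form `B`: the maximal dimension of a subspace on which
`v ↦ B v v` is negative definite. -/
noncomputable def negIdx {E : Type*} [AddCommGroup E] [Module ℝ E] (B : E → E → ℝ) : ℕ :=
  sSup {n : ℕ | ∃ T : Submodule ℝ E, Module.finrank ℝ T = n ∧ ∀ v ∈ T, v ≠ 0 → B v v < 0}

/-- A splitting of `E` into a subspace on which `B` is negative definite and a complementary
subspace on which `B` is positive definite. -/
structure IsDefiniteSplitting {E : Type*} [AddCommGroup E] [Module ℝ E] (B : E → E → ℝ)
    (N P : Submodule ℝ E) : Prop where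
  isCompl : IsCompl N P
  neg : ∀ v ∈ N, v ≠ 0 → B v v < 0
  pos : ∀ v ∈ P, v ≠ 0 → 0 < B v v

namespace IsDefiniteSplitting

variable {E F : Type*} [AddCommGroup E] [Module ℝ E] [AddCommGroup F] [Module ℝ F]

theorem negIdx_eq [FiniteDimensional ℝ E] {B : E → E → ℝ} {N P : Submodule ℝ E}
    (h : IsDefiniteSplitting B N P) : negIdx B = Module.finrank ℝ N := by
  refine IsGreatest.csSup_eq ⟨⟨N, rfl, h.neg⟩, ?_⟩
  rintro n ⟨T, rfl, hT⟩
  have hd : Disjoint T P := by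
    rw [Submodule.disjoint_def]
    intro v hv hv'
    by_contra hne
    exact lt_asymm (hT v hv hne) (h.pos v hv' hne)
  have h1 := Submodule.finrank_add_finrank_le_of_disjoint hd
  have h2 := Submodule.finrank_add_eq_of_isCompl h.isCompl
  omega

theorem neg_form {B : E → E → ℝ} {N P : Submodule ℝ E}
    (h : IsDefiniteSplitting B N P) : IsDefiniteSplitting (fun x y => -B x y) P N :=
  ⟨h.isCompl.symm, fun v hv h0 => neg_neg_of_pos (h.pos v hv h0),
    fun v hv h0 => neg_pos_of_neg (h.neg v hv h0)⟩

theorem prod {B : E → E → ℝ} {C : F → F → ℝ} {N P : Submodule ℝ E} {N' P' : Submodule ℝ F}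
    (hB0 : B 0 0 = 0) (hC0 : C 0 0 = 0)
    (h : IsDefiniteSplitting B N P) (h' : IsDefiniteSplitting C N' P') :
    IsDefiniteSplitting (fun x y : E × F => B x.1 y.1 + C x.2 y.2) (N.prod N') (P.prod P') := by
  refine ⟨⟨?_, ?_⟩, ?_, ?_⟩
  · rw [disjoint_iff, Submodule.prod_inf_prod, h.isCompl.inf_eq_bot, h'.isCompl.inf_eq_bot,
      Submodule.prod_bot]
  · rw [codisjoint_iff, Submodule.prod_sup_prod, h.isCompl.sup_eq_top, h'.isCompl.sup_eq_top,
      Submodule.prod_top]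
  · rintro ⟨v, w⟩ ⟨hv, hw⟩ hne
    by_cases hv0 : v = 0
    · subst hv0
      have : w ≠ 0 := fun hw0 => hne (by simp [hw0])
      simpa [hB0] using h'.neg w hw this
    · by_cases hw0 : w = 0
      · subst hw0
        simpa [hC0] using h.neg v hv hv0
      · exact add_neg (h.neg v hv hv0) (h'.neg w hw hw0)
  · rintro ⟨v, w⟩ ⟨hv, hw⟩ hne
    by_cases hv0 : v = 0
    · subst hv0
      have : w ≠ 0 := fun hw0 => hne (by simp [hw0])
      simpa [hB0] using h'.pos w hw this
    · by_cases hw0 : w = 0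
      · subst hw0
        simpa [hC0] using h.pos v hv hv0
      · exact add_pos (h.pos v hv hv0) (h'.pos w hw hw0)

end IsDefiniteSplitting

theorem finrank_submodule_prod {E F : Type*} [AddCommGroup E] [Module ℝ E] [AddCommGroup F]
    [Module ℝ F] [FiniteDimensional ℝ E] [FiniteDimensional ℝ F]
    (N : Submodule ℝ E) (N' : Submodule ℝ F) :
    Module.finrank ℝ (N.prod N') = Module.finrank ℝ N + Module.finrank ℝ N' := by
  rw [← Module.finrank_prod]
  exact LinearEquiv.finrank_eq
    { toFun := fun z => (⟨z.1.1, z.2.1⟩, ⟨z.1.2, z.2.2⟩)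
      invFun := fun z => ⟨(z.1, z.2), z.1.2, z.2.2⟩
      map_add' := fun _ _ => rfl
      map_smul' := fun _ _ => rfl
      left_inv := fun _ => rfl
      right_inv := fun _ => rfl }

/-- A nondegenerate symmetric bilinear form on a finite-dimensional real space admits a definite
splitting. -/
theorem exists_isDefiniteSplitting {E : Type*} [AddCommGroup E] [Module ℝ E]
    [FiniteDimensional ℝ E] (B : E →ₗ[ℝ] E →ₗ[ℝ] ℝ) (hsymm : ∀ x y, B x y = B y x)
    (hnd : ∀ x, (∀ y, B x y = 0) → x = 0) :
    ∃ N P : Submodule ℝ E, IsDefiniteSplitting (fun x y => B x y) N P := by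
  obtain ⟨b, hb⟩ := LinearMap.BilinForm.exists_orthogonal_basis (B := B) ⟨hsymm⟩
  have hb' : ∀ i j, i ≠ j → B (b i) (b j) = 0 := fun i j hij => hb hij
  have hdiag : ∀ i, B (b i) (b i) ≠ 0 := by
    intro i hi
    refine b.ne_zero i (hnd _ fun y => ?_)
    have : B (b i) = 0 := b.ext fun j => by
      by_cases hij : i = j
      · subst hij; simpa using hi
      · simpa using hb' i j hij
    simp [this]
  have hform : ∀ x, B x x = ∑ i, b.repr x i ^ 2 * B (b i) (b i) := by
    intro x
    conv_lhs => rw [← b.sum_repr x]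
    simp only [map_sum, map_smul, LinearMap.sum_apply, LinearMap.smul_apply, smul_eq_mul]
    refine Finset.sum_congr rfl fun i _ => ?_
    rw [Finset.sum_eq_single i]
    · ring
    · intro j _ hj; rw [hb' j i hj]; ring
    · simp
  have key : ∀ (s : Set (Fin (Module.finrank ℝ E))) (v : E),
      v ∈ Submodule.span ℝ (b '' s) → ∀ i, b.repr v i ≠ 0 → i ∈ s := by
    intro s v hv i hi
    rw [b.mem_span_image] at hv
    exact hv (by simpa using hi)
  have hex : ∀ v : E, v ≠ 0 → ∃ i, b.repr v i ≠ 0 := by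
    intro v hv
    by_contra! h
    exact hv (b.repr.map_eq_zero_iff.1 (Finsupp.ext h))
  refine ⟨Submodule.span ℝ (b '' {i | B (b i) (b i) < 0}),
    Submodule.span ℝ (b '' {i | B (b i) (b i) < 0}ᶜ), ⟨?_, ?_⟩, ?_, ?_⟩
  · exact b.linearIndependent.disjoint_span_image disjoint_compl_right
  · rw [codisjoint_iff, ← Submodule.span_union, ← Set.image_union, Set.union_compl_self,
      Set.image_univ, b.span_eq]
  · intro v hv hne
    rw [hform]
    obtain ⟨i, hi⟩ := hex v hne
    refine Finset.sum_neg' (fun j _ => ?_) ⟨i, Finset.mem_univ _, ?_⟩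
    · by_cases hj : b.repr v j = 0
      · simp [hj]
      · exact mul_nonpos_of_nonneg_of_nonpos (sq_nonneg _) (le_of_lt (key _ v hv j hj))
    · exact mul_neg_of_pos_of_neg (by positivity) (key _ v hv i hi)
  · intro v hv hne
    rw [hform]
    obtain ⟨i, hi⟩ := hex v hne
    have hp : ∀ j, b.repr v j ≠ 0 → 0 < B (b j) (b j) := fun j hj =>
      lt_of_le_of_ne (not_lt.1 (key _ v hv j hj)) (hdiag j).symm
    refine Finset.sum_pos' (fun j _ => ?_) ⟨i, Finset.mem_univ _, ?_⟩
    · by_cases hj : b.repr v j = 0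
      · simp [hj]
      · exact mul_nonneg (sq_nonneg _) (hp j hj).le
    · exact mul_pos (by positivity) (hp i hi)

/-- Negative definiteness on a finite-dimensional subspace is stable under pointwise convergence
of bilinear forms. -/
theorem eventually_negDef_of_tendsto {E α : Type*} [AddCommGroup E] [Module ℝ E]
    [FiniteDimensional ℝ E] {l : Filter α} {A : α → E →ₗ[ℝ] E →ₗ[ℝ] ℝ} {B : E →ₗ[ℝ] E →ₗ[ℝ] ℝ}
    (hA : ∀ x y, Filter.Tendsto (fun i => A i x y) l (nhds (B x y)))
    {N : Submodule ℝ E} (hN : ∀ v ∈ N, v ≠ 0 → B v v < 0) :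
    ∀ᶠ i in l, ∀ v ∈ N, v ≠ 0 → A i v v < 0 := by
  let b := Module.finBasis ℝ N
  let ι := Fin (Module.finrank ℝ N)
  let φ : (ι → ℝ) ≃ₗ[ℝ] N := b.equivFun.symm
  have hform : ∀ (C : E →ₗ[ℝ] E →ₗ[ℝ] ℝ) (c : ι → ℝ),
      C (φ c) (φ c) = ∑ j, ∑ k, c j * c k * C (b j) (b k) := by
    intro C c
    simp only [φ, Module.Basis.equivFun_symm_apply, AddSubmonoidClass.coe_finsetSum,
      Submodule.coe_smul, map_sum, map_smul, LinearMap.sum_apply, LinearMap.smul_apply,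
      smul_eq_mul, Finset.mul_sum]
    rw [Finset.sum_comm]
    refine Finset.sum_congr rfl fun i _ => Finset.sum_congr rfl fun j _ => by ring
  have hcont : Continuous fun c : ι → ℝ => B (φ c) (φ c) := by
    simp only [hform]; fun_prop
  obtain ⟨m, hm, hmB⟩ : ∃ m > 0, ∀ c ∈ Metric.sphere (0 : ι → ℝ) 1, B (φ c) (φ c) ≤ -m := by
    rcases (Metric.sphere (0 : ι → ℝ) 1).eq_empty_or_nonempty with he | hne
    · exact ⟨1, one_pos, by simp [he]⟩
    · obtain ⟨c, hc, hmax⟩ := (isCompact_sphere (0 : ι → ℝ) 1).exists_isMaxOn hne hcont.continuousOn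
      refine ⟨-B (φ c) (φ c), ?_, fun d hd => by simpa using hmax hd⟩
      have hc0 : c ≠ 0 := by rintro rfl; simp at hc
      have := hN (φ c) (φ c).2 (by simpa using hc0)
      linarith
  have hlim : Filter.Tendsto (fun i => ∑ j, ∑ k, |A i (b j) (b k) - B (b j) (b k)|) l (nhds 0) := by
    have : Filter.Tendsto (fun i => ∑ j, ∑ k, |A i (b j) (b k) - B (b j) (b k)|) l
        (nhds (∑ j : ι, ∑ k : ι, |B (b j) (b k) - B (b j) (b k)|)) :=
      tendsto_finsetSum _ fun j _ => tendsto_finsetSum _ fun k _ =>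
        ((hA _ _).sub tendsto_const_nhds).abs
    simpa using this
  filter_upwards [hlim.eventually_lt_const hm] with i hi
  have hsph : ∀ c ∈ Metric.sphere (0 : ι → ℝ) 1, A i (φ c) (φ c) < 0 := by
    intro c hc
    have hc1 : ‖c‖ = 1 := by simpa using hc
    have hcj : ∀ j, |c j| ≤ 1 := fun j => hc1 ▸ norm_le_pi_norm c j
    have h1 : A i (φ c) (φ c) - B (φ c) (φ c)
        ≤ ∑ j, ∑ k, |A i (b j) (b k) - B (b j) (b k)| := by
      rw [hform, hform, ← Finset.sum_sub_distrib]
      refine Finset.sum_le_sum fun j _ => ?_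
      rw [← Finset.sum_sub_distrib]
      refine Finset.sum_le_sum fun k _ => ?_
      rw [← mul_sub]
      refine (le_abs_self _).trans ?_
      rw [abs_mul, abs_mul]
      exact mul_le_of_le_one_left (abs_nonneg _)
        (mul_le_one₀ (hcj j) (abs_nonneg _) (hcj k))
    have := hmB c hc
    linarith
  intro v hv hv0
  obtain ⟨c, hc⟩ := φ.surjective ⟨v, hv⟩
  have hc' : (φ c : E) = v := by rw [hc]
  have hc0 : c ≠ 0 := by rintro rfl; exact hv0 (by simpa using hc'.symm)
  have hn : 0 < ‖c‖ := norm_pos_iff.2 hc0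
  have h2 := hsph (‖c‖⁻¹ • c) (by simp [norm_smul, hn.ne'])
  rw [map_smul, Submodule.coe_smul, hc', map_smul, map_smul, LinearMap.smul_apply, smul_eq_mul,
    smul_eq_mul] at h2
  by_contra! h3
  exact absurd h2 (not_lt.2 (by positivity))

theorem IsDefiniteSplitting.eventually_of_tendsto {E α : Type*} [AddCommGroup E] [Module ℝ E]
    [FiniteDimensional ℝ E] {l : Filter α} {A : α → E →ₗ[ℝ] E →ₗ[ℝ] ℝ} {B : E →ₗ[ℝ] E →ₗ[ℝ] ℝ}
    (hA : ∀ x y, Filter.Tendsto (fun i => A i x y) l (nhds (B x y)))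
    {N P : Submodule ℝ E} (h : IsDefiniteSplitting (fun x y => B x y) N P) :
    ∀ᶠ i in l, IsDefiniteSplitting (fun x y => A i x y) N P := by
  have hneg := eventually_negDef_of_tendsto hA h.neg
  have hpos := eventually_negDef_of_tendsto (A := fun i => -A i) (B := -B) (l := l)
    (fun x y => by simpa using (hA x y).neg) (N := P)
    (fun v hv h0 => by simpa using h.pos v hv h0)
  filter_upwards [hneg, hpos] with i h1 h2
  exact ⟨h.isCompl, h1, fun v hv h0 => by simpa using h2 v hv h0⟩

theorem negIdx_comp_linearEquiv {E F : Type*} [AddCommGroup E] [Module ℝ E]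
    [AddCommGroup F] [Module ℝ F] (B : F → F → ℝ) (e : E ≃ₗ[ℝ] F) :
    negIdx (fun x y => B (e x) (e y)) = negIdx B := by
  unfold negIdx
  congr 1
  ext n
  constructor
  · rintro ⟨T, rfl, hT⟩
    refine ⟨T.map (e : E →ₗ[ℝ] F), LinearEquiv.finrank_map_eq e T, ?_⟩
    rintro _ ⟨v, hv, rfl⟩ hv0
    exact hT v hv (by rintro rfl; simp at hv0)
  · rintro ⟨T, rfl, hT⟩
    refine ⟨T.map (e.symm : F →ₗ[ℝ] E), LinearEquiv.finrank_map_eq e.symm T, ?_⟩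
    rintro _ ⟨v, hv, rfl⟩ hv0
    simpa using hT v hv (by rintro rfl; simp at hv0)

/-- The shear-and-rescale map `(u, v, w) ↦ (u - K w, s v, t w)`. -/
def shearScale {U V W : Type*} [AddCommGroup U] [Module ℝ U] [AddCommGroup V] [Module ℝ V]
    [AddCommGroup W] [Module ℝ W] (K : W →ₗ[ℝ] U) (s t : ℝ) : U × V × W →ₗ[ℝ] U × V × W where
  toFun h := (h.1 - K h.2.2, s • h.2.1, t • h.2.2)
  map_add' x y := by
    simp only [Prod.fst_add, Prod.snd_add, map_add, smul_add, Prod.mk_add_mk, Prod.mk.injEq,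
      and_true]
    abel
  map_smul' c x := by
    simp only [Prod.smul_fst, Prod.smul_snd, map_smul, RingHom.id_apply, Prod.smul_mk, smul_sub,
      smul_comm c]

theorem shearScale_injective {U V W : Type*} [AddCommGroup U] [Module ℝ U] [AddCommGroup V]
    [Module ℝ V] [AddCommGroup W] [Module ℝ W] (K : W →ₗ[ℝ] U) {s t : ℝ} (hs : s ≠ 0)
    (ht : t ≠ 0) : Function.Injective (shearScale (V := V) K s t) := by
  rw [← LinearMap.ker_eq_bot, LinearMap.ker_eq_bot']
  rintro ⟨u, v, w⟩ h
  simp only [shearScale, LinearMap.coe_mk, AddHom.coe_mk, Prod.mk_eq_zero, smul_eq_zero, hs, ht,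
    false_or] at h
  obtain ⟨h1, rfl, rfl⟩ := h
  simpa using h1

theorem shearScale_apply {U V W : Type*} [AddCommGroup U] [Module ℝ U] [AddCommGroup V]
    [Module ℝ V] [AddCommGroup W] [Module ℝ W] (K : W →ₗ[ℝ] U) (s t : ℝ) (h : U × V × W) :
    shearScale K s t h = ((h.1 - K h.2.2, 0, 0) : U × V × W) + s • ((0, h.2.1, 0) : U × V × W)
      + t • ((0, 0, h.2.2) : U × V × W) := by
  simp [shearScale]

/-- Index of a family of symmetric bilinear forms whose blocks degenerate at different rates as
`ε → 0`: order `1` on `U`, order `ε` on `V` and order `ε²` on `W`. -/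
theorem eventually_negIdx_eq_of_graded {U V W : Type*} [AddCommGroup U] [Module ℝ U]
    [FiniteDimensional ℝ U] [AddCommGroup V] [Module ℝ V] [FiniteDimensional ℝ V]
    [AddCommGroup W] [Module ℝ W] [FiniteDimensional ℝ W]
    {H : ℝ → U × V × W →ₗ[ℝ] U × V × W →ₗ[ℝ] ℝ} {l : Filter ℝ} {σ : ℝ}
    (hl : l ≤ nhds 0) (hσ : σ * σ = 1) (hlσ : ∀ᶠ ε in l, 0 < σ * ε)
    (hsymm : ∀ᶠ ε in l, ∀ x y, H ε x y = H ε y x)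
    {BU : U →ₗ[ℝ] U →ₗ[ℝ] ℝ} {BV : V →ₗ[ℝ] V →ₗ[ℝ] ℝ} {BW : W →ₗ[ℝ] W →ₗ[ℝ] ℝ}
    (hBU : ∀ x y, BU x y = BU y x) (K : W →ₗ[ℝ] U)
    (hUU : ∀ u u', Filter.Tendsto (fun ε => H ε (u, 0, 0) (u', 0, 0)) l (nhds (BU u u')))
    (hUV : ∀ u v, ∃ c, Filter.Tendsto (fun ε => ε⁻¹ * H ε (u, 0, 0) (0, v, 0)) l (nhds c))
    (hUW : ∀ u w, Filter.Tendsto (fun ε => ε⁻¹ * H ε (u, 0, 0) (0, 0, w)) l (nhds (BU u (K w))))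
    (hVV : ∀ v v', Filter.Tendsto (fun ε => ε⁻¹ * H ε (0, v, 0) (0, v', 0)) l (nhds (BV v v')))
    (hVW : ∀ v w, ∃ c, Filter.Tendsto (fun ε => ε⁻¹ ^ 2 * H ε (0, v, 0) (0, 0, w)) l (nhds c))
    (hWW : ∀ w w', Filter.Tendsto (fun ε => ε⁻¹ ^ 2 * H ε (0, 0, w) (0, 0, w')) l
      (nhds (BW w w' + BU (K w) (K w'))))
    {NU PU : Submodule ℝ U} {NV PV : Submodule ℝ V} {NW PW : Submodule ℝ W}
    (sU : IsDefiniteSplitting (fun x y => BU x y) NU PU)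
    (sV : IsDefiniteSplitting (fun x y => σ * BV x y) NV PV)
    (sW : IsDefiniteSplitting (fun x y => BW x y) NW PW) :
    ∀ᶠ ε in l, negIdx (fun x y => H ε x y)
      = Module.finrank ℝ NU + Module.finrank ℝ NV + Module.finrank ℝ NW := by
  let r : ℝ → ℝ := fun ε => √(σ * ε)
  let Φ : ℝ → U × V × W →ₗ[ℝ] U × V × W := fun ε => shearScale K (r ε)⁻¹ ε⁻¹
  let B : U × V × W →ₗ[ℝ] U × V × W →ₗ[ℝ] ℝ :=
    BU.compl₁₂ (LinearMap.fst ℝ U (V × W)) (LinearMap.fst ℝ U (V × W))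
      + ((σ • BV).compl₁₂ (LinearMap.fst ℝ V W ∘ₗ LinearMap.snd ℝ U (V × W))
          (LinearMap.fst ℝ V W ∘ₗ LinearMap.snd ℝ U (V × W))
        + BW.compl₁₂ (LinearMap.snd ℝ V W ∘ₗ LinearMap.snd ℝ U (V × W))
          (LinearMap.snd ℝ V W ∘ₗ LinearMap.snd ℝ U (V × W)))
  have hB : ∀ x y, B x y = BU x.1 y.1 + (σ * BV x.2.1 y.2.1 + BW x.2.2 y.2.2) := fun x y => rfl
  have split : IsDefiniteSplitting (fun x y => B x y) (NU.prod (NV.prod NW))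
      (PU.prod (PV.prod PW)) := by
    have := sU.prod (by simp) (by simp) (sV.prod (by simp) (by simp) sW)
    simpa only [hB] using this
  have hr : Filter.Tendsto r l (nhds 0) := by
    have : Continuous r := by fun_prop
    have h0 := this.tendsto 0
    simp only [r, mul_zero, Real.sqrt_zero] at h0
    exact h0.mono_left hl
  have hε0 : ∀ᶠ ε in l, ε ≠ 0 := hlσ.mono fun ε h h0 => by simp [h0] at h
  have hlim : ∀ x y, Filter.Tendsto (fun ε => (H ε).compl₁₂ (Φ ε) (Φ ε) x y) l (nhds (B x y)) := by
    intro x y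
    obtain ⟨c₁, hc₁⟩ := hUV (x.1 - K x.2.2) y.2.1
    obtain ⟨c₂, hc₂⟩ := hUV (y.1 - K y.2.2) x.2.1
    obtain ⟨c₃, hc₃⟩ := hVW x.2.1 y.2.2
    obtain ⟨c₄, hc₄⟩ := hVW y.2.1 x.2.2
    have main := ((((hUU (x.1 - K x.2.2) (y.1 - K y.2.2)).add
      ((hr.const_mul σ).mul (hc₁.add hc₂))).add
      ((hUW (x.1 - K x.2.2) y.2.2).add (hUW (y.1 - K y.2.2) x.2.2))).add
      ((hVV x.2.1 y.2.1).const_mul σ)).add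
      (((hr.const_mul σ).mul (hc₃.add hc₄)).add (hWW x.2.2 y.2.2))
    refine Filter.Tendsto.congr' ?_ (main.trans (le_of_eq ?_))
    · filter_upwards [hlσ, hsymm, hε0] with ε hε hs h0
      have hrpos : 0 < r ε := Real.sqrt_pos.2 hε
      have hr2 : r ε * r ε = σ * ε := Real.mul_self_sqrt hε.le
      have e1 : (r ε)⁻¹ = σ * r ε * ε⁻¹ := by
        have : σ * r ε * ε⁻¹ * r ε = 1 := by
          rw [show σ * r ε * ε⁻¹ * r ε = σ * (r ε * r ε) * ε⁻¹ by ring, hr2,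
            show σ * (σ * ε) * ε⁻¹ = σ * σ * (ε * ε⁻¹) by ring, hσ, mul_inv_cancel₀ h0, one_mul]
        exact (eq_inv_of_mul_eq_one_left this).symm
      have e2 : (r ε)⁻¹ * (r ε)⁻¹ = σ * ε⁻¹ := by
        rw [e1, show σ * r ε * ε⁻¹ * (σ * r ε * ε⁻¹) = (σ * σ) * (r ε * r ε) * (ε⁻¹ * ε⁻¹) by ring,
          hσ, hr2, show 1 * (σ * ε) * (ε⁻¹ * ε⁻¹) = σ * ε⁻¹ * (ε * ε⁻¹) by ring,
          mul_inv_cancel₀ h0, mul_one]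
      rw [LinearMap.compl₁₂_apply]
      simp only [Φ, shearScale_apply, map_add, map_smul, LinearMap.add_apply,
        LinearMap.smul_apply, smul_eq_mul]
      rw [hs (0, x.2.1, 0) (y.1 - K y.2.2, 0, 0), hs (0, 0, x.2.2) (y.1 - K y.2.2, 0, 0),
        hs (0, 0, x.2.2) (0, y.2.1, 0)]
      generalize H ε (x.1 - K x.2.2, 0, 0) (0, y.2.1, 0) = q₁
      generalize H ε (y.1 - K y.2.2, 0, 0) (0, x.2.1, 0) = q₂
      generalize H ε (0, x.2.1, 0) (0, 0, y.2.2) = q₃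
      generalize H ε (0, y.2.1, 0) (0, 0, x.2.2) = q₄
      generalize H ε (0, x.2.1, 0) (0, y.2.1, 0) = q₅
      linear_combination -(q₁ + q₂) * e1 - q₅ * e2 - ε⁻¹ * (q₃ + q₄) * e1
    · congr 1
      rw [hB]
      simp only [map_sub, LinearMap.sub_apply]
      rw [hBU y.1 (K x.2.2), hBU (K y.2.2) (K x.2.2)]
      ring
  filter_upwards [split.eventually_of_tendsto hlim, hlσ, hε0] with ε hε hpos h0
  have hinj : Function.Injective (Φ ε) :=
    shearScale_injective K (inv_ne_zero (Real.sqrt_pos.2 hpos).ne') (inv_ne_zero h0)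
  have h1 := hε.negIdx_eq
  rw [finrank_submodule_prod, finrank_submodule_prod, ← add_assoc] at h1
  rw [← h1]
  exact (negIdx_comp_linearEquiv (fun x y => H ε x y)
    (LinearEquiv.ofInjectiveEndo (Φ ε) hinj)).symm

section DirectionalDerivative

variable {X Z : Type*} [NormedAddCommGroup X] [NormedSpace ℝ X]
  [NormedAddCommGroup Z] [NormedSpace ℝ Z]

/-- The derivative of `F` in the constant direction `z`, as a function of the base point. -/
noncomputable def dirDeriv (z : Z) (F : Z → ℝ) : Z → ℝ := fun q => fderiv ℝ F q z

variable {O : Set Z} {F : Z → ℝ}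

theorem ContDiffOn.dirDeriv (hO : IsOpen O) (hF : ContDiffOn ℝ (⊤ : ℕ∞) F O) (z : Z) :
    ContDiffOn ℝ (⊤ : ℕ∞) (dirDeriv z F) O :=
  (hF.fderiv_of_isOpen hO (by simp)).clm_apply contDiffOn_const

theorem ContDiffOn.differentiableAt_of_isOpen (hO : IsOpen O) (hF : ContDiffOn ℝ (⊤ : ℕ∞) F O)
    {q : Z} (hq : q ∈ O) : DifferentiableAt ℝ F q :=
  (hF.contDiffAt (hO.mem_nhds hq)).differentiableAt (by simp)

theorem ContDiffOn.differentiableAt_fderiv (hO : IsOpen O) (hF : ContDiffOn ℝ (⊤ : ℕ∞) F O)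
    {q : Z} (hq : q ∈ O) : DifferentiableAt ℝ (fderiv ℝ F) q :=
  ((hF.fderiv_of_isOpen (m := (⊤ : ℕ∞)) hO (by simp)).contDiffAt (hO.mem_nhds hq)).differentiableAt
    (by simp)

theorem fderiv_fderiv_eq_dirDeriv {q : Z} (h : DifferentiableAt ℝ (fderiv ℝ F) q) (a b : Z) :
    fderiv ℝ (fderiv ℝ F) q a b = dirDeriv a (dirDeriv b F) q := by
  have := (h.hasFDerivAt.clm_apply (hasFDerivAt_const b q)).fderiv
  unfold dirDeriv
  rw [this]
  simp

theorem dirDeriv_congr {G : Z → ℝ} (hO : IsOpen O) (h : Set.EqOn F G O) (z : Z) :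
    Set.EqOn (dirDeriv z F) (dirDeriv z G) O := fun q hq => by
  have : F =ᶠ[nhds q] G := Filter.eventuallyEq_of_mem (hO.mem_nhds hq) h
  simp only [dirDeriv, this.fderiv_eq]

theorem fderiv_fderiv_symm (hO : IsOpen O) (hF : ContDiffOn ℝ (⊤ : ℕ∞) F O) {q : Z} (hq : q ∈ O)
    (a b : Z) : fderiv ℝ (fderiv ℝ F) q a b = fderiv ℝ (fderiv ℝ F) q b a :=
  (hF.contDiffAt (hO.mem_nhds hq)).isSymmSndFDerivAt (by simp; exact WithTop.coe_le_coe.2 le_top) a b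

theorem dirDeriv_comm (hO : IsOpen O) (hF : ContDiffOn ℝ (⊤ : ℕ∞) F O) (a b : Z) :
    Set.EqOn (dirDeriv a (dirDeriv b F)) (dirDeriv b (dirDeriv a F)) O := fun q hq => by
  rw [← fderiv_fderiv_eq_dirDeriv (hF.differentiableAt_fderiv hO hq),
    ← fderiv_fderiv_eq_dirDeriv (hF.differentiableAt_fderiv hO hq), fderiv_fderiv_symm hO hF hq]

theorem dirDeriv_add (a b : Z) (F : Z → ℝ) (q : Z) :
    dirDeriv (a + b) F q = dirDeriv a F q + dirDeriv b F q := by simp [dirDeriv]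

/-- Directional derivatives commute with restriction to an affine subspace. -/
theorem dirDeriv_comp_affine (hO : IsOpen O) (hF : ContDiffOn ℝ (⊤ : ℕ∞) F O) {f : X → ℝ}
    (L : X →L[ℝ] Z) (c : Z) (h : ∀ x, L x + c ∈ O → f x = F (L x + c)) (v : X) :
    ∀ x, L x + c ∈ O → dirDeriv v f x = dirDeriv (L v) F (L x + c) := by
  intro x hx
  have h1 : f =ᶠ[nhds x] fun x => F (L x + c) := by
    have : Continuous fun x => L x + c := by fun_prop
    exact Filter.eventuallyEq_of_mem ((hO.preimage this).mem_nhds hx) h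
  have h2 : HasFDerivAt (fun x => L x + c) L x := L.hasFDerivAt.add_const c
  have h3 := (hF.differentiableAt_of_isOpen hO hx).hasFDerivAt.comp x h2
  simp only [dirDeriv]
  rw [h1.fderiv_eq]
  change fderiv ℝ (F ∘ fun x => L x + c) x v = _
  rw [h3.fderiv]
  rfl

theorem tendsto_inv_mul_comp_curve {γ : ℝ → Z} {γ' : Z}
    (hγ : HasDerivAt γ γ' 0) (hF : DifferentiableAt ℝ F (γ 0)) (h0 : F (γ 0) = 0) :
    Filter.Tendsto (fun ε => ε⁻¹ * F (γ ε)) (nhdsWithin 0 {0}ᶜ) (nhds (dirDeriv γ' F (γ 0))) := by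
  have := (hF.hasFDerivAt.comp_hasDerivAt 0 hγ).tendsto_slope_zero
  simpa [h0, dirDeriv] using this

/-- Second-order expansion along a differentiable curve through a degenerate zero. -/
theorem tendsto_inv_sq_mul_comp_curve (hO : IsOpen O) (hF : ContDiffOn ℝ (⊤ : ℕ∞) F O)
    {γ : ℝ → Z} {γ' : Z} (hγO : γ 0 ∈ O) (hγ : HasDerivAt γ γ' 0) (h0 : F (γ 0) = 0)
    (h1 : fderiv ℝ F (γ 0) = 0) :
    Filter.Tendsto (fun ε => ε⁻¹ ^ 2 * F (γ ε)) (nhdsWithin 0 {0}ᶜ)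
      (nhds ((1 / 2) * dirDeriv γ' (dirDeriv γ' F) (γ 0))) := by
  set z := γ 0 with hz
  set Q := fderiv ℝ (fderiv ℝ F) z with hQ
  have hQd : HasFDerivAt (fderiv ℝ F) Q z := (hF.differentiableAt_fderiv hO hγO).hasFDerivAt
  have hQs : ∀ a b, Q a b = Q b a := fderiv_fderiv_symm hO hF hγO
  let G : Z → ℝ := fun y => F y - (1 / 2) * Q (y - z) (y - z)
  have hGd : ∀ y ∈ O, HasFDerivAt G (fderiv ℝ F y - Q (y - z)) y := by
    intro y hy
    have e1 : HasFDerivAt (fun y => y - z) (ContinuousLinearMap.id ℝ Z) y :=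
      (hasFDerivAt_id y).sub_const z
    have e2 := (Q.hasFDerivAt.comp y e1).clm_apply e1
    have e3 := (hF.differentiableAt_of_isOpen hO hy).hasFDerivAt.sub (e2.const_mul (1 / 2 : ℝ))
    refine e3.congr_fderiv ?_
    ext v
    have e4 := hQs v y
    have e5 := hQs v z
    simp
    linear_combination (1 / 2) * e4 - (1 / 2) * e5
  have hGo : (fun y => G y) =o[nhds z] fun y => ‖y - z‖ ^ 2 := by
    rw [Asymptotics.isLittleO_iff]
    intro c hc
    have hlo := hQd.isLittleO
    rw [Asymptotics.isLittleO_iff] at hlo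
    obtain ⟨δ, hδ, hball⟩ := Metric.eventually_nhds_iff_ball.1 ((hlo hc).and (hO.mem_nhds hγO))
    filter_upwards [Metric.ball_mem_nhds z hδ] with y hy
    have hsub : Metric.closedBall z ‖y - z‖ ⊆ Metric.ball z δ := by
      apply Metric.closedBall_subset_ball
      simpa [dist_eq_norm] using hy
    have := (convex_closedBall z ‖y - z‖).norm_image_sub_le_of_norm_hasFDerivWithin_le
      (f := G) (C := c * ‖y - z‖) (x := z) (y := y)
      (fun p hp => (hGd p (hball p (hsub hp)).2).hasFDerivWithinAt)
      (fun p hp => by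
        have h2 := (hball p (hsub hp)).1
        rw [h1, sub_zero] at h2
        refine h2.trans ?_
        gcongr
        simpa [dist_eq_norm] using hp)
      (by simp) (by simp [dist_eq_norm])
    have hGz : G z = 0 := by simp [G, h0]
    rw [hGz, sub_zero] at this
    refine this.trans (le_of_eq ?_)
    rw [Real.norm_of_nonneg (by positivity)]
    ring
  have hslope : Filter.Tendsto (fun ε : ℝ => ε⁻¹ • (γ ε - z)) (nhdsWithin 0 {0}ᶜ) (nhds γ') := by
    simpa [hz] using hγ.tendsto_slope_zero
  have hγt : Filter.Tendsto γ (nhdsWithin 0 {0}ᶜ) (nhds z) :=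
    hγ.continuousAt.tendsto.mono_left nhdsWithin_le_nhds
  have hbig : (fun ε => ‖γ ε - z‖ ^ 2) =O[nhdsWithin 0 {0}ᶜ] fun ε : ℝ => ε ^ 2 := by
    have : (fun ε => γ ε - γ 0) =O[nhdsWithin 0 {0}ᶜ] fun ε : ℝ => ε - 0 :=
      hγ.hasFDerivAt.isBigO_sub.mono nhdsWithin_le_nhds
    simpa using this.norm_left.pow 2
  have hrem : Filter.Tendsto (fun ε => G (γ ε) / ε ^ 2) (nhdsWithin 0 {0}ᶜ) (nhds 0) :=
    ((hGo.comp_tendsto hγt).trans_isBigO hbig).tendsto_div_nhds_zero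
  have hquad : Filter.Tendsto (fun ε : ℝ => (1 / 2) * Q (ε⁻¹ • (γ ε - z)) (ε⁻¹ • (γ ε - z)))
      (nhdsWithin 0 {0}ᶜ) (nhds ((1 / 2) * Q γ' γ')) := by
    have hc : Continuous fun p : Z => (1 / 2) * Q p p := by fun_prop
    exact (hc.tendsto γ').comp hslope
  have := hrem.add hquad
  rw [zero_add, hQ, fderiv_fderiv_eq_dirDeriv (hF.differentiableAt_fderiv hO hγO)] at this
  refine this.congr fun ε => ?_
  simp only [G, map_smul, smul_apply, smul_eq_mul]
  ring

end DirectionalDerivative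

/-- The index is constant along a preconnected family of nondegenerate symmetric forms. -/
theorem negIdx_eq_of_isPreconnected {E : Type*} [AddCommGroup E] [Module ℝ E]
    [FiniteDimensional ℝ E] {H : ℝ → E →ₗ[ℝ] E →ₗ[ℝ] ℝ} {s : Set ℝ} (hs : IsPreconnected s)
    (hcont : ∀ x y, ContinuousOn (fun ε => H ε x y) s) (hsymm : ∀ ε ∈ s, ∀ x y, H ε x y = H ε y x)
    (hnd : ∀ ε ∈ s, ∀ x, (∀ y, H ε x y = 0) → x = 0) {a b : ℝ} (ha : a ∈ s) (hb : b ∈ s) :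
    negIdx (fun x y => H a x y) = negIdx (fun x y => H b x y) := by
  refine hs.constant (f := fun ε => negIdx (fun x y => H ε x y)) (fun ε hε => ?_) ha hb
  obtain ⟨N, P, h⟩ := exists_isDefiniteSplitting (H ε) (hsymm ε hε) (hnd ε hε)
  refine tendsto_nhds_of_eventually_eq ?_
  filter_upwards [h.eventually_of_tendsto fun x y => hcont x y ε hε] with ε' h'
  rw [h'.negIdx_eq, h.negIdx_eq]

section Restriction

variable {X Y Z : Type*} [NormedAddCommGroup X] [NormedSpace ℝ X] [NormedAddCommGroup Y]
  [InnerProductSpace ℝ Y] [NormedAddCommGroup Z] [NormedSpace ℝ Z] {O : Set Z} {F : Z → ℝ}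

theorem dirDeriv_rotate (hO : IsOpen O) (hF : ContDiffOn ℝ (⊤ : ℕ∞) F O) (a b c : Z) :
    Set.EqOn (dirDeriv a (dirDeriv b (dirDeriv c F))) (dirDeriv b (dirDeriv c (dirDeriv a F))) O :=
  (dirDeriv_comm hO (hF.dirDeriv hO c) a b).trans
    (dirDeriv_congr hO (dirDeriv_comm hO hF a c) b)

theorem dirDeriv_quadratic (A : Y →L[ℝ] Y) (hA : ∀ x y : Y, ⟪A x, y⟫ = ⟪x, A y⟫) (π : X →L[ℝ] Y)
    (c : ℝ) (k x : X) :
    dirDeriv k (fun x => (1 / 2) * ⟪A (π x), π x⟫ + c) x = ⟪A (π x), π k⟫ := by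
  have h1 : HasFDerivAt (fun x => A (π x)) (A ∘L π) x := (A ∘L π).hasFDerivAt
  have h2 := ((h1.inner ℝ π.hasFDerivAt).const_mul (1 / 2 : ℝ)).add_const c
  unfold dirDeriv
  rw [h2.fderiv]
  simp [hA (π k) (π x), real_inner_comm (A (π x)) (π k)]
  ring

theorem dirDeriv_linear (A : Y →L[ℝ] Y) (π : X →L[ℝ] Y) (y : Y) (h x : X) :
    dirDeriv h (fun x => ⟪A (π x), y⟫) x = ⟪A (π h), y⟫ := by
  have h1 : HasFDerivAt (fun x => A (π x)) (A ∘L π) x := (A ∘L π).hasFDerivAt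
  have h2 := h1.inner ℝ (hasFDerivAt_const y x)
  unfold dirDeriv
  rw [h2.fderiv]
  simp

/-- First and second derivatives of a function that is quadratic along an affine subspace. -/
theorem dirDeriv_dirDeriv_of_quadratic (hO : IsOpen O) (hF : ContDiffOn ℝ (⊤ : ℕ∞) F O)
    (A : Y →L[ℝ] Y) (hA : ∀ x y : Y, ⟪A x, y⟫ = ⟪x, A y⟫) (π : X →L[ℝ] Y) (c : ℝ) (L : X →L[ℝ] Z)
    (hquad : ∀ x, L x ∈ O → F (L x) = (1 / 2) * ⟪A (π x), π x⟫ + c) {x : X} (hx : L x ∈ O) :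
    (∀ k, dirDeriv (L k) F (L x) = ⟪A (π x), π k⟫) ∧
      ∀ h k, dirDeriv (L h) (dirDeriv (L k) F) (L x) = ⟪A (π h), π k⟫ := by
  have h1 : ∀ k x, L x + 0 ∈ O → ⟪A (π x), π k⟫ = dirDeriv (L k) F (L x + 0) := fun k x hx => by
    rw [← dirDeriv_quadratic A hA π c k x]
    exact dirDeriv_comp_affine hO hF L 0 (fun x hx => by simpa using (hquad x (by simpa using hx)).symm)
      k x hx
  have h2 := fun h k => dirDeriv_comp_affine hO (hF.dirDeriv hO (L k)) L 0 (h1 k) h x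
    (by simpa using hx)
  refine ⟨fun k => by simpa using (h1 k x (by simpa using hx)).symm, fun h k => ?_⟩
  have := h2 h k
  rw [dirDeriv_linear] at this
  simpa using this.symm

theorem dirDeriv_eq_zero_of_const (hO : IsOpen O) (hF : ContDiffOn ℝ (⊤ : ℕ∞) F O)
    (L : X →L[ℝ] Z) (c : ℝ) (hconst : ∀ x, L x ∈ O → F (L x) = c) {x : X} (hx : L x ∈ O) (k : X) :
    dirDeriv (L k) F (L x) = 0 := by
  have := dirDeriv_comp_affine hO hF (f := fun _ => c) L 0
    (fun x hx => by simpa using (hconst x (by simpa using hx)).symm) k x (by simpa using hx)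
  simpa [dirDeriv] using this.symm

/-- Second derivative of `t ↦ ⟪g t, M (g t)⟫` for symmetric `M`. -/
theorem dirDeriv_dirDeriv_inner_self {g : X → Y} {T : Set X} (hT : IsOpen T)
    (hg : ContDiffOn ℝ (⊤ : ℕ∞) g T) (M : Y →L[ℝ] Y) (hM : ∀ x y : Y, ⟪M x, y⟫ = ⟪x, M y⟫)
    {t : X} (ht : t ∈ T) (w w' : X) :
    dirDeriv w (dirDeriv w' fun s => ⟪g s, M (g s)⟫) t =
      2 * (⟪M (fderiv ℝ g t w), fderiv ℝ g t w'⟫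
        + dirDeriv w (dirDeriv w' fun s => ⟪g s, M (g t)⟫) t) := by
  have hgd : ∀ s ∈ T, HasFDerivAt g (fderiv ℝ g s) s := fun s hs =>
    ((hg.contDiffAt (hT.mem_nhds hs)).differentiableAt (by simp)).hasFDerivAt
  have hgdd : HasFDerivAt (fderiv ℝ g) (fderiv ℝ (fderiv ℝ g) t) t :=
    (((hg.fderiv_of_isOpen (m := (⊤ : ℕ∞)) hT (by simp)).contDiffAt
      (hT.mem_nhds ht)).differentiableAt (by simp)).hasFDerivAt
  have hMg : ∀ s ∈ T, HasFDerivAt (fun s => M (g s)) (M ∘L fderiv ℝ g s) s := fun s hs =>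
    M.hasFDerivAt.comp s (hgd s hs)
  have hgw : HasFDerivAt (fun s => fderiv ℝ g s w') ((fderiv ℝ (fderiv ℝ g) t).flip w') t := by
    refine (hgdd.clm_apply (hasFDerivAt_const w' t)).congr_fderiv ?_
    ext; simp
  have e1 : Set.EqOn (dirDeriv w' fun s => ⟪g s, M (g s)⟫)
      (fun s => 2 * ⟪fderiv ℝ g s w', M (g s)⟫) T := fun s hs => by
    unfold dirDeriv
    rw [((hgd s hs).inner ℝ (hMg s hs)).fderiv]
    simp [← hM (g s), real_inner_comm (fderiv ℝ g s w') (M (g s))]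
    ring
  have e2 : Set.EqOn (dirDeriv w' fun s => ⟪g s, M (g t)⟫)
      (fun s => ⟪fderiv ℝ g s w', M (g t)⟫) T := fun s hs => by
    unfold dirDeriv
    rw [((hgd s hs).inner ℝ (hasFDerivAt_const (M (g t)) s)).fderiv]
    simp
  rw [dirDeriv_congr hT e1 w ht, dirDeriv_congr hT e2 w ht]
  unfold dirDeriv
  rw [((hgw.inner ℝ (hMg t ht)).const_mul 2).fderiv,
    (hgw.inner ℝ (hasFDerivAt_const (M (g t)) t)).fderiv]
  simp [real_inner_comm (fderiv ℝ g t w')]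

theorem dirDeriv_dirDeriv_linear_comb {G f : Z → ℝ} (hO : IsOpen O)
    (hF : ContDiffOn ℝ (⊤ : ℕ∞) F O) (hG : ContDiffOn ℝ (⊤ : ℕ∞) G O) (α β : ℝ)
    (hf : ∀ q ∈ O, f q = α * F q + β * G q) (a b : Z) {q : Z} (hq : q ∈ O) :
    dirDeriv a (dirDeriv b f) q
      = α * dirDeriv a (dirDeriv b F) q + β * dirDeriv a (dirDeriv b G) q := by
  have step : ∀ {F G f : Z → ℝ}, ContDiffOn ℝ (⊤ : ℕ∞) F O → ContDiffOn ℝ (⊤ : ℕ∞) G O →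
      (∀ q ∈ O, f q = α * F q + β * G q) → ∀ c, ∀ q ∈ O,
        dirDeriv c f q = α * dirDeriv c F q + β * dirDeriv c G q := by
    intro F G f hF hG hf c q hq
    rw [dirDeriv_congr hO (G := fun q => α * F q + β * G q) hf c hq]
    change fderiv ℝ ((fun y => α * F y) + fun y => β * G y) q c = _
    unfold dirDeriv
    rw [(((hF.differentiableAt_of_isOpen hO hq).hasFDerivAt.const_mul α).add
      ((hG.differentiableAt_of_isOpen hO hq).hasFDerivAt.const_mul β)).fderiv]
    simp
  exact step (hF.dirDeriv hO b) (hG.dirDeriv hO b) (step hF hG hf b) a q hq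

end Restriction

/-- Morse index formula for the perturbed critical points: for `0 < ε ≤ ε₀` the
Morse index of `x_ε` equals `ind(L₀) + ind(L₁) + ind₀(S'₀)`, and for `−ε₀ ≤ ε < 0` it equals
`ind(L₀) + (dim V − ind(L₁)) + ind₀(S'₀)`. -/
theorem stmt4
    {U V W : Type*} [NormedAddCommGroup U] [InnerProductSpace ℝ U] [FiniteDimensional ℝ U]
    [NormedAddCommGroup V] [InnerProductSpace ℝ V] [FiniteDimensional ℝ V]
    [NormedAddCommGroup W] [InnerProductSpace ℝ W] [FiniteDimensional ℝ W]
    (Ω : Set (U × V × W)) (hΩ : IsOpen Ω) (hΩ0 : (0 : U × V × W) ∈ Ω)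
    (S : (U × V × W) × ℝ → ℝ) (hS : ContDiffOn ℝ (⊤ : ℕ∞) S (Ω ×ˢ Set.univ))
    (S₁ S₂ : U × V × W → ℝ)
    (hS₁def : ∀ p, S₁ p = deriv (fun e => S (p, e)) 0)
    (hS₂def : ∀ p, S₂ p = (1 / 2) * deriv (fun e => deriv (fun e' => S (p, e')) e) 0)
    (L₀ : U ≃ₗ[ℝ] U) (hL₀ : ∀ x y : U, ⟪L₀ x, y⟫ = ⟪x, L₀ y⟫) (c₀ : ℝ)
    (hNF0 : ∀ p ∈ Ω, S (p, 0) = (1 / 2) * ⟪L₀ p.1, p.1⟫ + c₀)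
    (L₁ : V ≃ₗ[ℝ] V) (hL₁ : ∀ x y : V, ⟪L₁ x, y⟫ = ⟪x, L₁ y⟫) (c₁ : ℝ)
    (hNF1 : ∀ (v : V) (w : W), ((0, v, w) : U × V × W) ∈ Ω →
      S₁ (0, v, w) = (1 / 2) * ⟪L₁ v, v⟫ + c₁)
    (g lam : W → U)
    (hg : ∀ t, g t = gradient (fun u' : U => S₁ (u', 0, t)) 0)
    (hlam : ∀ t, lam t = -(L₀.symm (g t)))
    (S₀' : W → ℝ)
    (hS₀'def : ∀ t, S₀' t = (1 / 2) * ⟪g t, lam t⟫ + S₂ (0, 0, t))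
    (hcrit0 : fderiv ℝ S₀' 0 = 0)
    (hnondeg0 : ∀ h : W, (∀ k : W, fderiv ℝ (fderiv ℝ S₀') 0 h k = 0) → h = 0)
    -- the data provided by the local perturbation result (Statement 3):
    (U₀ : Set (U × V × W)) (ε₀ : ℝ) (x : ℝ → U × V × W)
    (hU₀open : IsOpen U₀) (hU₀0 : (0 : U × V × W) ∈ U₀) (hU₀Ω : U₀ ⊆ Ω) (hε₀ : 0 < ε₀)
    (hxsmooth : ContDiffOn ℝ (⊤ : ℕ∞) x (Set.Icc (-ε₀) ε₀))
    (hxmem : ∀ ε ∈ Set.Icc (-ε₀) ε₀, x ε ∈ U₀) (hx0 : x 0 = 0)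
    (hxcrit : ∀ ε : ℝ, 0 < |ε| → |ε| ≤ ε₀ →
      fderiv ℝ (fun p => S (p, ε)) (x ε) = 0 ∧
      (∀ h : U × V × W,
        (∀ k : U × V × W, fderiv ℝ (fderiv ℝ (fun p => S (p, ε))) (x ε) h k = 0) → h = 0) ∧
      ∀ y ∈ U₀, fderiv ℝ (fun p => S (p, ε)) y = 0 → y = x ε) :
    ∀ ε : ℝ,
      (0 < ε → ε ≤ ε₀ →
        negIdx (fun h k : U × V × W => fderiv ℝ (fderiv ℝ (fun p => S (p, ε))) (x ε) h k)
          = negIdx (fun a b : U => ⟪L₀ a, b⟫)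
            + negIdx (fun a b : V => ⟪L₁ a, b⟫)
            + negIdx (fun h k : W => fderiv ℝ (fderiv ℝ S₀') 0 h k)) ∧
      (-ε₀ ≤ ε → ε < 0 →
        negIdx (fun h k : U × V × W => fderiv ℝ (fderiv ℝ (fun p => S (p, ε))) (x ε) h k)
          = negIdx (fun a b : U => ⟪L₀ a, b⟫)
            + (Module.finrank ℝ V - negIdx (fun a b : V => ⟪L₁ a, b⟫))
            + negIdx (fun h k : W => fderiv ℝ (fderiv ℝ S₀') 0 h k)) := by
  have hO : IsOpen (Ω ×ˢ (Set.univ : Set ℝ)) := hΩ.prod isOpen_univ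
  set O : Set ((U × V × W) × ℝ) := Ω ×ˢ Set.univ
  have memO : ∀ {p : U × V × W} {ε : ℝ}, p ∈ Ω → (p, ε) ∈ O := fun hp => ⟨hp, Set.mem_univ _⟩
  have memO' : ∀ {p : U × V × W} {ε : ℝ}, (p, ε) ∈ O → p ∈ Ω := fun hp => hp.1
  have h0O : (0 : (U × V × W) × ℝ) ∈ O := memO (p := 0) hΩ0
  let A₀ : U →L[ℝ] U := L₀.toLinearMap.toContinuousLinearMap
  let M : U →L[ℝ] U := L₀.symm.toLinearMap.toContinuousLinearMap
  let A₁ : V →L[ℝ] V := L₁.toLinearMap.toContinuousLinearMap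
  have hM : ∀ y z : U, ⟪M y, z⟫ = ⟪y, M z⟫ := fun y z => by
    have := hL₀ (L₀.symm y) (L₀.symm z)
    simpa [M] using this.symm
  let i : U × V × W →L[ℝ] (U × V × W) × ℝ := ContinuousLinearMap.inl ℝ _ _
  let e : (U × V × W) × ℝ := (0, 1)
  have hi : ∀ p, i p = (p, 0) := fun p => rfl
  have hG : ContDiffOn ℝ (⊤ : ℕ∞) (dirDeriv e S) O := hS.dirDeriv hO e
  -- the Hessian of `S (·, ε)` in terms of directional derivatives of `S`
  have hslice : ∀ (ε : ℝ) (k p : U × V × W), p ∈ Ω →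
      dirDeriv k (fun p => S (p, ε)) p = dirDeriv (i k) S (p, ε) := fun ε k p hp => by
    have := dirDeriv_comp_affine hO hS (f := fun p => S (p, ε)) i (0, ε)
      (fun x hx => by simp [hi]) k p (by simpa [hi] using memO hp)
    simpa [hi] using this
  have hsliceSmooth : ∀ ε : ℝ, ContDiffOn ℝ (⊤ : ℕ∞) (fun p => S (p, ε)) Ω := fun ε =>
    hS.comp (by fun_prop) fun p hp => memO hp
  have hHess : ∀ (ε : ℝ) (h k p : U × V × W), p ∈ Ω →
      fderiv ℝ (fderiv ℝ (fun p => S (p, ε))) p h k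
        = dirDeriv (i h) (dirDeriv (i k) S) (p, ε) := fun ε h k p hp => by
    rw [fderiv_fderiv_eq_dirDeriv ((hsliceSmooth ε).differentiableAt_fderiv hΩ hp)]
    have := dirDeriv_comp_affine hO (hS.dirDeriv hO (i k))
      (f := dirDeriv k (fun p => S (p, ε))) i (0, ε)
      (fun x hx => by simpa [hi] using hslice ε k x (by simpa [hi] using memO' hx)) h p
      (by simpa [hi] using memO hp)
    simpa [hi] using this
  have hS₁ : ∀ p ∈ Ω, S₁ p = dirDeriv e S (p, 0) := fun p hp => by
    have := dirDeriv_comp_affine hO hS (f := fun ε => S (p, ε))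
      (ContinuousLinearMap.inr ℝ (U × V × W) ℝ) (p, 0) (fun x hx => by simp) 1 0
      (by simpa using memO hp)
    rw [hS₁def]
    simpa [dirDeriv, e] using this
  have hS₂ : ∀ p ∈ Ω, S₂ p = (1 / 2) * dirDeriv e (dirDeriv e S) (p, 0) := fun p hp => by
    have h1 := dirDeriv_comp_affine hO hS (f := fun ε => S (p, ε))
      (ContinuousLinearMap.inr ℝ (U × V × W) ℝ) (p, 0) (fun x hx => by simp) 1
    have h2 := dirDeriv_comp_affine hO hG (f := dirDeriv 1 fun ε => S (p, ε))
      (ContinuousLinearMap.inr ℝ (U × V × W) ℝ) (p, 0) (fun x hx => by simpa [e] using h1 x hx) 1 0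
      (by simpa using memO hp)
    rw [hS₂def]
    have h3 : (fun ε => deriv (fun ε' => S (p, ε')) ε) = dirDeriv 1 fun ε => S (p, ε) := by
      funext ε; simp [dirDeriv]
    rw [h3]
    simpa [dirDeriv, e] using h2
  -- consequences of the normal form hypotheses
  have hNF0' : ∀ p ∈ Ω, (∀ k, dirDeriv (i k) S (p, 0) = ⟪L₀ p.1, k.1⟫) ∧
      ∀ h k, dirDeriv (i h) (dirDeriv (i k) S) (p, 0) = ⟪L₀ h.1, k.1⟫ := fun p hp =>
    dirDeriv_dirDeriv_of_quadratic hO hS A₀ hL₀ (ContinuousLinearMap.fst ℝ U (V × W)) c₀ i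
      (fun p hp => hNF0 p (memO' hp)) (x := p) (memO hp)
  let j : V × W →L[ℝ] (U × V × W) × ℝ := i ∘L ContinuousLinearMap.inr ℝ U (V × W)
  have hj : ∀ y, j y = ((0, y), 0) := fun y => rfl
  have hNF1' : ∀ y : V × W, ((0, y) : U × V × W) ∈ Ω →
      ∀ h k, dirDeriv (j h) (dirDeriv (j k) (dirDeriv e S)) (j y) = ⟪L₁ h.1, k.1⟫ := fun y hy =>
    (dirDeriv_dirDeriv_of_quadratic hO hG A₁ hL₁ (ContinuousLinearMap.fst ℝ V W) c₁ j
      (fun y hy => by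
        rw [hj, ← hS₁ ((0, y) : U × V × W) (memO' hy)]
        exact hNF1 y.1 y.2 (memO' hy)) (x := y) (memO hy)).2
  -- the gradient `g` and the reduced function
  let iU : U →L[ℝ] (U × V × W) × ℝ := i ∘L ContinuousLinearMap.inl ℝ U (V × W)
  let iW : W →L[ℝ] (U × V × W) × ℝ := j ∘L ContinuousLinearMap.inr ℝ V W
  have hiU : ∀ u, iU u = ((u, 0, 0), 0) := fun u => rfl
  have hiW : ∀ t, iW t = ((0, 0, t), 0) := fun t => rfl
  let T : Set W := iW ⁻¹' O
  have hT : IsOpen T := hO.preimage iW.continuous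
  have h0T : (0 : W) ∈ T := by simpa [T] using h0O
  have hgU : ∀ t ∈ T, ∀ u, ⟪g t, u⟫ = dirDeriv (iU u) (dirDeriv e S) (iW t) := by
    intro t ht u
    have := dirDeriv_comp_affine hO hG (f := fun u' : U => S₁ (u', 0, t)) iU (iW t)
      (fun u' hu' => by
        have h1 : iU u' + iW t = ((u', 0, t), 0) := by simp [hiU, hiW]
        rw [h1] at hu' ⊢
        exact hS₁ _ (memO' hu')) u 0 (by rw [map_zero, zero_add]; exact ht)
    rw [map_zero, zero_add] at this
    rw [← this, hg, gradient, InnerProductSpace.toDual_symm_apply]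
    rfl
  have hgsmooth : ContDiffOn ℝ (⊤ : ℕ∞) g T := by
    have h1 : ContDiffOn ℝ (⊤ : ℕ∞) (fun t => (InnerProductSpace.toDual ℝ U).symm
        (fderiv ℝ (dirDeriv e S) (iW t) ∘L iU)) T := by
      have h2 : ContDiffOn ℝ (⊤ : ℕ∞) (fun t => fderiv ℝ (dirDeriv e S) (iW t)) T :=
        (hG.fderiv_of_isOpen hO (by simp)).comp iW.contDiff.contDiffOn fun t ht => ht
      exact (InnerProductSpace.toDual ℝ U).symm.contDiff.comp_contDiffOn
        (h2.clm_comp contDiffOn_const)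
    refine h1.congr fun t ht => ext_inner_right ℝ fun u => ?_
    rw [hgU t ht, InnerProductSpace.toDual_symm_apply]
    rfl
  let Dg : W →L[ℝ] U := fderiv ℝ g 0
  have hDg : ∀ w u, ⟪Dg w, u⟫ = dirDeriv (iW w) (dirDeriv (iU u) (dirDeriv e S)) 0 := by
    intro w u
    have h1 := dirDeriv_comp_affine hO (hG.dirDeriv hO (iU u)) (f := fun t => ⟪g t, u⟫) iW 0
      (fun t ht => by simpa using hgU t (by simpa [T] using ht) u) w 0 (by simpa using h0O)
    have h2 := ((hgsmooth.contDiffAt (hT.mem_nhds h0T)).differentiableAt (by simp)).hasFDerivAt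
    have h3 : dirDeriv w (fun t => ⟪g t, u⟫) 0 = ⟪Dg w, u⟫ := by
      unfold dirDeriv
      rw [(h2.inner ℝ (hasFDerivAt_const u (0 : W))).fderiv]
      simp [Dg]
    rw [← h3, h1]
    simp
  have hDDg : ∀ w w' u, dirDeriv w (dirDeriv w' fun t => ⟪g t, u⟫) 0
      = dirDeriv (iW w) (dirDeriv (iW w') (dirDeriv (iU u) (dirDeriv e S))) 0 := by
    intro w w' u
    have h1 := dirDeriv_comp_affine hO (hG.dirDeriv hO (iU u)) (f := fun t => ⟪g t, u⟫) iW 0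
      (fun t ht => by simpa using hgU t (by simpa [T] using ht) u) w'
    have h2 := dirDeriv_comp_affine hO ((hG.dirDeriv hO (iU u)).dirDeriv hO (iW w')) iW 0 h1 w 0
      (by simpa using h0O)
    simpa using h2
  have hTT : ∀ w w', dirDeriv w (dirDeriv w' fun t => dirDeriv e (dirDeriv e S) (iW t)) 0
      = dirDeriv (iW w) (dirDeriv (iW w') (dirDeriv e (dirDeriv e S))) 0 := by
    intro w w'
    have h1 := dirDeriv_comp_affine hO (hG.dirDeriv hO e)
      (f := fun t => dirDeriv e (dirDeriv e S) (iW t)) iW 0 (fun t ht => by simp) w'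
    have h2 := dirDeriv_comp_affine hO ((hG.dirDeriv hO e).dirDeriv hO (iW w')) iW 0 h1 w 0
      (by simpa using h0O)
    simpa using h2
  have hgMg : ContDiffOn ℝ (⊤ : ℕ∞) (fun t => ⟪g t, M (g t)⟫) T :=
    hgsmooth.inner ℝ (M.contDiff.comp_contDiffOn hgsmooth)
  have hTS : ContDiffOn ℝ (⊤ : ℕ∞) (fun t => dirDeriv e (dirDeriv e S) (iW t)) T :=
    (hG.dirDeriv hO e).comp iW.contDiff.contDiffOn fun t ht => ht
  have hS₀eq : ∀ t ∈ T, S₀' t = (-(1 / 2)) * ⟪g t, M (g t)⟫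
      + (1 / 2) * dirDeriv e (dirDeriv e S) (iW t) := fun t ht => by
    rw [hS₀'def, hlam, hS₂ ((0, 0, t) : U × V × W) (memO' ht), inner_neg_right, hiW]
    simp [M]
  have hS₀smooth : ContDiffOn ℝ (⊤ : ℕ∞) S₀' T :=
    ((contDiffOn_const.mul hgMg).add (contDiffOn_const.mul hTS)).congr hS₀eq
  have hHessS₀ : ∀ w w', fderiv ℝ (fderiv ℝ S₀') 0 w w' = -⟪M (Dg w), Dg w'⟫
      + dirDeriv (iW w) (dirDeriv (iW w') (dirDeriv (iU (lam 0)) (dirDeriv e S))) 0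
      + (1 / 2) * dirDeriv (iW w) (dirDeriv (iW w') (dirDeriv e (dirDeriv e S))) 0 := by
    intro w w'
    have hlam0 : M (g 0) = -lam 0 := by simp [hlam, M]
    rw [fderiv_fderiv_eq_dirDeriv (hS₀smooth.differentiableAt_fderiv hT h0T),
      dirDeriv_dirDeriv_linear_comb hT hgMg hTS _ _ hS₀eq w w' h0T,
      dirDeriv_dirDeriv_inner_self hT hgsmooth M hM h0T, hTT, hDDg, hlam0, map_neg]
    have h1 : ∀ q, dirDeriv (-iU (lam 0)) (dirDeriv e S) q
        = (-1) * dirDeriv (iU (lam 0)) (dirDeriv e S) q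
          + 0 * dirDeriv (iU (lam 0)) (dirDeriv e S) q := by
      intro q; simp [dirDeriv]
    rw [dirDeriv_dirDeriv_linear_comb hO (hG.dirDeriv hO (iU (lam 0)))
      (hG.dirDeriv hO (iU (lam 0))) (-1) 0 (fun q _ => h1 q) _ _ h0O]
    ring
  -- the path of critical points
  have hIcc : Set.Icc (-ε₀) ε₀ ∈ nhds (0 : ℝ) := Icc_mem_nhds (by linarith) hε₀
  obtain ⟨b, hb⟩ : ∃ b, HasDerivAt x b 0 :=
    ⟨_, ((hxsmooth.contDiffAt hIcc).differentiableAt (by simp)).hasDerivAt⟩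
  let γ : ℝ → (U × V × W) × ℝ := fun ε => (x ε, ε)
  have hγ0 : γ 0 = 0 := by simp [γ, hx0]
  have hγ : HasDerivAt γ (i b + e) 0 := by
    have := hb.prodMk (hasDerivAt_id (0 : ℝ))
    simpa [hi, e] using this
  have hxΩ : ∀ ε ∈ Set.Icc (-ε₀) ε₀, x ε ∈ Ω := fun ε hε => hU₀Ω (hxmem ε hε)
  have hb1 : b.1 = lam 0 := by
    have key : L₀ b.1 = -g 0 := ext_inner_right ℝ fun u => by
      have hF := hS.dirDeriv hO (iU u)
      have hzero : ∀ ε ∈ Set.Icc (-ε₀) ε₀, dirDeriv (iU u) S (γ ε) = 0 := by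
        intro ε hε
        rcases eq_or_ne ε 0 with rfl | hne
        · have := (hNF0' 0 hΩ0).1 (u, 0, 0)
          rw [hγ0]
          exact this.trans (by simp)
        · have h1 := (hxcrit ε (abs_pos.2 hne) (abs_le.2 hε)).1
          have h2 := hslice ε (u, 0, 0) (x ε) (hxΩ ε hε)
          simp only [dirDeriv, h1] at h2
          exact h2.symm
      have h1 := tendsto_inv_mul_comp_curve hγ
        (by rw [hγ0]; exact hF.differentiableAt_of_isOpen hO h0O)
        (hzero 0 ⟨by linarith, hε₀.le⟩)
      have h2 : Filter.Tendsto (fun ε => ε⁻¹ * dirDeriv (iU u) S (γ ε)) (nhdsWithin 0 {0}ᶜ)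
          (nhds 0) := by
        refine tendsto_const_nhds.congr' ?_
        filter_upwards [nhdsWithin_le_nhds hIcc] with ε hε
        rw [hzero ε hε, mul_zero]
      have h3 := tendsto_nhds_unique h1 h2
      rw [dirDeriv_add, hγ0, dirDeriv_comm hO hS e (iU u) h0O] at h3
      have h4 : dirDeriv (i b) (dirDeriv (iU u) S) 0 = ⟪L₀ b.1, u⟫ := (hNF0' 0 hΩ0).2 b (u, 0, 0)
      have h5 := hgU 0 h0T u
      rw [map_zero] at h5
      rw [h4, ← h5] at h3
      rw [inner_neg_left]
      linarith
    rw [hlam, ← map_neg, ← key, LinearEquiv.symm_apply_apply]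
  -- expansion of the blocks of the Hessian along the path
  have hF2 : ∀ h k, ContDiffOn ℝ (⊤ : ℕ∞) (dirDeriv (i h) (dirDeriv (i k) S)) O := fun h k =>
    (hS.dirDeriv hO (i k)).dirDeriv hO (i h)
  have hF0 : ∀ h k, ⟪L₀ h.1, k.1⟫ = 0 → ∀ p, i p ∈ O →
      dirDeriv (i h) (dirDeriv (i k) S) (i p) = 0 := fun h k h0 p hp =>
    ((hNF0' p (memO' hp)).2 h k).trans h0
  have hF1 : ∀ h k, ⟪L₀ h.1, k.1⟫ = 0 → ∀ z p, i p ∈ O →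
      dirDeriv (i z) (dirDeriv (i h) (dirDeriv (i k) S)) (i p) = 0 := fun h k h0 z p hp =>
    dirDeriv_eq_zero_of_const hO (hF2 h k) i 0 (hF0 h k h0) hp z
  have hi0 : i 0 = 0 := map_zero i
  have h0O' : i 0 ∈ O := by rwa [hi0]
  have lim₁ : ∀ h k, ⟪L₀ h.1, k.1⟫ = 0 →
      Filter.Tendsto (fun ε => ε⁻¹ * dirDeriv (i h) (dirDeriv (i k) S) (γ ε)) (nhdsWithin 0 {0}ᶜ)
        (nhds (dirDeriv (i h) (dirDeriv (i k) (dirDeriv e S)) 0)) := by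
    intro h k h0
    have h1 := tendsto_inv_mul_comp_curve hγ (F := dirDeriv (i h) (dirDeriv (i k) S))
      (by rw [hγ0]; exact (hF2 h k).differentiableAt_of_isOpen hO h0O)
      (by rw [hγ0, ← hi0]; exact hF0 h k h0 0 h0O')
    have h2 := hF1 h k h0 b 0 h0O'
    rw [hi0] at h2
    rwa [hγ0, dirDeriv_add, h2, zero_add, dirDeriv_rotate hO hS e _ _ h0O] at h1
  have lim₂ : ∀ h k, ⟪L₀ h.1, k.1⟫ = 0 →
      dirDeriv (i h) (dirDeriv (i k) (dirDeriv e S)) 0 = 0 →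
      Filter.Tendsto (fun ε => ε⁻¹ ^ 2 * dirDeriv (i h) (dirDeriv (i k) S) (γ ε))
        (nhdsWithin 0 {0}ᶜ)
        (nhds (dirDeriv (i b) (dirDeriv (i h) (dirDeriv (i k) (dirDeriv e S))) 0
          + (1 / 2) * dirDeriv (i h) (dirDeriv (i k) (dirDeriv e (dirDeriv e S))) 0)) := by
    intro h k h0 h0'
    have hd : fderiv ℝ (dirDeriv (i h) (dirDeriv (i k) S)) (γ 0) = 0 := by
      have hdi := hF1 h k h0
      have hde := (dirDeriv_rotate hO hS e (i h) (i k) h0O).trans h0'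
      refine ContinuousLinearMap.ext fun z => ?_
      have hz : z = i z.1 + z.2 • e := Prod.ext (by simp [hi, e]) (by simp [hi, e])
      have h1 := hdi z.1 0 h0O'
      rw [hi0] at h1
      unfold dirDeriv at h1 hde
      rw [hγ0, hz, map_add, map_smul]
      unfold dirDeriv
      rw [h1, hde]
      simp
    have h1 := tendsto_inv_sq_mul_comp_curve hO (hF2 h k) (by rwa [hγ0]) hγ
      (by rw [hγ0, ← hi0]; exact hF0 h k h0 0 h0O') hd
    refine h1.trans (le_of_eq (congrArg nhds ?_))
    have hdd := (hF2 h k).differentiableAt_fderiv hO h0O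
    have h2 : dirDeriv (i b) (dirDeriv (i b) (dirDeriv (i h) (dirDeriv (i k) S))) 0 = 0 := by
      have := dirDeriv_eq_zero_of_const hO ((hF2 h k).dirDeriv hO (i b)) i 0 (hF1 h k h0 b) h0O' b
      rwa [hi0] at this
    have h3 := dirDeriv_congr hO (dirDeriv_rotate hO hS e (i h) (i k)) (i b) h0O
    have h4 := (dirDeriv_congr hO (dirDeriv_rotate hO hS e (i h) (i k)) e h0O).trans
      (dirDeriv_rotate hO hG e (i h) (i k) h0O)
    rw [hγ0, ← fderiv_fderiv_eq_dirDeriv hdd, map_add, map_add, add_apply, add_apply,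
      fderiv_fderiv_symm hO (hF2 h k) h0O e (i b), fderiv_fderiv_eq_dirDeriv hdd,
      fderiv_fderiv_eq_dirDeriv hdd, fderiv_fderiv_eq_dirDeriv hdd, h2, h3, h4]
    ring
  have hww : ∀ w w', dirDeriv (i b) (dirDeriv (iW w) (dirDeriv (iW w') (dirDeriv e S))) 0
      = dirDeriv (iW w) (dirDeriv (iW w') (dirDeriv (iU (lam 0)) (dirDeriv e S))) 0 := by
    intro w w'
    have h1 : i b = iU (lam 0) + j b.2 := by
      rw [← hb1, hiU, hj, hi]
      exact Prod.ext (Prod.ext (by simp) (by simp)) (by simp)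
    have h2 := dirDeriv_eq_zero_of_const hO ((hG.dirDeriv hO (iW w')).dirDeriv hO (iW w)) j 0
      (fun y hy => (hNF1' y (memO' hy) (0, w) (0, w')).trans (by simp)) (x := 0)
      (by rwa [map_zero]) b.2
    rw [map_zero] at h2
    rw [h1, dirDeriv_add, h2, add_zero, dirDeriv_rotate hO hG _ _ _ h0O]
  -- the forms entering the limit
  let H : ℝ → (U × V × W) →ₗ[ℝ] (U × V × W) →ₗ[ℝ] ℝ := fun ε =>
    ContinuousLinearMap.toLinearMap₁₂ (fderiv ℝ (fderiv ℝ (fun p => S (p, ε))) (x ε))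
  have hH : ∀ ε ∈ Set.Icc (-ε₀) ε₀, ∀ h k,
      H ε h k = dirDeriv (i h) (dirDeriv (i k) S) (γ ε) := fun ε hε h k =>
    hHess ε h k (x ε) (hxΩ ε hε)
  have hHsymm : ∀ ε ∈ Set.Icc (-ε₀) ε₀, ∀ h k, H ε h k = H ε k h := fun ε hε h k =>
    fderiv_fderiv_symm hΩ (hsliceSmooth ε) (hxΩ ε hε) h k
  have hHcont : ∀ h k, ContinuousOn (fun ε => H ε h k) (Set.Icc (-ε₀) ε₀) := fun h k =>
    ((hF2 h k).continuousOn.comp (hxsmooth.continuousOn.prodMk continuousOn_id)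
      fun ε hε => memO (hxΩ ε hε)).congr fun ε hε => hH ε hε h k
  let BU : U →ₗ[ℝ] U →ₗ[ℝ] ℝ := (innerₗ U) ∘ₗ L₀.toLinearMap
  let BV : V →ₗ[ℝ] V →ₗ[ℝ] ℝ := (innerₗ V) ∘ₗ L₁.toLinearMap
  let BW : W →ₗ[ℝ] W →ₗ[ℝ] ℝ := ContinuousLinearMap.toLinearMap₁₂ (fderiv ℝ (fderiv ℝ S₀') 0)
  have hBU : ∀ y z, BU y z = ⟪L₀ y, z⟫ := fun y z => rfl
  have hBV : ∀ y z, BV y z = ⟪L₁ y, z⟫ := fun y z => rfl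
  have hBUsymm : ∀ y z, BU y z = BU z y := fun y z => by
    rw [hBU, hBU, hL₀, real_inner_comm]
  have hBVsymm : ∀ y z, BV y z = BV z y := fun y z => by
    rw [hBV, hBV, hL₁, real_inner_comm]
  obtain ⟨NU, PU, sU⟩ := exists_isDefiniteSplitting BU hBUsymm fun y hy => by
    simpa using inner_self_eq_zero.1 (hy (L₀ y))
  obtain ⟨NV, PV, sV⟩ := exists_isDefiniteSplitting BV hBVsymm fun y hy => by
    simpa using inner_self_eq_zero.1 (hy (L₁ y))
  obtain ⟨NW, PW, sW⟩ := exists_isDefiniteSplitting BW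
    (fderiv_fderiv_symm hT hS₀smooth h0T) hnondeg0
  let K : W →ₗ[ℝ] U := M.toLinearMap ∘ₗ Dg.toLinearMap
  have main : ∀ (σ : ℝ) (l : Filter ℝ) (N P : Submodule ℝ V), l ≤ nhdsWithin 0 {0}ᶜ → σ * σ = 1 →
      (∀ᶠ ε in l, 0 < σ * ε) → IsDefiniteSplitting (fun y z => σ * BV y z) N P →
      ∀ᶠ ε in l, negIdx (fun h k => H ε h k)
        = Module.finrank ℝ NU + Module.finrank ℝ N + Module.finrank ℝ NW := by
    intro σ l N P hl hσ hlσ sN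
    have hl0 : l ≤ nhds 0 := hl.trans nhdsWithin_le_nhds
    have hlIcc : ∀ᶠ ε in l, ε ∈ Set.Icc (-ε₀) ε₀ := hl0 hIcc
    have tr : ∀ {h k : U × V × W} {f : ℝ → ℝ} {c : ℝ}, Filter.Tendsto
        (fun ε => f ε * dirDeriv (i h) (dirDeriv (i k) S) (γ ε)) (nhdsWithin 0 {0}ᶜ) (nhds c) →
        Filter.Tendsto (fun ε => f ε * H ε h k) l (nhds c) := fun {h k f c} ht =>
      (ht.mono_left hl).congr' (hlIcc.mono fun ε hε => by simp only [hH ε hε])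
    refine eventually_negIdx_eq_of_graded hl0 hσ hlσ (hlIcc.mono hHsymm) hBUsymm K
      (fun u u' => ?_) (fun u v => ⟨_, tr (lim₁ _ _ (by simp))⟩)
      (fun u w => ?_) (fun v v' => ?_) (fun v w => ⟨_, tr (lim₂ _ _ (by simp) ?_)⟩)
      (fun w w' => ?_) sU sN sW
    · have h1 := ((hHcont (u, 0, 0) (u', 0, 0)).continuousAt hIcc).tendsto.mono_left hl0
      rw [hH 0 (mem_of_mem_nhds hIcc), hγ0] at h1
      exact h1.trans (le_of_eq (congrArg nhds ((hNF0' 0 hΩ0).2 (u, 0, 0) (u', 0, 0))))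
    · refine (tr (lim₁ _ _ (by simp))).trans (le_of_eq (congrArg nhds ?_))
      have h1 : ⟪Dg w, u⟫ = dirDeriv (iU u) (dirDeriv (iW w) (dirDeriv e S)) 0 := by
        rw [hDg, dirDeriv_comm hO hG _ _ h0O]
      refine h1.symm.trans ?_
      rw [hBUsymm, hBU]
      simp [K, M]
    · refine (tr (lim₁ _ _ (by simp))).trans (le_of_eq (congrArg nhds ?_))
      have := hNF1' 0 hΩ0 (v, 0) (v', 0)
      rw [map_zero] at this
      exact this
    · have := hNF1' 0 hΩ0 (v, 0) (0, w)
      rw [map_zero] at this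
      exact this.trans (by simp)
    · refine (tr (lim₂ _ _ (by simp) ?_)).trans (le_of_eq (congrArg nhds ?_))
      · have := hNF1' 0 hΩ0 (0, w) (0, w')
        rw [map_zero] at this
        exact this.trans (by simp)
      · have h1 : BW w w' = _ := hHessS₀ w w'
        have h2 : BU (K w) (K w') = ⟪M (Dg w), Dg w'⟫ := by
          rw [hBU, hM]
          simp [K, M]
        rw [h1, h2, ← hww]
        change dirDeriv (i b) (dirDeriv (iW w) (dirDeriv (iW w') (dirDeriv e S))) 0
          + (1 / 2) * dirDeriv (iW w) (dirDeriv (iW w') (dirDeriv e (dirDeriv e S))) 0 = _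
        ring
  have const : ∀ s : Set ℝ, s ⊆ Set.Icc (-ε₀) ε₀ → (∀ ε ∈ s, ε ≠ 0) → IsPreconnected s →
      ∀ a ∈ s, ∀ a' ∈ s, negIdx (fun h k => H a h k) = negIdx (fun h k => H a' h k) :=
    fun s hs hs0 hsc a ha a' ha' => negIdx_eq_of_isPreconnected hsc
      (fun h k => (hHcont h k).mono hs) (fun ε hε => hHsymm ε (hs hε))
      (fun ε hε => (hxcrit ε (abs_pos.2 (hs0 ε hε)) (abs_le.2 (hs hε))).2.1) ha ha'
  have eU : negIdx (fun a b : U => ⟪L₀ a, b⟫) = Module.finrank ℝ NU := sU.negIdx_eq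
  have eV : negIdx (fun a b : V => ⟪L₁ a, b⟫) = Module.finrank ℝ NV := sV.negIdx_eq
  have eW : negIdx (fun h k : W => fderiv ℝ (fderiv ℝ S₀') 0 h k) = Module.finrank ℝ NW :=
    sW.negIdx_eq
  rw [eU, eV, eW]
  refine fun ε => ⟨fun hε hε' => ?_, fun hε hε' => ?_⟩
  · have h1 := main 1 (nhdsWithin 0 (Set.Ioi 0)) NV PV
      (nhdsWithin_mono _ fun y hy => ne_of_gt hy) (by norm_num)
      (by filter_upwards [self_mem_nhdsWithin] with y hy; simpa using hy)
      (by simpa only [one_mul] using sV)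
    obtain ⟨a, ha, ha'⟩ := (h1.and (Ioc_mem_nhdsGT hε₀)).exists
    rw [← ha]
    exact const (Set.Ioc 0 ε₀) (fun y hy => ⟨by linarith [hy.1], hy.2⟩) (fun y hy => hy.1.ne')
      isPreconnected_Ioc ε ⟨hε, hε'⟩ a ha'
  · have h1 := main (-1) (nhdsWithin 0 (Set.Iio 0)) PV NV
      (nhdsWithin_mono _ fun y hy => ne_of_lt hy) (by norm_num)
      (by filter_upwards [self_mem_nhdsWithin] with y hy; simpa using hy)
      (by simpa only [neg_mul, one_mul] using sV.neg_form)
    obtain ⟨a, ha, ha'⟩ := (h1.and (Ico_mem_nhdsLT (neg_neg_of_pos hε₀))).exists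
    have h2 := Submodule.finrank_add_eq_of_isCompl sV.isCompl
    rw [← h2, Nat.add_sub_cancel_left, ← ha]
    exact const (Set.Ico (-ε₀) 0) (fun y hy => ⟨hy.1, by linarith [hy.2]⟩) (fun y hy => hy.2.ne)
      isPreconnected_Ico ε ⟨hε, hε'⟩ a ha'
end
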